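/- arXiv:1105.6027 — 8 statements merged into one kernel-verified Lean document; each statement's English description precedes it below -/
import Mathlib

section
/- Let N be a finite set and let A, B, C be pairwise disjoint subsets of N with A and B nonempty. Fix enumerations A = {a_1, …, a_m} and B = {b_1, …, b_n} (with the a_i distinct and the b_j distinct). Then u_{⟨A,B|C⟩} = Σ_{i=1}^{m} Σ_{j=1}^{n} u_{⟨a_i, b_j | {a_1,…,a_{i−1}} ∪ {b_1,…,b_{j−1}} ∪ C⟩}. In particular, u_{⟨A,B|C⟩} admits at least one representation by elementary imsets from E_{⟨A,B|C⟩}, i.e., the fiber F_{⟨A,B|C⟩} is nonempty. -/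
open Finset

/-- The semi-elementary imset `u_{⟨A,B|C⟩}` as a `ℤ`-valued function on finite sets. -/
def uim {α : Type*} [DecidableEq α] (A B C : Finset α) : Finset α → ℤ := fun S =>
  (if S = A ∪ B ∪ C then 1 else 0) + (if S = C then 1 else 0)
    - (if S = A ∪ C then 1 else 0) - (if S = B ∪ C then 1 else 0)

/-- `θ` is a representation of `u_{⟨A,B|C⟩}` by elementary imsets from `E_{⟨A,B|C⟩}`:
`θ` is supported on the triples `(a, b, Γ)` with `a ∈ A`, `b ∈ B`, `C ⊆ Γ ⊆ A ∪ B ∪ C`,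
`a, b ∉ Γ`, and the corresponding nonnegative integer combination of elementary imsets
equals `u_{⟨A,B|C⟩}`. -/
def IsRep {α : Type*} [DecidableEq α] (A B C : Finset α) (θ : α → α → Finset α → ℕ) : Prop :=
  (∀ a b Γ, θ a b Γ ≠ 0 →
      a ∈ A ∧ b ∈ B ∧ C ⊆ Γ ∧ Γ ⊆ A ∪ B ∪ C ∧ a ∉ Γ ∧ b ∉ Γ) ∧
  ∀ S : Finset α, uim A B C S =
      ∑ a ∈ A, ∑ b ∈ B, ∑ Γ ∈ (A ∪ B ∪ C).powerset, (θ a b Γ : ℤ) * uim {a} {b} Γ S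

/-- The image under `f` of the first `k` indices. -/
def imageBelow {α : Type*} [DecidableEq α] {m : ℕ} (f : Fin m → α) (k : ℕ) : Finset α :=
  (Finset.univ.filter fun i : Fin m => (i : ℕ) < k).image f

section ImageBelow

variable {α : Type*} [DecidableEq α] {m : ℕ} (f : Fin m → α)

theorem imageBelow_zero : imageBelow f 0 = ∅ := by
  simp [imageBelow]

theorem imageBelow_self : imageBelow f m = Finset.univ.image f := by
  simp [imageBelow]

theorem image_Iio_eq_imageBelow (i : Fin m) : (Finset.Iio i).image f = imageBelow f i := by
  unfold imageBelow
  congr 1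
  ext j
  simp

theorem imageBelow_succ (i : Fin m) :
    imageBelow f ((i : ℕ) + 1) = {f i} ∪ imageBelow f i := by
  have h : (Finset.univ.filter fun j : Fin m => (j : ℕ) < (i : ℕ) + 1) =
      insert i (Finset.univ.filter fun j : Fin m => (j : ℕ) < (i : ℕ)) := by
    ext j
    simp only [Finset.mem_filter, Finset.mem_univ, true_and, Finset.mem_insert, Fin.ext_iff]
    omega
  rw [imageBelow, h, Finset.image_insert, Finset.insert_eq, imageBelow]

end ImageBelow

/-- The mixed difference of a function of two natural variables telescopes. -/
theorem sum_sum_mixed_sub (g : ℕ → ℕ → ℤ) (m n : ℕ) :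
    ∑ i : Fin m, ∑ j : Fin n,
      (g (i + 1) (j + 1) + g i j - g (i + 1) j - g i (j + 1)) =
    g m n + g 0 0 - g m 0 - g 0 n := by
  have inner : ∀ i : ℕ, ∑ j : Fin n, (g (i + 1) (j + 1) + g i j - g (i + 1) j - g i (j + 1)) =
      (g (i + 1) n - g (i + 1) 0) - (g i n - g i 0) := by
    intro i
    rw [Fin.sum_univ_eq_sum_range
      (fun j => g (i + 1) (j + 1) + g i j - g (i + 1) j - g i (j + 1)) n,
      ← Finset.sum_range_sub (g (i + 1)) n, ← Finset.sum_range_sub (g i) n,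
      ← Finset.sum_sub_distrib]
    exact Finset.sum_congr rfl fun j _ => by ring
  simp only [inner]
  rw [Fin.sum_univ_eq_sum_range
      (fun i => (g (i + 1) n - g (i + 1) 0) - (g i n - g i 0)) m,
    Finset.sum_range_sub (fun i => g i n - g i 0) m]
  ring

theorem uim_image_eq_sum {α : Type*} [DecidableEq α] {m n : ℕ} (a : Fin m → α) (b : Fin n → α)
    (C S : Finset α) :
    uim (Finset.univ.image a) (Finset.univ.image b) C S = ∑ i : Fin m, ∑ j : Fin n,
      uim {a i} {b j} (((Finset.Iio i).image a) ∪ ((Finset.Iio j).image b) ∪ C) S := by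
  have h := sum_sum_mixed_sub
    (fun i j => if S = imageBelow a i ∪ imageBelow b j ∪ C then 1 else 0) m n
  simp only [imageBelow_zero, imageBelow_self, Finset.empty_union, Finset.union_empty] at h
  rw [uim, ← h]
  refine Finset.sum_congr rfl fun i _ => Finset.sum_congr rfl fun j _ => ?_
  simp only [uim, image_Iio_eq_imageBelow, imageBelow_succ]
  have hab : {a i} ∪ {b j} ∪ (imageBelow a i ∪ imageBelow b j ∪ C) =
      {a i} ∪ imageBelow a i ∪ ({b j} ∪ imageBelow b j) ∪ C := by ac_rfl
  have hi : {a i} ∪ (imageBelow a i ∪ imageBelow b j ∪ C) =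
      {a i} ∪ imageBelow a i ∪ imageBelow b j ∪ C := by ac_rfl
  have hj : {b j} ∪ (imageBelow a i ∪ imageBelow b j ∪ C) =
      imageBelow a i ∪ ({b j} ∪ imageBelow b j) ∪ C := by ac_rfl
  rw [hab, hi, hj]

theorem stmt2 {α : Type*} [DecidableEq α] (N A B C : Finset α) {m n : ℕ}
    (a : Fin m → α) (b : Fin n → α)
    (hA : A ⊆ N) (hB : B ⊆ N) (hC : C ⊆ N)
    (hAB : Disjoint A B) (hAC : Disjoint A C) (hBC : Disjoint B C)
    (hAne : A.Nonempty) (hBne : B.Nonempty)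
    (ha : Function.Injective a) (hb : Function.Injective b)
    (haA : A = Finset.image a Finset.univ) (hbB : B = Finset.image b Finset.univ) :
    (∀ S : Finset α, S ⊆ N →
      uim A B C S = ∑ i : Fin m, ∑ j : Fin n,
        uim {a i} {b j} (((Finset.Iio i).image a) ∪ ((Finset.Iio j).image b) ∪ C) S) ∧
    ∃ θ : α → α → Finset α → ℕ, IsRep A B C θ := by
  subst haA hbB
  refine ⟨fun S _ => uim_image_eq_sum a b C S, ?_⟩
  classical
  set Γ₀ : Fin m → Fin n → Finset α := fun i j =>
    ((Finset.Iio i).image a) ∪ ((Finset.Iio j).image b) ∪ C with hΓ₀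
  have hsub : ∀ i j, Γ₀ i j ⊆ Finset.univ.image a ∪ Finset.univ.image b ∪ C := fun i j =>
    Finset.union_subset_union (Finset.union_subset_union
      (Finset.image_subset_image (Finset.subset_univ _))
      (Finset.image_subset_image (Finset.subset_univ _))) (Finset.Subset.refl C)
  refine ⟨fun x y Γ => if ∃ i j, a i = x ∧ b j = y ∧ Γ₀ i j = Γ then 1 else 0, ?_, ?_⟩
  · intro x y Γ h
    obtain ⟨i, j, rfl, rfl, rfl⟩ : ∃ i j, a i = x ∧ b j = y ∧ Γ₀ i j = Γ := by
      by_contra hn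
      exact h (if_neg hn)
    have hai : a i ∈ Finset.univ.image a := Finset.mem_image_of_mem a (Finset.mem_univ i)
    have hbj : b j ∈ Finset.univ.image b := Finset.mem_image_of_mem b (Finset.mem_univ j)
    refine ⟨hai, hbj, Finset.subset_union_right, hsub i j, ?_, ?_⟩
    · intro hmem
      rcases Finset.mem_union.1 hmem with hmem | hmem
      · rcases Finset.mem_union.1 hmem with hmem | hmem
        · simp [ha.eq_iff] at hmem
        · exact Finset.disjoint_left.1 hAB hai
            (Finset.image_subset_image (Finset.subset_univ _) hmem)
      · exact Finset.disjoint_left.1 hAC hai hmem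
    · intro hmem
      rcases Finset.mem_union.1 hmem with hmem | hmem
      · rcases Finset.mem_union.1 hmem with hmem | hmem
        · exact Finset.disjoint_left.1 hAB
            (Finset.image_subset_image (Finset.subset_univ _) hmem) hbj
        · simp [hb.eq_iff] at hmem
      · exact Finset.disjoint_left.1 hBC hbj hmem
  · intro S
    rw [uim_image_eq_sum, Finset.sum_image ha.injOn]
    refine Finset.sum_congr rfl fun i _ => ?_
    rw [Finset.sum_image hb.injOn]
    refine Finset.sum_congr rfl fun j _ => ?_
    have hθ : ∀ Γ, (∃ i' j', a i' = a i ∧ b j' = b j ∧ Γ₀ i' j' = Γ) ↔ Γ₀ i j = Γ := by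
      simp [ha.eq_iff, hb.eq_iff]
    simp only [hθ, Nat.cast_ite, Nat.cast_one, Nat.cast_zero, ite_mul, one_mul, zero_mul]
    rw [Finset.sum_ite_eq, if_pos (Finset.mem_powerset.2 (hsub i j))]
end

section
/- Let N be a finite set and A, B, C pairwise disjoint subsets of N with A and B nonempty. Let θ : u_{⟨A,B|C⟩} = Σ_{u ∈ E_{⟨A,B|C⟩}} θ_u u be a representation. Then for each pair (s,t) with 0 ≤ s ≤ |A|−1 and 0 ≤ t ≤ |B|−1, there is exactly one u ∈ E^{s,t}_{⟨A,B|C⟩} with θ_u = 1, and θ_{u'} = 0 for every other u' ∈ E^{s,t}_{⟨A,B|C⟩}. In particular, every representation is a sum of exactly |A|·|B| elementary imsets, one from each class E^{s,t}_{⟨A,B|C⟩}. -/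
open Finset

theorem sum_uim_mul {α : Type*} [DecidableEq α] {A B C U : Finset α} (h : A ∪ B ∪ C ⊆ U)
    (f : Finset α → ℤ) :
    ∑ S ∈ U.powerset, uim A B C S * f S = f (A ∪ B ∪ C) + f C - f (A ∪ C) - f (B ∪ C) := by
  have hC : C ⊆ U := subset_union_right.trans h
  have hAC : A ∪ C ⊆ U :=
    (union_subset_union_left subset_union_left).trans h
  have hBC : B ∪ C ⊆ U :=
    (union_subset_union_left subset_union_right).trans h
  simp only [uim, add_mul, sub_mul, sum_add_distrib, sum_sub_distrib, ite_mul, one_mul, zero_mul,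
    sum_ite_eq', mem_powerset, if_pos h, if_pos hC, if_pos hAC, if_pos hBC]

/-- The product of the indicators of `s < |A ∩ S|` and `t < |B ∩ S|`. -/
def thresholdIndicator {α : Type*} [DecidableEq α] (A B : Finset α) (s t : ℕ) (S : Finset α) : ℤ :=
  (if s < (A ∩ S).card then 1 else 0) * (if t < (B ∩ S).card then 1 else 0)

/-- On a semi-elementary imset `u_{⟨A,B|C⟩}` the threshold indicator takes the value one. -/
theorem sum_uim_mul_thresholdIndicator {α : Type*} [DecidableEq α] {A B C : Finset α}
    (hAB : Disjoint A B) (hAC : Disjoint A C) (hBC : Disjoint B C) {s t : ℕ}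
    (hs : s < A.card) (ht : t < B.card) :
    ∑ S ∈ (A ∪ B ∪ C).powerset, uim A B C S * thresholdIndicator A B s t S = 1 := by
  rw [sum_uim_mul Subset.rfl]
  simp [thresholdIndicator, inter_union_distrib_left, disjoint_iff_inter_eq_empty.mp hAB,
    disjoint_iff_inter_eq_empty.mp hAB.symm, disjoint_iff_inter_eq_empty.mp hAC,
    disjoint_iff_inter_eq_empty.mp hBC, hs, ht]

/-- The threshold indicator detects whether an elementary imset lies in the class `E^{s,t}`. -/
theorem sum_elementary_mul_thresholdIndicator {α : Type*} [DecidableEq α] {A B Γ U : Finset α}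
    (hAB : Disjoint A B) {a b : α} (ha : a ∈ A) (hb : b ∈ B) (haΓ : a ∉ Γ) (hbΓ : b ∉ Γ)
    (haU : a ∈ U) (hbU : b ∈ U) (hΓ : Γ ⊆ U) (s t : ℕ) :
    ∑ S ∈ U.powerset, uim {a} {b} Γ S * thresholdIndicator A B s t S =
      if (A ∩ Γ).card = s ∧ (B ∩ Γ).card = t then 1 else 0 := by
  have hbA : b ∉ A := fun h => disjoint_left.mp hAB h hb
  have haB : a ∉ B := fun h => disjoint_left.mp hAB ha h
  have hAab : (A ∩ ({a} ∪ {b} ∪ Γ)).card = (A ∩ Γ).card + 1 := by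
    simp [inter_insert_of_mem ha, hbA, haΓ]
  have hBab : (B ∩ ({a} ∪ {b} ∪ Γ)).card = (B ∩ Γ).card + 1 := by
    simp [haB, hbΓ, hb]
  have hAa : (A ∩ ({a} ∪ Γ)).card = (A ∩ Γ).card + 1 := by
    simp [haΓ, ha]
  have hBa : (B ∩ ({a} ∪ Γ)).card = (B ∩ Γ).card := by
    simp [haB]
  have hAb : (A ∩ ({b} ∪ Γ)).card = (A ∩ Γ).card := by
    simp [hbA]
  have hBb : (B ∩ ({b} ∪ Γ)).card = (B ∩ Γ).card + 1 := by
    simp [hbΓ, hb]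
  rw [sum_uim_mul (union_subset (union_subset (by simpa) (by simpa)) hΓ)]
  simp only [thresholdIndicator, hAab, hBab, hAa, hBa, hAb, hBb]
  split_ifs <;> omega

/-- The multiplicities of the elementary imsets in one class `E^{s,t}` add up to one. -/
theorem IsRep.sum_class_eq_one {α : Type*} [DecidableEq α] {A B C : Finset α}
    (hAB : Disjoint A B) (hAC : Disjoint A C) (hBC : Disjoint B C)
    {θ : α → α → Finset α → ℕ} (hθ : IsRep A B C θ) {s t : ℕ}
    (hs : s < A.card) (ht : t < B.card) :
    ∑ p ∈ (A ×ˢ B ×ˢ (A ∪ B ∪ C).powerset).filter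
      (fun p => (A ∩ p.2.2).card = s ∧ (B ∩ p.2.2).card = t), θ p.1 p.2.1 p.2.2 = 1 := by
  rw [← Nat.cast_inj (R := ℤ), Nat.cast_sum, Nat.cast_one,
    ← sum_uim_mul_thresholdIndicator hAB hAC hBC hs ht, sum_filter]
  simp only [hθ.2, sum_product, sum_mul]
  symm
  rw [sum_comm]
  refine sum_congr rfl fun a ha => ?_
  rw [sum_comm]
  refine sum_congr rfl fun b hb => ?_
  rw [sum_comm]
  refine sum_congr rfl fun Γ hΓ => ?_
  simp only [mul_assoc, ← mul_sum]
  by_cases h : θ a b Γ = 0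
  · simp [h]
  obtain ⟨-, -, -, hΓU, haΓ, hbΓ⟩ := hθ.1 a b Γ h
  rw [sum_elementary_mul_thresholdIndicator hAB ha hb haΓ hbΓ (by simp [ha]) (by simp [hb]) hΓU]
  simp

theorem stmt3 {α : Type*} [DecidableEq α] (A B C : Finset α)
    (hAB : Disjoint A B) (hAC : Disjoint A C) (hBC : Disjoint B C)
    (hAne : A.Nonempty) (hBne : B.Nonempty)
    (θ : α → α → Finset α → ℕ) (hθ : IsRep A B C θ) :
    ∀ s t, s < A.card → t < B.card →
      ∃ a b Γ,
        (a ∈ A ∧ b ∈ B ∧ C ⊆ Γ ∧ Γ ⊆ A ∪ B ∪ C ∧ a ∉ Γ ∧ b ∉ Γ ∧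
          (A ∩ Γ).card = s ∧ (B ∩ Γ).card = t) ∧
        θ a b Γ = 1 ∧
        ∀ a' b' Γ',
          (a' ∈ A ∧ b' ∈ B ∧ C ⊆ Γ' ∧ Γ' ⊆ A ∪ B ∪ C ∧ a' ∉ Γ' ∧ b' ∉ Γ' ∧
            (A ∩ Γ').card = s ∧ (B ∩ Γ').card = t) →
          (a', b', Γ') ≠ (a, b, Γ) → θ a' b' Γ' = 0 := by
  intro s t hs ht
  have hsum := hθ.sum_class_eq_one hAB hAC hBC hs ht
  set T := (A ×ˢ B ×ˢ (A ∪ B ∪ C).powerset).filter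
    (fun p => (A ∩ p.2.2).card = s ∧ (B ∩ p.2.2).card = t)
  obtain ⟨⟨a, b, Γ⟩, hp, hne⟩ := exists_ne_zero_of_sum_ne_zero (hsum ▸ one_ne_zero)
  obtain ⟨ha, hb, hCΓ, hΓU, haΓ, hbΓ⟩ := hθ.1 a b Γ hne
  rw [← add_sum_erase T _ hp] at hsum
  obtain ⟨hone, hrest⟩ : θ a b Γ = 1 ∧ ∑ p ∈ T.erase (a, b, Γ), θ p.1 p.2.1 p.2.2 = 0 := by
    dsimp only at hsum hne
    omega
  obtain ⟨-, hs', ht'⟩ := mem_filter.mp hp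
  refine ⟨a, b, Γ, ⟨ha, hb, hCΓ, hΓU, haΓ, hbΓ, hs', ht'⟩, hone, ?_⟩
  rintro a' b' Γ' ⟨ha', hb', -, hΓU', -, -, hs'', ht''⟩ hne'
  exact sum_eq_zero_iff.mp hrest (a', b', Γ')
    (mem_erase.mpr ⟨hne', mem_filter.mpr ⟨mem_product.mpr ⟨ha', mem_product.mpr
      ⟨hb', mem_powerset.mpr hΓU'⟩⟩, hs'', ht''⟩⟩)
end

section
/- Let N be a finite set and A, B, C pairwise disjoint subsets of N with A and B nonempty. Fix integers 0 ≤ s ≤ |A|−1 and 0 ≤ t ≤ |B|−1, and define f : P(N) → ℤ by f(S) = 1 if |A∩S| > s and |B∩S| > t, and f(S) = 0 otherwise. Then: (i) for every elementary imset u = u_{⟨a,b|Γ⟩} ∈ E_{⟨A,B|C⟩}, the inner product ⟨f, u⟩ = Σ_{S ⊆ N} f(S)u(S) equals 1 if |A∩Γ| = s and |B∩Γ| = t, and equals 0 otherwise; (ii) ⟨f, u_{⟨A,B|C⟩}⟩ = 1. -/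
open Finset

theorem sum_powerset_mul_uim {α : Type*} [DecidableEq α] (f : Finset α → ℤ)
    {N A B C : Finset α} (hA : A ⊆ N) (hB : B ⊆ N) (hC : C ⊆ N) :
    ∑ S ∈ N.powerset, f S * uim A B C S
      = f (A ∪ B ∪ C) + f C - f (A ∪ C) - f (B ∪ C) := by
  have key : ∀ T ⊆ N, ∑ S ∈ N.powerset, f S * (if S = T then 1 else 0) = f T := by
    intro T hT
    simp [hT]
  simp only [uim, mul_sub, mul_add, sum_sub_distrib, sum_add_distrib]
  rw [key _ (union_subset (union_subset hA hB) hC), key _ hC, key _ (union_subset hA hC),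
    key _ (union_subset hB hC)]

theorem stmt4 {α : Type*} [DecidableEq α] (N A B C : Finset α) (s t : ℕ)
    (hA : A ⊆ N) (hB : B ⊆ N) (hC : C ⊆ N)
    (hAB : Disjoint A B) (hAC : Disjoint A C) (hBC : Disjoint B C)
    (hAne : A.Nonempty) (hBne : B.Nonempty)
    (hs : s ≤ A.card - 1) (ht : t ≤ B.card - 1) :
    (∀ a b Γ, a ∈ A → b ∈ B → C ⊆ Γ → Γ ⊆ A ∪ B ∪ C → a ∉ Γ → b ∉ Γ →
      (∑ S ∈ N.powerset,
          (if s < (A ∩ S).card ∧ t < (B ∩ S).card then (1 : ℤ) else 0) * uim {a} {b} Γ S)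
        = if (A ∩ Γ).card = s ∧ (B ∩ Γ).card = t then 1 else 0) ∧
    (∑ S ∈ N.powerset,
        (if s < (A ∩ S).card ∧ t < (B ∩ S).card then (1 : ℤ) else 0) * uim A B C S) = 1 := by
  constructor
  · intro a b Γ ha hb _ hΓ haΓ hbΓ
    have haB : a ∉ B := disjoint_left.1 hAB ha
    have hbA : b ∉ A := disjoint_right.1 hAB hb
    have hΓN : Γ ⊆ N := hΓ.trans (union_subset (union_subset hA hB) hC)
    rw [sum_powerset_mul_uim (fun S => if s < (A ∩ S).card ∧ t < (B ∩ S).card then (1 : ℤ) else 0)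
      (singleton_subset_iff.2 (hA ha)) (singleton_subset_iff.2 (hB hb)) hΓN]
    simp only [inter_union_distrib_left, inter_singleton_of_mem ha, inter_singleton_of_mem hb,
      inter_singleton_of_notMem haB, inter_singleton_of_notMem hbA, empty_union, union_empty]
    have hcA : ({a} ∪ A ∩ Γ).card = (A ∩ Γ).card + 1 := by
      rw [← insert_eq, card_insert_of_notMem (by simp [haΓ])]
    have hcB : ({b} ∪ B ∩ Γ).card = (B ∩ Γ).card + 1 := by
      rw [← insert_eq, card_insert_of_notMem (by simp [hbΓ])]
    simp only [hcA, hcB]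
    split_ifs <;> omega
  · have hA0 := hAne.card_pos
    have hB0 := hBne.card_pos
    rw [sum_powerset_mul_uim (fun S => if s < (A ∩ S).card ∧ t < (B ∩ S).card then (1 : ℤ) else 0)
      hA hB hC]
    simp only [inter_union_distrib_left, inter_self, disjoint_iff_inter_eq_empty.1 hAB,
      disjoint_iff_inter_eq_empty.1 hAB.symm, disjoint_iff_inter_eq_empty.1 hAC,
      disjoint_iff_inter_eq_empty.1 hBC, empty_union, union_empty, card_empty]
    split_ifs <;> omega
end

section
/- Let N be a finite set and A, B, C pairwise disjoint subsets of N with A and B nonempty. Then the fiber F_{⟨A,B|C⟩} is connected by two-by-two basic relations: for any two representations θ, θ' ∈ F_{⟨A,B|C⟩} there exists a finite sequence θ = θ_0, θ_1, …, θ_K = θ' of representations in F_{⟨A,B|C⟩} such that θ_{k−1} and θ_k are adjacent for every 1 ≤ k ≤ K. -/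
open Finset

/-- Two coefficient vectors are adjacent if their difference is (up to sign, which is
automatic by exchanging the roles of the two exchanged elements) a two-by-two move,
i.e. the difference of the two sides of a two-by-two basic relation whose four
elementary imsets all belong to `E_{⟨A,B|C⟩}`. -/
def Adjacent {α : Type*} [DecidableEq α] (A B C : Finset α)
    (θ θ' : α → α → Finset α → ℕ) : Prop :=
  (∃ a b₁ b₂ Γ, a ∈ A ∧ b₁ ∈ B ∧ b₂ ∈ B ∧ b₁ ≠ b₂ ∧ C ⊆ Γ ∧ Γ ⊆ A ∪ B ∪ C ∧
      a ∉ Γ ∧ b₁ ∉ Γ ∧ b₂ ∉ Γ ∧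
      ∀ x y Z, (θ x y Z : ℤ) - θ' x y Z =
          (if x = a ∧ y = b₁ ∧ Z = Γ then 1 else 0)
          + (if x = a ∧ y = b₂ ∧ Z = insert b₁ Γ then 1 else 0)
          - (if x = a ∧ y = b₂ ∧ Z = Γ then 1 else 0)
          - (if x = a ∧ y = b₁ ∧ Z = insert b₂ Γ then 1 else 0)) ∨
  (∃ a₁ a₂ b Γ, a₁ ∈ A ∧ a₂ ∈ A ∧ b ∈ B ∧ a₁ ≠ a₂ ∧ C ⊆ Γ ∧ Γ ⊆ A ∪ B ∪ C ∧
      a₁ ∉ Γ ∧ a₂ ∉ Γ ∧ b ∉ Γ ∧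
      ∀ x y Z, (θ x y Z : ℤ) - θ' x y Z =
          (if x = a₁ ∧ y = b ∧ Z = Γ then 1 else 0)
          + (if x = a₂ ∧ y = b ∧ Z = insert a₁ Γ then 1 else 0)
          - (if x = a₂ ∧ y = b ∧ Z = Γ then 1 else 0)
          - (if x = a₁ ∧ y = b ∧ Z = insert a₂ Γ then 1 else 0))

open Function

section Prefix

variable {α : Type*} [DecidableEq α]

/-- The set of the first `k` values of a sequence. -/
def prefixSet (f : ℕ → α) (k : ℕ) : Finset α := (range k).image f

/-- The first `#A` values of `f` list the elements of `A`. -/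
def Enumerates (A : Finset α) (f : ℕ → α) : Prop := prefixSet f #A = A

@[simp] lemma prefixSet_zero (f : ℕ → α) : prefixSet f 0 = ∅ := by simp [prefixSet]

lemma prefixSet_succ (f : ℕ → α) (k : ℕ) :
    prefixSet f (k + 1) = insert (f k) (prefixSet f k) := by
  simp [prefixSet, range_add_one]

lemma mem_prefixSet {f : ℕ → α} {k : ℕ} {x : α} : x ∈ prefixSet f k ↔ ∃ j < k, f j = x := by
  simp [prefixSet]

lemma prefixSet_congr {f g : ℕ → α} {k : ℕ} (h : ∀ j < k, f j = g j) :
    prefixSet f k = prefixSet g k :=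
  Finset.image_congr fun j hj => h j (by simpa using hj)

lemma Enumerates.injOn {A : Finset α} {f : ℕ → α} (h : Enumerates A f) :
    Set.InjOn f (range #A) := by
  rw [← Finset.card_image_iff]
  unfold Enumerates prefixSet at h
  rw [h, card_range]

lemma Enumerates.inj {A : Finset α} {f : ℕ → α} (h : Enumerates A f) {i j : ℕ} (hi : i < #A)
    (hj : j < #A) (hij : f i = f j) : i = j :=
  h.injOn (by simpa using hi) (by simpa using hj) hij

lemma Enumerates.mem {A : Finset α} {f : ℕ → α} (h : Enumerates A f) {k : ℕ} (hk : k < #A) :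
    f k ∈ A := by
  rw [← h]; exact mem_prefixSet.2 ⟨k, hk, rfl⟩

lemma Enumerates.exists_eq {A : Finset α} {f : ℕ → α} (h : Enumerates A f) {x : α} (hx : x ∈ A) :
    ∃ k < #A, f k = x := by
  rw [← h] at hx; exact mem_prefixSet.1 hx

lemma Enumerates.prefixSet_subset {A : Finset α} {f : ℕ → α} (h : Enumerates A f) {k : ℕ}
    (hk : k ≤ #A) : prefixSet f k ⊆ A := by
  intro x hx
  obtain ⟨j, hj, rfl⟩ := mem_prefixSet.1 hx
  exact h.mem (by omega)

lemma Enumerates.card_prefixSet {A : Finset α} {f : ℕ → α} (h : Enumerates A f) {k : ℕ}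
    (hk : k ≤ #A) : #(prefixSet f k) = k := by
  unfold prefixSet
  rw [Finset.card_image_of_injOn, card_range]
  exact h.injOn.mono (by simpa using hk)

lemma Enumerates.notMem_prefixSet {A : Finset α} {f : ℕ → α} (h : Enumerates A f) {j k : ℕ}
    (hjk : j ≤ k) (hk : k < #A) : f k ∉ prefixSet f j := by
  intro hm
  obtain ⟨i, hi, hik⟩ := mem_prefixSet.1 hm
  have := h.inj (by omega) hk hik
  omega

lemma prefixSet_comp_swap (f : ℕ → α) {j k : ℕ} (hjk : j ≠ k + 1) :
    prefixSet (f ∘ Equiv.swap k (k + 1)) j = prefixSet f j := by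
  have key : (range j).image (Equiv.swap k (k + 1)) = range j := by
    refine Finset.eq_of_subset_of_card_le (fun x hx => ?_) ?_
    · obtain ⟨i, hi, rfl⟩ := Finset.mem_image.1 hx
      simp only [mem_range] at hi ⊢
      rw [Equiv.swap_apply_def]
      split_ifs <;> omega
    · rw [Finset.card_image_of_injective _ (Equiv.injective _)]
  unfold prefixSet
  rw [← Finset.image_image, key]

lemma Enumerates.comp_swap {A : Finset α} {f : ℕ → α} (h : Enumerates A f) {k : ℕ}
    (hk : k + 1 < #A) : Enumerates A (f ∘ Equiv.swap k (k + 1)) := by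
  unfold Enumerates
  rw [prefixSet_comp_swap f (by omega)]
  exact h

lemma exists_enumerates [Nonempty α] (A : Finset α) : ∃ f : ℕ → α, Enumerates A f := by
  induction A using Finset.induction_on with
  | empty => exact ⟨fun _ => Classical.arbitrary α, by simp [Enumerates]⟩
  | insert a A ha ih =>
    obtain ⟨f, hf⟩ := ih
    refine ⟨update f #A a, ?_⟩
    unfold Enumerates
    rw [Finset.card_insert_of_notMem ha, prefixSet_succ, update_self,
      prefixSet_congr (g := f) fun j hj => update_of_ne (by omega) _ _, hf]

/-- Bubble sort: `f` can be turned into `g` by transpositions of adjacent entries, each of them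
changing a prefix set at which `f` and `g` differ. -/
lemma bubble_sort {A : Finset α} {f g : ℕ → α} (hf : Enumerates A f) (hg : Enumerates A g)
    {P : (ℕ → α) → Prop} (hP : P f)
    (step : ∀ h, Enumerates A h → P h → ∀ k, k + 1 < #A →
      prefixSet f (k + 1) ≠ prefixSet g (k + 1) → P (h ∘ Equiv.swap k (k + 1))) :
    ∃ h, P h ∧ ∀ k < #A, h k = g k := by
  obtain ⟨idx, hidx⟩ : ∃ idx : α → ℕ, ∀ k < #A, idx (g k) = k :=
    ⟨invFunOn g (range #A), fun k hk => hg.injOn.leftInvOn_invFunOn (by simpa using hk)⟩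
  have hidx' : ∀ x ∈ A, g (idx x) = x ∧ idx x < #A := by
    intro x hx
    obtain ⟨k, hk, rfl⟩ := hg.exists_eq hx
    rw [hidx k hk]
    exact ⟨rfl, hk⟩
  suffices H : ∀ (n : ℕ) (h : ℕ → α), ∑ j ∈ range #A, (#A - j) * idx (h j) = n →
      Enumerates A h → P h →
      (∀ k, prefixSet f (k + 1) = prefixSet g (k + 1) →
        prefixSet h (k + 1) = prefixSet g (k + 1)) →
      ∃ h, P h ∧ ∀ k < #A, h k = g k from H _ f rfl hf hP fun _ => id
  intro n
  induction n using Nat.strong_induction_on with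
  | _ n ih =>
  intro h hn hh hPh hE
  by_cases hinv : ∃ k, k + 1 < #A ∧ idx (h (k + 1)) < idx (h k)
  · obtain ⟨k, hk, hlt⟩ := hinv
    have hne : prefixSet h (k + 1) ≠ prefixSet g (k + 1) := by
      intro heq
      have h1 : h k ∈ prefixSet g (k + 1) := by
        rw [← heq]; exact mem_prefixSet.2 ⟨k, by omega, rfl⟩
      obtain ⟨j, hj, hjk⟩ := mem_prefixSet.1 h1
      rw [← hjk, hidx j (by omega)] at hlt
      refine hh.notMem_prefixSet le_rfl hk ?_
      rw [heq]
      exact mem_prefixSet.2 ⟨_, by omega, (hidx' _ (hh.mem hk)).1⟩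
    refine ih _ ?_ (h ∘ Equiv.swap k (k + 1)) rfl (hh.comp_swap hk)
      (step h hh hPh k hk fun e => hne (hE k e)) ?_
    · rw [← hn]
      have hs : ({k, k + 1} : Finset ℕ) ⊆ range #A := by
        intro x hx
        simp only [mem_insert, mem_singleton] at hx
        rw [mem_range]; omega
      rw [← Finset.sum_sdiff hs, ← Finset.sum_sdiff hs]
      refine add_lt_add_of_le_of_lt (le_of_eq (Finset.sum_congr rfl fun j hj => ?_)) ?_
      · simp only [mem_sdiff, mem_insert, mem_singleton, not_or] at hj
        rw [comp_apply, Equiv.swap_apply_of_ne_of_ne hj.2.1 hj.2.2]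
      · rw [Finset.sum_pair (by omega), Finset.sum_pair (by omega)]
        simp only [comp_apply, Equiv.swap_apply_left, Equiv.swap_apply_right]
        obtain ⟨d, hd⟩ : ∃ d, #A - k = d + 1 := ⟨#A - k - 1, by omega⟩
        rw [show #A - (k + 1) = d by omega, hd]
        nlinarith
    · intro j hj
      have hjk : j ≠ k := by rintro rfl; exact hne (hE j hj)
      rw [prefixSet_comp_swap h (by omega)]
      exact hE j hj
  · push Not at hinv
    have hlt : ∀ k, k + 1 < #A → idx (h k) < idx (h (k + 1)) := by
      intro k hk
      refine lt_of_le_of_ne (hinv k hk) fun e => ?_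
      have e' : h k = h (k + 1) := by
        rw [← (hidx' _ (hh.mem (show k < #A by omega))).1, e, (hidx' _ (hh.mem hk)).1]
      have := hh.inj (by omega) hk e'
      omega
    have hge : ∀ k, k < #A → k ≤ idx (h k) := by
      intro k
      induction k with
      | zero => intro _; omega
      | succ k ihk =>
        intro hk
        have := ihk (by omega)
        have := hlt k hk
        omega
    have hle : ∀ d k, k + d + 1 = #A → idx (h k) ≤ k := by
      intro d
      induction d with
      | zero =>
        intro k hk
        have := (hidx' _ (hh.mem (show k < #A by omega))).2
        omega
      | succ d ihd =>
        intro k hk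
        have := ihd (k + 1) (by omega)
        have := hlt k (by omega)
        omega
    refine ⟨h, hPh, fun k hk => ?_⟩
    have e : idx (h k) = k := le_antisymm (hle (#A - k - 1) k (by omega)) (hge k hk)
    have := (hidx' _ (hh.mem hk)).1
    rw [e] at this
    exact this.symm

/-- A nonnegative integral unit flow from `∅` to `B` in the Boolean lattice is a maximal chain. -/
lemma exists_enumerates_of_unit_flow {ι : Type*} (I : Finset ι) (m : ι → ℕ) (y : ι → Finset α)
    (b : ι → α) (B : Finset α) (hB : B.Nonempty)
    (hsupp : ∀ i ∈ I, m i ≠ 0 → b i ∈ B ∧ b i ∉ y i ∧ y i ⊆ B)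
    (hflow : ∀ Y, ∑ i ∈ I, (m i : ℤ) *
      ((if y i = Y then 1 else 0) - (if insert (b i) (y i) = Y then 1 else 0)) =
        (if Y = ∅ then 1 else 0) - (if Y = B then 1 else 0)) :
    ∃ t, Enumerates B t ∧
      (∀ i ∈ I, m i ≠ 0 → y i = prefixSet t #(y i) ∧ b i = t #(y i) ∧ #(y i) < #B) ∧
      ∀ l < #B, ∃ i ∈ I, m i = 1 ∧ #(y i) = l := by
  have hcard : ∀ i ∈ I, m i ≠ 0 → #(insert (b i) (y i)) = #(y i) + 1 := fun i hi h0 =>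
    Finset.card_insert_of_notMem (hsupp i hi h0).2.1
  have hlt : ∀ i ∈ I, m i ≠ 0 → #(y i) < #B := fun i hi h0 => by
    obtain ⟨h1, h2, h3⟩ := hsupp i hi h0
    rw [Nat.lt_iff_add_one_le, ← hcard i hi h0]
    exact Finset.card_le_card (Finset.insert_subset h1 h3)
  have hpred : ∀ j ∈ I, m j ≠ 0 → y j ≠ ∅ → ∃ i ∈ I, m i ≠ 0 ∧ insert (b i) (y i) = y j := by
    intro j hj h0 hne
    by_contra! hcon
    have hjB : y j ≠ B := fun e => by have := hlt j hj h0; rw [e] at this; omega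
    have h1 := hflow (y j)
    rw [if_neg hne, if_neg hjB] at h1
    have h2 : ∑ i ∈ I, (m i : ℤ) * ((if y i = y j then 1 else 0) -
        (if insert (b i) (y i) = y j then 1 else 0)) =
        ∑ i ∈ I, if y i = y j then (m i : ℤ) else 0 := by
      refine Finset.sum_congr rfl fun i hi => ?_
      by_cases hm : m i = 0
      · simp [hm]
      · rw [if_neg (hcon i hi hm)]; simp
    rw [h2] at h1
    have h3 := Finset.single_le_sum (f := fun i => if y i = y j then (m i : ℤ) else 0)
      (fun i _ => by split_ifs <;> simp) hj
    simp only [if_true] at h3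
    omega
  have huniq : ∀ Y, ∑ i ∈ I, (if y i = Y then m i else 0) = 1 →
      ∃ i ∈ I, m i = 1 ∧ y i = Y ∧ ∀ j ∈ I, m j ≠ 0 → y j = Y → j = i := by
    classical
    intro Y hY
    obtain ⟨i, hi, hi0⟩ : ∃ i ∈ I, (if y i = Y then m i else 0) ≠ 0 :=
      Finset.exists_ne_zero_of_sum_ne_zero (by rw [hY]; exact one_ne_zero)
    have hiY : y i = Y := by by_contra h; simp [h] at hi0
    rw [← Finset.add_sum_erase _ _ hi, if_pos hiY] at hY
    rw [if_pos hiY] at hi0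
    refine ⟨i, hi, by omega, hiY, fun j hj hj0 hjY => ?_⟩
    by_contra hne
    have h3 := Finset.single_le_sum (f := fun i => if y i = Y then m i else 0)
      (fun i _ => Nat.zero_le _) (Finset.mem_erase.2 ⟨hne, hj⟩)
    simp only [if_pos hjY] at h3
    omega
  have hlevel : ∀ l < #B, ∃ i ∈ I, m i = 1 ∧ #(y i) = l ∧
      ∀ j ∈ I, m j ≠ 0 → #(y j) = l → j = i := by
    intro l
    induction l with
    | zero =>
      intro _
      have h1 := hflow ∅
      rw [if_pos rfl, if_neg hB.ne_empty.symm] at h1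
      obtain ⟨i, hi, hi1, hiY, hu⟩ := huniq ∅ (by
        zify
        simpa using h1)
      exact ⟨i, hi, hi1, by simp [hiY], fun j hj h0 hc => hu j hj h0 (Finset.card_eq_zero.1 hc)⟩
    | succ l ih =>
      intro hl
      obtain ⟨g, hg, hg1, hgl, hgu⟩ := ih (by omega)
      have hg0 : m g ≠ 0 := by omega
      have hc := hcard g hg hg0
      have h1 := hflow (insert (b g) (y g))
      have hneB : insert (b g) (y g) ≠ B := fun e => by rw [e] at hc; omega
      rw [if_neg (Finset.insert_ne_empty _ _), if_neg hneB] at h1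
      simp only [mul_sub, Finset.sum_sub_distrib] at h1
      have h2 : ∑ i ∈ I, (m i : ℤ) * (if insert (b i) (y i) = insert (b g) (y g) then 1 else 0)
          = 1 := by
        rw [Finset.sum_eq_single_of_mem g hg]
        · simp [hg1]
        · intro i hi hne
          by_cases hm : m i = 0
          · simp [hm]
          · rw [if_neg, mul_zero]
            intro e
            refine hne (hgu i hi hm ?_)
            have := hcard i hi hm
            rw [e] at this
            omega
      obtain ⟨i, hi, hi1, hiY, hu⟩ := huniq (insert (b g) (y g)) (by
        zify
        simp only [mul_ite, mul_one, mul_zero] at h1 h2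
        linarith)
      refine ⟨i, hi, hi1, by rw [hiY]; omega, fun j hj h0 hcj => hu j hj h0 ?_⟩
      obtain ⟨i', hi', hi0', e⟩ := hpred j hj h0 (by rintro e; simp [e] at hcj)
      have := hcard i' hi' hi0'
      rw [← e, hgu i' hi' hi0' (by rw [e] at this; omega)]
  have : Nonempty ι := ⟨(hlevel 0 hB.card_pos).choose⟩
  choose! g hg hg1 hgl hgu using hlevel
  have hg0 : ∀ l < #B, m (g l) ≠ 0 := fun l hl => by rw [hg1 l hl]; exact one_ne_zero
  have hpre : ∀ l < #B, y (g l) = prefixSet (fun l => b (g l)) l := by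
    intro l
    induction l with
    | zero => intro hl; simpa using hgl 0 hl
    | succ l ih =>
      intro hl
      have hc := hgl _ hl
      obtain ⟨i, hi, hi0, e⟩ := hpred _ (hg _ hl) (hg0 _ hl) (by intro e; simp [e] at hc)
      have := hcard i hi hi0
      rw [← e, hgu l (by omega) i hi hi0 (by rw [e] at this; omega), prefixSet_succ,
        ih (by omega)]
  refine ⟨fun l => b (g l), ?_, fun i hi hi0 => ?_, fun l hl => ⟨g l, hg l hl, hg1 l hl, hgl l hl⟩⟩
  · obtain ⟨n, hn⟩ : ∃ n, #B = n + 1 := ⟨#B - 1, by have := hB.card_pos; omega⟩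
    have hnl : n < #B := by omega
    obtain ⟨h1, h2, h3⟩ := hsupp _ (hg n hnl) (hg0 n hnl)
    unfold Enumerates
    rw [hn, prefixSet_succ, ← hpre n hnl]
    refine Finset.eq_of_subset_of_card_le (Finset.insert_subset h1 h3) ?_
    rw [hcard _ (hg n hnl) (hg0 n hnl), hgl n hnl, hn]
  · have hl := hlt i hi hi0
    have e := hgu _ hl i hi hi0 rfl
    refine ⟨?_, ?_, hl⟩
    · rw [← hpre _ hl, ← e]
    · dsimp only
      rw [← e]

end Prefix

section Table

variable {α : Type*} [DecidableEq α] {A B C : Finset α}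

/-- The conditioning set of the square at position `(k, l)`, when row `l` orders `A` by `s l` and
column `k` orders `B` by `t k`. -/
def cell (C : Finset α) (s t : ℕ → ℕ → α) (k l : ℕ) : Finset α :=
  C ∪ prefixSet (s l) k ∪ prefixSet (t k) l

/-- The coefficient vector of the sum of the squares `⟨s l k, t k l | cell C s t k l⟩` over all
`k < p` and `l < q`. -/
def tableRep (p q : ℕ) (C : Finset α) (s t : ℕ → ℕ → α) : α → α → Finset α → ℕ := fun x y Z =>
  ∑ k ∈ range p, ∑ l ∈ range q, if x = s l k ∧ y = t k l ∧ Z = cell C s t k l then 1 else 0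

/-- A representation given by orderings `s l` of `A` and `t k` of `B`. -/
structure IsTable (A B C : Finset α) (s t : ℕ → ℕ → α) : Prop where
  row : ∀ l < #B, Enumerates A (s l)
  col : ∀ k < #A, Enumerates B (t k)
  rep : IsRep A B C (tableRep #A #B C s t)

/-- One two-by-two move inside the fiber. -/
def FiberStep (A B C : Finset α) (θ θ' : α → α → Finset α → ℕ) : Prop :=
  IsRep A B C θ ∧ IsRep A B C θ' ∧ Adjacent A B C θ θ'

/-- The table `(s', t')` is a representation that two-by-two moves reach from `(s, t)`. -/
def Linked (A B C : Finset α) (s t s' t' : ℕ → ℕ → α) : Prop :=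
  IsTable A B C s' t' ∧ Relation.ReflTransGen (FiberStep A B C) (tableRep #A #B C s t)
    (tableRep #A #B C s' t')

lemma Linked.trans {s t s' t' s'' t'' : ℕ → ℕ → α} (h : Linked A B C s t s' t')
    (h' : Linked A B C s' t' s'' t'') : Linked A B C s t s'' t'' :=
  ⟨h'.1, h.2.trans h'.2⟩

/-! ### Symmetry -/

lemma uim_comm (A B C : Finset α) : uim A B C = uim B A C := by
  funext S
  simp only [uim, Finset.union_comm B A]
  ring

lemma IsRep.transpose {θ : α → α → Finset α → ℕ} (h : IsRep A B C θ) :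
    IsRep B A C (Function.swap θ) := by
  refine ⟨fun b a Γ h0 => ?_, fun S => ?_⟩
  · obtain ⟨h1, h2, h3, h4, h5, h6⟩ := h.1 a b Γ h0
    exact ⟨h2, h1, h3, by rwa [Finset.union_comm B A], h6, h5⟩
  · rw [uim_comm, h.2 S, Finset.sum_comm, Finset.union_comm B A]
    refine Finset.sum_congr rfl fun b _ => Finset.sum_congr rfl fun a _ =>
      Finset.sum_congr rfl fun Γ _ => ?_
    rw [uim_comm]

lemma Adjacent.transpose {θ θ' : α → α → Finset α → ℕ} (h : Adjacent A B C θ θ') :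
    Adjacent B A C (Function.swap θ) (Function.swap θ') := by
  rcases h with ⟨a, b₁, b₂, Γ, h1, h2, h3, h4, h5, h6, h7, h8, h9, h⟩ |
    ⟨a₁, a₂, b, Γ, h1, h2, h3, h4, h5, h6, h7, h8, h9, h⟩
  · refine Or.inr ⟨b₁, b₂, a, Γ, h2, h3, h1, h4, h5, by rwa [Finset.union_comm B A], h8, h9, h7,
      fun y x Z => ?_⟩
    simp only [and_left_comm (a := y = _)]
    exact h x y Z
  · refine Or.inl ⟨b, a₁, a₂, Γ, h3, h1, h2, h4, h5, by rwa [Finset.union_comm B A], h9, h7, h8,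
      fun y x Z => ?_⟩
    simp only [and_left_comm (a := y = _)]
    exact h x y Z

lemma Adjacent.symm {θ θ' : α → α → Finset α → ℕ} (h : Adjacent A B C θ θ') :
    Adjacent A B C θ' θ := by
  rcases h with ⟨a, b₁, b₂, Γ, h1, h2, h3, h4, h5, h6, h7, h8, h9, h⟩ |
    ⟨a₁, a₂, b, Γ, h1, h2, h3, h4, h5, h6, h7, h8, h9, h⟩
  · refine Or.inl ⟨a, b₂, b₁, Γ, h1, h3, h2, h4.symm, h5, h6, h7, h9, h8, fun x y Z => ?_⟩
    linarith [h x y Z]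
  · refine Or.inr ⟨a₂, a₁, b, Γ, h2, h1, h3, h4.symm, h5, h6, h8, h7, h9, fun x y Z => ?_⟩
    linarith [h x y Z]

lemma FiberStep.symm {θ θ' : α → α → Finset α → ℕ} (h : FiberStep A B C θ θ') :
    FiberStep A B C θ' θ :=
  ⟨h.2.1, h.1, h.2.2.symm⟩

lemma FiberStep.transpose {θ θ' : α → α → Finset α → ℕ} (h : FiberStep A B C θ θ') :
    FiberStep B A C (Function.swap θ) (Function.swap θ') :=
  ⟨h.1.transpose, h.2.1.transpose, h.2.2.transpose⟩

lemma cell_comm (C : Finset α) (s t : ℕ → ℕ → α) (k l : ℕ) : cell C t s l k = cell C s t k l :=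
  Finset.union_right_comm _ _ _

lemma swap_tableRep (p q : ℕ) (C : Finset α) (s t : ℕ → ℕ → α) :
    Function.swap (tableRep p q C s t) = tableRep q p C t s := by
  funext y x Z
  unfold Function.swap tableRep
  rw [Finset.sum_comm]
  simp only [cell_comm C s t, and_left_comm (a := x = _)]

lemma IsTable.transpose {s t : ℕ → ℕ → α} (h : IsTable A B C s t) : IsTable B A C t s :=
  ⟨h.col, h.row, by rw [← swap_tableRep]; exact h.rep.transpose⟩

lemma Linked.transpose {s t s' t' : ℕ → ℕ → α} (h : Linked A B C s t s' t') :
    Linked B A C t s t' s' := by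
  refine ⟨h.1.transpose, ?_⟩
  rw [← swap_tableRep #A #B C s t, ← swap_tableRep #A #B C s' t']
  exact Relation.ReflTransGen.lift Function.swap (fun _ _ => FiberStep.transpose) _ _ h.2

/-! ### Tables as representations -/

lemma tableRep_congr {p q : ℕ} {s s' : ℕ → ℕ → α} (t : ℕ → ℕ → α)
    (h : ∀ l < q, ∀ k < p, s l k = s' l k) : tableRep p q C s t = tableRep p q C s' t := by
  funext x y Z
  refine Finset.sum_congr rfl fun k hk => Finset.sum_congr rfl fun l hl => ?_
  rw [mem_range] at hk hl
  rw [cell, cell, h l hl k hk, prefixSet_congr fun j hj => h l hl j (hj.trans hk)]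

lemma Linked.congr_row {s t s₁ s₂ t' : ℕ → ℕ → α} (h : Linked A B C s t s₁ t')
    (hs : ∀ l < #B, ∀ k < #A, s₁ l k = s₂ l k) : Linked A B C s t s₂ t' := by
  have e := tableRep_congr (C := C) t' hs
  refine ⟨⟨fun l hl => ?_, h.1.col, e ▸ h.1.rep⟩, e ▸ h.2⟩
  unfold Enumerates
  rw [← prefixSet_congr (hs l hl)]
  exact h.1.row l hl

lemma subset_cell {s t : ℕ → ℕ → α} {k l : ℕ} : C ⊆ cell C s t k l :=
  Finset.subset_union_left.trans Finset.subset_union_left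

lemma cell_subset {s t : ℕ → ℕ → α} (hs : ∀ l < #B, Enumerates A (s l))
    (ht : ∀ k < #A, Enumerates B (t k)) {k l : ℕ} (hk : k < #A) (hl : l < #B) :
    cell C s t k l ⊆ A ∪ B ∪ C := by
  have h1 := (hs l hl).prefixSet_subset hk.le
  have h2 := (ht k hk).prefixSet_subset hl.le
  unfold cell
  intro x hx
  simp only [mem_union] at hx ⊢
  rcases hx with (hx | hx) | hx
  · exact Or.inr hx
  · exact Or.inl (Or.inl (h1 hx))
  · exact Or.inl (Or.inr (h2 hx))

lemma notMem_cell_row {s t : ℕ → ℕ → α} (hs : ∀ l < #B, Enumerates A (s l))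
    (ht : ∀ k < #A, Enumerates B (t k)) {k l : ℕ} (hk : k < #A) (hl : l < #B)
    (hAB : Disjoint A B) (hAC : Disjoint A C) {j : ℕ} (hkj : k ≤ j)
    (hj : j < #A) : s l j ∉ cell C s t k l := by
  have hA := (hs l hl).mem hj
  have h2 := (ht k hk).prefixSet_subset hl.le
  simp only [cell, mem_union, not_or]
  exact ⟨⟨Finset.disjoint_left.1 hAC hA, (hs l hl).notMem_prefixSet hkj hj⟩,
    fun hx => Finset.disjoint_left.1 hAB hA (h2 hx)⟩

lemma notMem_cell_col {s t : ℕ → ℕ → α} (hs : ∀ l < #B, Enumerates A (s l))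
    (ht : ∀ k < #A, Enumerates B (t k)) {k l : ℕ} (hk : k < #A) (hl : l < #B)
    (hAB : Disjoint A B) (hBC : Disjoint B C) {j : ℕ} (hlj : l ≤ j)
    (hj : j < #B) : t k j ∉ cell C s t k l := by
  rw [← cell_comm]
  exact notMem_cell_row ht hs hl hk hAB.symm hBC hlj hj

lemma isRep_tableRep_iff (hAB : Disjoint A B) (hAC : Disjoint A C) (hBC : Disjoint B C)
    {s t : ℕ → ℕ → α} (hs : ∀ l < #B, Enumerates A (s l)) (ht : ∀ k < #A, Enumerates B (t k)) :
    IsRep A B C (tableRep #A #B C s t) ↔ ∀ S, uim A B C S =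
      ∑ k ∈ range #A, ∑ l ∈ range #B, uim {s l k} {t k l} (cell C s t k l) S := by
  have hsum : ∀ S, ∑ a ∈ A, ∑ b ∈ B, ∑ Γ ∈ (A ∪ B ∪ C).powerset,
      (tableRep #A #B C s t a b Γ : ℤ) * uim {a} {b} Γ S =
      ∑ k ∈ range #A, ∑ l ∈ range #B, uim {s l k} {t k l} (cell C s t k l) S := by
    intro S
    simp only [← Finset.sum_product', tableRep]
    push_cast
    simp only [Finset.sum_mul]
    rw [Finset.sum_comm]
    refine Finset.sum_congr rfl fun j hj => ?_
    simp only [mem_product, mem_range] at hj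
    rw [Finset.sum_eq_single_of_mem (s j.2 j.1, t j.1 j.2, cell C s t j.1 j.2)]
    · simp
    · simp only [mem_product, mem_powerset]
      exact ⟨(hs _ hj.2).mem hj.1, (ht _ hj.1).mem hj.2, cell_subset hs ht hj.1 hj.2⟩
    · rintro ⟨x, y, Z⟩ - hne
      rw [if_neg, zero_mul]
      rintro ⟨rfl, rfl, rfl⟩
      exact hne rfl
  refine ⟨fun h S => (h.2 S).trans (hsum S), fun h => ⟨fun a b Γ h0 => ?_,
    fun S => (h S).trans (hsum S).symm⟩⟩
  obtain ⟨k, hk, h0⟩ := Finset.exists_ne_zero_of_sum_ne_zero h0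
  obtain ⟨l, hl, h0⟩ := Finset.exists_ne_zero_of_sum_ne_zero h0
  rw [mem_range] at hk hl
  obtain ⟨rfl, rfl, rfl⟩ : a = s l k ∧ b = t k l ∧ Γ = cell C s t k l := by
    by_contra hc
    exact h0 (if_neg hc)
  exact ⟨(hs l hl).mem hk, (ht k hk).mem hl, subset_cell, cell_subset hs ht hk hl,
    notMem_cell_row hs ht hk hl hAB hAC le_rfl hk, notMem_cell_col hs ht hk hl hAB hBC le_rfl hl⟩

/-- Transposing two neighbouring entries of a row changes a sum over the squares of a table by the
terms of a two-by-two relation. -/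
lemma sum_sub_sum_comp_swap {p q : ℕ} (s t : ℕ → ℕ → α) (φ : α → α → Finset α → ℤ) {k l : ℕ}
    (hk : k + 1 < p) (hl : l < q) (hb : t k l = t (k + 1) l)
    (hY : prefixSet (t k) l = prefixSet (t (k + 1)) l) {s' : ℕ → ℕ → α}
    (hs' : s' = update s l (s l ∘ Equiv.swap k (k + 1))) :
    (∑ i ∈ range p, ∑ j ∈ range q, φ (s j i) (t i j) (cell C s t i j)) -
      ∑ i ∈ range p, ∑ j ∈ range q, φ (s' j i) (t i j) (cell C s' t i j) =
    φ (s l k) (t k l) (cell C s t k l) +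
      φ (s l (k + 1)) (t k l) (insert (s l k) (cell C s t k l)) -
      φ (s l (k + 1)) (t k l) (cell C s t k l) -
      φ (s l k) (t k l) (insert (s l (k + 1)) (cell C s t k l)) := by
  have hrow : s' l = s l ∘ Equiv.swap k (k + 1) := by rw [hs', update_self]
  have hpre : ∀ i, i ≠ k + 1 → prefixSet (s' l) i = prefixSet (s l) i := fun i hi => by
    rw [hrow, prefixSet_comp_swap _ hi]
  have hlk : s' l k = s l (k + 1) := by simp [hrow]
  have hlk' : s' l (k + 1) = s l k := by simp [hrow]
  rw [← Finset.sum_sub_distrib]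
  simp only [← Finset.sum_sub_distrib]
  rw [Finset.sum_comm, Finset.sum_eq_single_of_mem l (mem_range.2 hl)]
  · have hsub : ({k, k + 1} : Finset ℕ) ⊆ range p := by
      intro x hx
      simp only [mem_insert, mem_singleton] at hx
      rw [mem_range]; omega
    rw [← Finset.sum_subset hsub]
    · rw [Finset.sum_pair (by omega), hlk, hlk']
      have e1 : cell C s' t k l = cell C s t k l := by rw [cell, hpre k (by omega), cell]
      have e2 : cell C s t (k + 1) l = insert (s l k) (cell C s t k l) := by
        simp only [cell, ← hY, prefixSet_succ, Finset.union_insert, Finset.insert_union]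
      have e3 : cell C s' t (k + 1) l = insert (s l (k + 1)) (cell C s t k l) := by
        simp only [cell, ← hY, prefixSet_succ, Finset.union_insert, Finset.insert_union, hlk,
          hpre k (by omega)]
      rw [e1, e2, e3, ← hb]
      ring
    · intro i _ hi
      simp only [mem_insert, mem_singleton, not_or] at hi
      rw [cell, cell, hpre i hi.2, hrow, comp_apply, Equiv.swap_apply_of_ne_of_ne hi.1 hi.2,
        sub_self]
  · intro j _ hj
    have e : s' j = s j := by rw [hs', update_of_ne hj]
    simp only [cell, e, sub_self, Finset.sum_const_zero]

lemma uim_two_by_two (a₁ a₂ b : α) (Γ S : Finset α) :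
    uim {a₁} {b} Γ S + uim {a₂} {b} (insert a₁ Γ) S - uim {a₂} {b} Γ S -
      uim {a₁} {b} (insert a₂ Γ) S = 0 := by
  have e1 : ({a₁} ∪ {b} ∪ insert a₂ Γ : Finset α) = {a₂} ∪ {b} ∪ insert a₁ Γ := by
    ext; simp; tauto
  have e2 : ({a₁} ∪ insert a₂ Γ : Finset α) = {a₂} ∪ insert a₁ Γ := by
    ext; simp; tauto
  have e3 : ({a₁} ∪ {b} ∪ Γ : Finset α) = {b} ∪ insert a₁ Γ := by
    ext; simp
  have e4 : ({a₂} ∪ {b} ∪ Γ : Finset α) = {b} ∪ insert a₂ Γ := by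
    ext; simp
  have e5 : ∀ a, ({a} ∪ Γ : Finset α) = insert a Γ := fun a => (Finset.insert_eq a Γ).symm
  simp only [uim, e1, e2, e3, e4, e5]
  ring

/-! ### Moving between tables -/

lemma linked_comp_swap (hAB : Disjoint A B) (hAC : Disjoint A C) (hBC : Disjoint B C)
    {s t : ℕ → ℕ → α} (h : IsTable A B C s t) {k l : ℕ} (hk : k + 1 < #A) (hl : l < #B)
    (hY : prefixSet (t k) l = prefixSet (t (k + 1)) l)
    (hY' : prefixSet (t k) (l + 1) = prefixSet (t (k + 1)) (l + 1)) :
    Linked A B C s t (update s l (s l ∘ Equiv.swap k (k + 1))) t := by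
  have hk0 : k < #A := by omega
  have hb : t k l = t (k + 1) l := by
    have h1 : t k l ∈ prefixSet (t (k + 1)) (l + 1) := by
      rw [← hY', prefixSet_succ]
      exact mem_insert_self _ _
    rw [prefixSet_succ, ← hY, mem_insert] at h1
    exact h1.resolve_right ((h.col k hk0).notMem_prefixSet le_rfl hl)
  have hrow : ∀ j < #B, Enumerates A (update s l (s l ∘ Equiv.swap k (k + 1)) j) := by
    intro j hj
    by_cases e : j = l
    · subst e
      rw [update_self]
      exact (h.row j hj).comp_swap hk
    · rw [update_of_ne e]
      exact h.row j hj
  have hrep : IsRep A B C (tableRep #A #B C (update s l (s l ∘ Equiv.swap k (k + 1))) t) := by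
    rw [isRep_tableRep_iff hAB hAC hBC hrow h.col]
    intro S
    rw [(isRep_tableRep_iff hAB hAC hBC h.row h.col).1 h.rep S, ← sub_eq_zero,
      sum_sub_sum_comp_swap s t (fun a b Γ => uim {a} {b} Γ S) hk hl hb hY rfl,
      uim_two_by_two]
  refine ⟨⟨hrow, h.col, hrep⟩, .single ⟨h.rep, hrep, Or.inr ⟨s l k, s l (k + 1), t k l,
    cell C s t k l, (h.row l hl).mem hk0, (h.row l hl).mem hk, (h.col k hk0).mem hl, fun e => ?_,
    subset_cell, cell_subset h.row h.col hk0 hl,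
    notMem_cell_row h.row h.col hk0 hl hAB hAC le_rfl hk0,
    notMem_cell_row h.row h.col hk0 hl hAB hAC (by omega) hk,
    notMem_cell_col h.row h.col hk0 hl hAB hBC le_rfl hl, fun x y Z => ?_⟩⟩⟩
  · have := (h.row l hl).inj hk0 hk e
    omega
  · have := sum_sub_sum_comp_swap (C := C) s t
      (fun a b Γ => if x = a ∧ y = b ∧ Z = Γ then 1 else 0) hk hl hb hY rfl
    unfold tableRep
    push_cast
    exact this

lemma linked_update (hAB : Disjoint A B) (hAC : Disjoint A C) (hBC : Disjoint B C)
    {s t : ℕ → ℕ → α} (h : IsTable A B C s t) {l : ℕ} (hl : l < #B) {g : ℕ → α}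
    (hg : Enumerates A g)
    (hagree : ∀ k, k + 1 < #A → prefixSet (s l) (k + 1) ≠ prefixSet g (k + 1) →
      prefixSet (t k) l = prefixSet (t (k + 1)) l ∧
      prefixSet (t k) (l + 1) = prefixSet (t (k + 1)) (l + 1)) :
    Linked A B C s t (update s l g) t := by
  obtain ⟨f, hf, hfg⟩ := bubble_sort (h.row l hl) hg (P := fun f => Linked A B C s t (update s l f) t)
    (by rw [update_eq_self]; exact ⟨h, .refl⟩) (fun f _ hf k hk hne => by
      have := linked_comp_swap hAB hAC hBC hf.1 hk hl (hagree k hk hne).1 (hagree k hk hne).2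
      rw [update_self, update_idem] at this
      exact hf.trans this)
  refine hf.congr_row fun j hj k hk => ?_
  by_cases e : j = l
  · subst e
    rw [update_self, update_self, hfg k hk]
  · rw [update_of_ne e, update_of_ne e]

/-- The rows of a table may be replaced wherever neighbouring columns agree. -/
lemma linked_rows (hAB : Disjoint A B) (hAC : Disjoint A C) (hBC : Disjoint B C)
    {s t : ℕ → ℕ → α} (h : IsTable A B C s t) {g : ℕ → ℕ → α} (hg : ∀ l < #B, Enumerates A (g l))
    (hagree : ∀ l < #B, ∀ k, k + 1 < #A → prefixSet (s l) (k + 1) ≠ prefixSet (g l) (k + 1) →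
      prefixSet (t k) l = prefixSet (t (k + 1)) l ∧
      prefixSet (t k) (l + 1) = prefixSet (t (k + 1)) (l + 1)) :
    Linked A B C s t g t := by
  have key : ∀ n ≤ #B, Linked A B C s t (fun l => if l < n then g l else s l) t := by
    intro n
    induction n with
    | zero => intro _; exact ⟨by simpa using h, by simpa using .refl⟩
    | succ n ih =>
      intro hn
      have h1 := ih (by omega)
      have h2 := linked_update hAB hAC hBC h1.1 (l := n) (by omega) (hg n (by omega))
        (by simpa using hagree n (by omega))
      refine (h1.trans h2).congr_row fun l _ k _ => ?_
      by_cases e : l = n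
      · subst e
        simp
      · rw [update_of_ne e]
        simp only [show l < n + 1 ↔ l < n by omega]
  refine (key _ le_rfl).congr_row fun l hl k _ => ?_
  rw [if_pos hl]

/-- The columns of a table may be replaced wherever neighbouring rows agree. -/
lemma linked_cols (hAB : Disjoint A B) (hAC : Disjoint A C) (hBC : Disjoint B C)
    {s t : ℕ → ℕ → α} (h : IsTable A B C s t) {g : ℕ → ℕ → α} (hg : ∀ k < #A, Enumerates B (g k))
    (hagree : ∀ k < #A, ∀ l, l + 1 < #B → prefixSet (t k) (l + 1) ≠ prefixSet (g k) (l + 1) →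
      prefixSet (s l) k = prefixSet (s (l + 1)) k ∧
      prefixSet (s l) (k + 1) = prefixSet (s (l + 1)) (k + 1)) :
    Linked A B C s t s g :=
  (linked_rows hAB.symm hBC hAC h.transpose hg hagree).transpose

lemma cell_inter_left (hAB : Disjoint A B) (hAC : Disjoint A C) {X Y : Finset α} (hX : X ⊆ A)
    (hY : Y ⊆ B) : (C ∪ X ∪ Y) ∩ A = X := by
  rw [Finset.union_inter_distrib_right, Finset.union_inter_distrib_right,
    Finset.disjoint_iff_inter_eq_empty.1 hAC.symm, Finset.inter_eq_left.2 hX,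
    Finset.disjoint_iff_inter_eq_empty.1 (hAB.symm.mono_left hY)]
  simp

/-- At an interior vertex of a table, either the two rows or the two columns meeting there agree. -/
lemma IsTable.agree (hAB : Disjoint A B) (hAC : Disjoint A C) (hBC : Disjoint B C)
    {s t : ℕ → ℕ → α} (h : IsTable A B C s t) {k l : ℕ} (hk : k + 1 < #A) (hl : l + 1 < #B) :
    prefixSet (s l) (k + 1) = prefixSet (s (l + 1)) (k + 1) ∨
      prefixSet (t k) (l + 1) = prefixSet (t (k + 1)) (l + 1) := by
  by_contra! hcon
  obtain ⟨hX, hY⟩ := hcon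
  set X := prefixSet (s (l + 1)) (k + 1) with hXdef
  set Y := prefixSet (t (k + 1)) (l + 1) with hYdef
  have hXA : X ⊆ A := (h.row _ hl).prefixSet_subset hk.le
  have hYB : Y ⊆ B := (h.col _ hk).prefixSet_subset hl.le
  have hXc : #X = k + 1 := (h.row _ hl).card_prefixSet hk.le
  have hYc : #Y = l + 1 := (h.col _ hk).card_prefixSet hl.le
  have hinj : ∀ X' ⊆ A, ∀ Y' ⊆ B, C ∪ X ∪ Y = C ∪ X' ∪ Y' → X = X' ∧ Y = Y' := by
    intro X' hX' Y' hY' e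
    constructor
    · rw [← cell_inter_left hAB hAC hXA hYB, e, cell_inter_left hAB hAC hX' hY']
    · rw [← cell_inter_left hAB.symm hBC hYB hXA, Finset.union_right_comm, e,
        Finset.union_right_comm, cell_inter_left hAB.symm hBC hY' hX']
  have hsum := (isRep_tableRep_iff hAB hAC hBC h.row h.col).1 h.rep (C ∪ X ∪ Y)
  have hcorner : ∀ i < #A, ∀ j < #B, ∀ i' ≤ #A, ∀ j' ≤ #B,
      C ∪ X ∪ Y = C ∪ prefixSet (s j) i' ∪ prefixSet (t i) j' →
      i' = k + 1 ∧ j' = l + 1 ∧ X = prefixSet (s j) (k + 1) ∧ Y = prefixSet (t i) (l + 1) := by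
    intro i hi j hj i' hi' j' hj' e
    obtain ⟨e1, e2⟩ := hinj _ ((h.row j hj).prefixSet_subset hi') _
      ((h.col i hi).prefixSet_subset hj') e
    have c1 := (h.row j hj).card_prefixSet hi'
    have c2 := (h.col i hi).card_prefixSet hj'
    rw [← e1, hXc] at c1
    rw [← e2, hYc] at c2
    subst c1 c2
    exact ⟨rfl, rfl, e1, e2⟩
  have hterm : ∀ i < #A, ∀ j < #B, uim {s j i} {t i j} (cell C s t i j) (C ∪ X ∪ Y) =
      if i = k + 1 ∧ j = l + 1 then 1 else 0 := by
    intro i hi j hj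
    have n1 : ¬ C ∪ X ∪ Y = {s j i} ∪ {t i j} ∪ cell C s t i j := by
      intro e
      rw [show ({s j i} ∪ {t i j} ∪ cell C s t i j : Finset α) =
        C ∪ prefixSet (s j) (i + 1) ∪ prefixSet (t i) (j + 1) by
          simp only [prefixSet_succ, cell]; ext; simp; tauto] at e
      obtain ⟨e1, e2, e3, e4⟩ := hcorner i hi j hj (i + 1) hi (j + 1) hj e
      obtain rfl : j = l := by omega
      exact hX e3.symm
    have n2 : ¬ C ∪ X ∪ Y = {s j i} ∪ cell C s t i j := by
      intro e
      rw [show ({s j i} ∪ cell C s t i j : Finset α) =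
        C ∪ prefixSet (s j) (i + 1) ∪ prefixSet (t i) j by
          simp only [prefixSet_succ, cell]; ext; simp; try tauto] at e
      obtain ⟨e1, e2, e3, e4⟩ := hcorner i hi j hj (i + 1) hi j hj.le e
      obtain rfl : i = k := by omega
      exact hY e4.symm
    have n3 : ¬ C ∪ X ∪ Y = {t i j} ∪ cell C s t i j := by
      intro e
      rw [show ({t i j} ∪ cell C s t i j : Finset α) =
        C ∪ prefixSet (s j) i ∪ prefixSet (t i) (j + 1) by
          simp only [prefixSet_succ, cell]; ext; simp; try tauto] at e
      obtain ⟨e1, e2, e3, e4⟩ := hcorner i hi j hj i hi.le (j + 1) hj e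
      obtain rfl : j = l := by omega
      exact hX e3.symm
    have n4 : C ∪ X ∪ Y = cell C s t i j ↔ i = k + 1 ∧ j = l + 1 := by
      constructor
      · intro e
        obtain ⟨e1, e2, -⟩ := hcorner i hi j hj i hi.le j hj.le e
        exact ⟨e1, e2⟩
      · rintro ⟨rfl, rfl⟩
        rfl
    simp only [uim, if_neg n1, if_neg n2, if_neg n3, n4]
    ring
  have hone : ∑ i ∈ range #A, ∑ j ∈ range #B,
      uim {s j i} {t i j} (cell C s t i j) (C ∪ X ∪ Y) = 1 := by
    rw [Finset.sum_eq_single_of_mem (k + 1) (mem_range.2 hk),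
      Finset.sum_eq_single_of_mem (l + 1) (mem_range.2 hl), hterm _ hk _ hl, if_pos ⟨rfl, rfl⟩]
    · intro j hj hne
      rw [hterm _ hk _ (mem_range.1 hj), if_neg fun e => hne e.2]
    · intro i hi hne
      refine Finset.sum_eq_zero fun j hj => ?_
      rw [hterm _ (mem_range.1 hi) _ (mem_range.1 hj), if_neg fun e => hne e.1]
  rw [hone] at hsum
  have m1 : ¬ C ∪ X ∪ Y = A ∪ B ∪ C := by
    intro e
    have := (hinj A subset_rfl B subset_rfl (by rw [e]; ext; simp; tauto)).1
    rw [this] at hXc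
    omega
  have m2 : ¬ C ∪ X ∪ Y = C := by
    intro e
    have := (hinj ∅ (by simp) ∅ (by simp) (by rw [e]; simp)).1
    simp [this] at hXc
  have m3 : ¬ C ∪ X ∪ Y = A ∪ C := by
    intro e
    have := (hinj A subset_rfl ∅ (by simp) (by rw [e]; ext; simp; tauto)).1
    rw [this] at hXc
    omega
  have m4 : ¬ C ∪ X ∪ Y = B ∪ C := by
    intro e
    have := (hinj ∅ (by simp) B subset_rfl (by rw [e]; ext; simp; tauto)).1
    simp [this] at hXc
  simp only [uim, if_neg m1, if_neg m2, if_neg m3, if_neg m4] at hsum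
  norm_num at hsum

/-- Every table can be moved to one whose first rows are all equal. -/
lemma exists_linked_rows_eq (hAB : Disjoint A B) (hAC : Disjoint A C) (hBC : Disjoint B C)
    [Nonempty α] {s t : ℕ → ℕ → α} (h : IsTable A B C s t) (n : ℕ) (hn : n < #B) :
    ∃ s' t', Linked A B C s t s' t' ∧ ∀ i ≤ n, s' i = s' n := by
  induction n with
  | zero => exact ⟨s, t, ⟨h, .refl⟩, fun i hi => by rw [Nat.le_zero.1 hi]⟩
  | succ n ih =>
    obtain ⟨s, t, hl, hs⟩ := ih (by omega)
    have h := hl.1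
    choose ord hord using fun S : Finset α => exists_enumerates S
    set u : ℕ → ℕ → α := fun k j =>
      if j < n + 1 then ord (prefixSet (t k) (n + 1)) j else t k j with hu
    have hcard : ∀ k < #A, #(prefixSet (t k) (n + 1)) = n + 1 := fun k hk =>
      (h.col k hk).card_prefixSet hn.le
    have hlow : ∀ k, ∀ j ≤ n + 1,
        prefixSet (u k) j = prefixSet (ord (prefixSet (t k) (n + 1))) j := fun k j hj =>
      prefixSet_congr fun i hi => if_pos (by omega)
    have hhigh : ∀ k < #A, ∀ j, prefixSet (u k) (n + 1 + j) = prefixSet (t k) (n + 1 + j) := by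
      intro k hk j
      induction j with
      | zero =>
        have := hord (prefixSet (t k) (n + 1))
        unfold Enumerates at this
        rw [hcard k hk] at this
        rw [add_zero, hlow k _ le_rfl, this]
      | succ j ihj =>
        rw [← add_assoc, prefixSet_succ, prefixSet_succ, ihj]
        simp only [hu]
        rw [if_neg (by omega)]
    have l1 : Linked A B C s t s u := by
      refine linked_cols hAB hAC hBC h (fun k hk => ?_) fun k hk l hl' hne => ?_
      · obtain ⟨d, hd⟩ : ∃ d, #B = n + 1 + d := ⟨#B - (n + 1), by omega⟩
        have := h.col k hk
        unfold Enumerates at this ⊢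
        rwa [hd, hhigh k hk d, ← hd]
      · have hln : l < n := by
          by_contra hc
          refine hne ?_
          obtain ⟨d, hd⟩ : ∃ d, l + 1 = n + 1 + d := ⟨l - n, by omega⟩
          rw [hd, hhigh k hk d]
        rw [hs l (by omega), hs (l + 1) (by omega)]
        exact ⟨rfl, rfl⟩
    have l2 : Linked A B C s u (fun i => if i ≤ n + 1 then s (n + 1) else s i) u := by
      refine linked_rows hAB hAC hBC l1.1 (fun i hi => ?_) fun i hi k hk hne => ?_
      · split_ifs
        · exact h.row _ hn
        · exact h.row _ hi
      · have hin : i ≤ n := by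
          by_contra hc
          refine hne ?_
          by_cases e : i = n + 1
          · rw [e, if_pos le_rfl]
          · rw [if_neg (by omega)]
        rw [if_pos (by omega), hs i hin] at hne
        have e := (h.agree hAB hAC hBC hk hn).resolve_left hne
        rw [hlow _ _ (by omega), hlow _ _ (by omega), hlow _ _ (by omega), hlow _ _ (by omega), e]
        exact ⟨rfl, rfl⟩
    refine ⟨_, _, (hl.trans l1).trans l2, fun i hi => ?_⟩
    simp only [if_pos hi, le_refl, if_true]

/-- Every table can be moved to any table with constant rows and columns. -/
lemma IsTable.linked_const (hAB : Disjoint A B) (hAC : Disjoint A C) (hBC : Disjoint B C)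
    (hB : B.Nonempty) {s t : ℕ → ℕ → α} (h : IsTable A B C s t) {f g : ℕ → α}
    (hf : Enumerates A f) (hg : Enumerates B g) :
    Linked A B C s t (fun _ => f) (fun _ => g) := by
  have : Nonempty α := ⟨hB.choose⟩
  have hpos := hB.card_pos
  obtain ⟨s', t', h1, hs⟩ := exists_linked_rows_eq hAB hAC hBC h (#B - 1) (by omega)
  have h2 : Linked A B C s' t' s' (fun _ => g) := by
    refine linked_cols hAB hAC hBC h1.1 (fun _ _ => hg) fun k hk l hl _ => ?_
    rw [hs l (by omega), hs (l + 1) (by omega)]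
    exact ⟨rfl, rfl⟩
  have h3 : Linked A B C s' (fun _ => g) (fun _ => f) (fun _ => g) :=
    linked_rows hAB hAC hBC h2.1 (fun _ _ => hf) fun _ _ _ _ _ => ⟨rfl, rfl⟩
  exact (h1.trans h2).trans h3

/-! ### Every representation is a table -/

lemma sum_mul_uim {N : Finset α} (w : Finset α → ℤ) {A B C : Finset α} (h : A ∪ B ∪ C ⊆ N) :
    ∑ S ∈ N.powerset, w S * uim A B C S = w (A ∪ B ∪ C) + w C - w (A ∪ C) - w (B ∪ C) := by
  have h1 : C ⊆ N := Finset.subset_union_right.trans h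
  have h2 : A ∪ C ⊆ N :=
    (Finset.union_subset_union_left Finset.subset_union_left).trans h
  have h3 : B ∪ C ⊆ N :=
    (Finset.union_subset_union_left Finset.subset_union_right).trans h
  simp only [uim, mul_sub, mul_add, Finset.sum_sub_distrib, Finset.sum_add_distrib, mul_ite,
    mul_one, mul_zero, Finset.sum_ite_eq', mem_powerset, h, h1, h2, h3, if_true]

/-- The elementary imsets of a representation in which exactly `k` elements of `A` precede form a
maximal chain of `B`. -/
lemma IsRep.exists_col (hAB : Disjoint A B) (hAC : Disjoint A C) (hBC : Disjoint B C)
    (hB : B.Nonempty) {θ : α → α → Finset α → ℕ} (h : IsRep A B C θ) {k : ℕ} (hk : k < #A) :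
    ∃ t, Enumerates B t ∧
      (∀ a b Γ, θ a b Γ ≠ 0 → #(Γ ∩ A) = k → Γ ∩ B = prefixSet t #(Γ ∩ B) ∧
        b = t #(Γ ∩ B) ∧ #(Γ ∩ B) < #B) ∧
      ∀ l < #B, ∃ a b Γ, θ a b Γ = 1 ∧ #(Γ ∩ A) = k ∧ #(Γ ∩ B) = l := by
  set T := A ×ˢ B ×ˢ (A ∪ B ∪ C).powerset with hT
  set I := T.filter fun i => #(i.2.2 ∩ A) = k with hI
  have hmem : ∀ a b Γ, θ a b Γ ≠ 0 → (a, b, Γ) ∈ T := by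
    intro a b Γ h0
    obtain ⟨h1, h2, h3, h4, h5, h6⟩ := h.1 a b Γ h0
    simp only [hT, mem_product, mem_powerset]
    exact ⟨h1, h2, h4⟩
  obtain ⟨t, ht, h1, h2⟩ := exists_enumerates_of_unit_flow I (fun i => θ i.1 i.2.1 i.2.2)
    (fun i => i.2.2 ∩ B) (fun i => i.2.1) B hB (fun i _ h0 => by
      obtain ⟨h1, h2, h3, h4, h5, h6⟩ := h.1 _ _ _ h0
      exact ⟨h2, fun hm => h6 (mem_inter.1 hm).1, Finset.inter_subset_right⟩) (fun Y => by
      set w : Finset α → ℤ := fun S => if #(S ∩ A) ≤ k ∧ S ∩ B = Y then 1 else 0 with hw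
      have hflow : ∑ S ∈ (A ∪ B ∪ C).powerset, w S * uim A B C S =
          ∑ i ∈ T, (θ i.1 i.2.1 i.2.2 : ℤ) *
            ∑ S ∈ (A ∪ B ∪ C).powerset, w S * uim {i.1} {i.2.1} i.2.2 S := by
        simp only [Finset.mul_sum]
        rw [Finset.sum_comm]
        refine Finset.sum_congr rfl fun S _ => ?_
        rw [h.2 S]
        simp only [hT, Finset.sum_product, Finset.mul_sum]
        refine Finset.sum_congr rfl fun a _ => Finset.sum_congr rfl fun b _ =>
          Finset.sum_congr rfl fun Γ _ => ?_
        ring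
      have hleft : ∑ S ∈ (A ∪ B ∪ C).powerset, w S * uim A B C S =
          (if Y = ∅ then 1 else 0) - (if Y = B then 1 else 0) := by
        rw [sum_mul_uim w subset_rfl]
        have e1 : (A ∪ B ∪ C) ∩ A = A := Finset.inter_eq_right.2
          (Finset.subset_union_left.trans Finset.subset_union_left)
        have e2 : (A ∪ C) ∩ A = A := Finset.inter_eq_right.2 Finset.subset_union_left
        have e3 : C ∩ A = ∅ := Finset.disjoint_iff_inter_eq_empty.1 hAC.symm
        have e4 : C ∩ B = ∅ := Finset.disjoint_iff_inter_eq_empty.1 hBC.symm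
        have e5 : (B ∪ C) ∩ A = ∅ := by
          rw [Finset.union_inter_distrib_right, e3,
            Finset.disjoint_iff_inter_eq_empty.1 hAB.symm, Finset.union_empty]
        have e6 : (B ∪ C) ∩ B = B := Finset.inter_eq_right.2 Finset.subset_union_left
        simp only [hw, e1, e2, e3, e4, e5, e6, hk.not_ge, Finset.card_empty, Nat.zero_le,
          false_and, true_and, if_false, eq_comm (b := Y)]
        ring
      rw [← hleft, hflow, hI, Finset.sum_filter]
      refine Finset.sum_congr rfl fun i _ => ?_
      by_cases h0 : θ i.1 i.2.1 i.2.2 = 0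
      · simp [h0]
      obtain ⟨h1, h2, h3, h4, h5, h6⟩ := h.1 _ _ _ h0
      obtain ⟨a, b, Γ⟩ := i
      dsimp only at h0 h1 h2 h3 h4 h5 h6 ⊢
      have haB : a ∉ B := Finset.disjoint_left.1 hAB h1
      have hbA : b ∉ A := Finset.disjoint_right.1 hAB h2
      have hsub : {a} ∪ {b} ∪ Γ ⊆ A ∪ B ∪ C := by
        intro x hx
        simp only [mem_union, mem_singleton] at hx
        rcases hx with (rfl | rfl) | hx
        · simp [h1]
        · simp [h2]
        · exact h4 hx
      rw [sum_mul_uim w hsub]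
      have e1 : ({a} ∪ {b} ∪ Γ) ∩ A = insert a (Γ ∩ A) := by
        ext x; simp only [mem_inter, mem_union, mem_singleton, mem_insert]; grind
      have e2 : ({a} ∪ Γ) ∩ A = insert a (Γ ∩ A) := by
        ext x; simp only [mem_inter, mem_union, mem_singleton, mem_insert]; grind
      have e3 : ({b} ∪ Γ) ∩ A = Γ ∩ A := by
        ext x; simp only [mem_inter, mem_union, mem_singleton]; grind
      have e4 : ({a} ∪ {b} ∪ Γ) ∩ B = insert b (Γ ∩ B) := by
        ext x; simp only [mem_inter, mem_union, mem_singleton, mem_insert]; grind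
      have e5 : ({a} ∪ Γ) ∩ B = Γ ∩ B := by
        ext x; simp only [mem_inter, mem_union, mem_singleton]; grind
      have e6 : ({b} ∪ Γ) ∩ B = insert b (Γ ∩ B) := by
        ext x; simp only [mem_inter, mem_union, mem_singleton, mem_insert]; grind
      have hc : #(insert a (Γ ∩ A)) = #(Γ ∩ A) + 1 :=
        Finset.card_insert_of_notMem fun hm => h5 (mem_inter.1 hm).1
      simp only [hw, e1, e2, e3, e4, e5, e6, hc]
      rcases lt_trichotomy #(Γ ∩ A) k with hlt | heq | hgt
      · simp only [hlt.ne, if_false, hlt.le, Nat.succ_le_of_lt hlt, true_and]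
        ring
      · simp only [heq, if_true, le_refl, true_and, Nat.not_succ_le_self, false_and, if_false]
        ring
      · simp only [hgt.ne', if_false, hgt.not_ge, (show ¬ #(Γ ∩ A) + 1 ≤ k by omega), false_and]
        ring)
  refine ⟨t, ht, fun a b Γ h0 hc => h1 (a, b, Γ) (mem_filter.2 ⟨hmem a b Γ h0, hc⟩) h0,
    fun l hl => ?_⟩
  obtain ⟨⟨a, b, Γ⟩, hi, hθ, hc⟩ := h2 l hl
  exact ⟨a, b, Γ, hθ, (mem_filter.1 hi).2, hc⟩

lemma IsRep.exists_table (hAB : Disjoint A B) (hAC : Disjoint A C) (hBC : Disjoint B C)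
    (hA : A.Nonempty) (hB : B.Nonempty) {θ : α → α → Finset α → ℕ} (h : IsRep A B C θ) :
    ∃ s t, IsTable A B C s t ∧ θ = tableRep #A #B C s t := by
  have : Nonempty α := ⟨hA.choose⟩
  choose! t ht htθ htex using fun k (hk : k < #A) => h.exists_col hAB hAC hBC hB hk
  choose! s hs hsθ _hsex using fun l (hl : l < #B) =>
    h.transpose.exists_col hAB.symm hBC hAC hA hl
  have hcell : ∀ a b Γ, θ a b Γ ≠ 0 → ∀ k l, #(Γ ∩ A) = k → #(Γ ∩ B) = l → k < #A → l < #B →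
      a = s l k ∧ b = t k l ∧ Γ = cell C s t k l := by
    rintro a b Γ h0 k l hk hl hkA hlB
    obtain ⟨h1, h2, -⟩ := htθ k hkA a b Γ h0 hk
    obtain ⟨h3, h4, -⟩ := hsθ l hlB b a Γ h0 hl
    rw [hl] at h1 h2
    rw [hk] at h3 h4
    obtain ⟨-, -, h5, h6, -, -⟩ := h.1 a b Γ h0
    refine ⟨h4, h2, ?_⟩
    rw [cell, ← h1, ← h3]
    ext x
    have h5' := @h5 x
    have h6' := @h6 x
    simp only [mem_union, mem_inter] at h6' ⊢
    tauto
  have hlt : ∀ a b Γ, θ a b Γ ≠ 0 → #(Γ ∩ A) < #A ∧ #(Γ ∩ B) < #B := by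
    intro a b Γ h0
    obtain ⟨h1, h2, -, -, h5, h6⟩ := h.1 a b Γ h0
    constructor
    · refine Finset.card_lt_card ⟨Finset.inter_subset_right, fun hs => h5 ?_⟩
      exact (mem_inter.1 (hs h1)).1
    · refine Finset.card_lt_card ⟨Finset.inter_subset_right, fun hs => h6 ?_⟩
      exact (mem_inter.1 (hs h2)).1
  have hone : ∀ k < #A, ∀ l < #B, θ (s l k) (t k l) (cell C s t k l) = 1 := by
    intro k hk l hl
    obtain ⟨a, b, Γ, h1, h2, h3⟩ := htex k hk l hl
    obtain ⟨rfl, rfl, rfl⟩ := hcell a b Γ (by omega) k l h2 h3 hk hl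
    exact h1
  have hcardA : ∀ k < #A, ∀ l < #B, #(cell C s t k l ∩ A) = k := by
    intro k hk l hl
    rw [cell, cell_inter_left hAB hAC ((hs l hl).prefixSet_subset hk.le)
      ((ht k hk).prefixSet_subset hl.le), (hs l hl).card_prefixSet hk.le]
  have hcardB : ∀ k < #A, ∀ l < #B, #(cell C s t k l ∩ B) = l := by
    intro k hk l hl
    rw [← cell_comm, cell, cell_inter_left hAB.symm hBC ((ht k hk).prefixSet_subset hl.le)
      ((hs l hl).prefixSet_subset hk.le), (ht k hk).card_prefixSet hl.le]
  have heq : θ = tableRep #A #B C s t := by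
    funext x y Z
    unfold tableRep
    by_cases h0 : θ x y Z = 0
    · rw [h0]
      refine (Finset.sum_eq_zero fun k hk => Finset.sum_eq_zero fun l hl => if_neg ?_).symm
      rintro ⟨rfl, rfl, rfl⟩
      rw [hone k (mem_range.1 hk) l (mem_range.1 hl)] at h0
      exact one_ne_zero h0
    · obtain ⟨hk, hl⟩ := hlt x y Z h0
      have e := hcell x y Z h0 _ _ rfl rfl hk hl
      have h1 := hone _ hk _ hl
      rw [← e.1, ← e.2.1, ← e.2.2] at h1
      rw [h1, Finset.sum_eq_single_of_mem _ (mem_range.2 hk),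
        Finset.sum_eq_single_of_mem _ (mem_range.2 hl), if_pos e]
      · rintro l hl' hne
        refine if_neg ?_
        rintro ⟨-, -, e'⟩
        refine hne ?_
        conv_rhs => rw [e']
        exact (hcardB _ hk l (mem_range.1 hl')).symm
      · rintro k hk' hne
        refine Finset.sum_eq_zero fun l hl' => if_neg ?_
        rintro ⟨-, -, e'⟩
        refine hne ?_
        conv_rhs => rw [e']
        exact (hcardA k (mem_range.1 hk') l (mem_range.1 hl')).symm
  exact ⟨s, t, ⟨hs, ht, heq ▸ h⟩, heq⟩

/-- The fiber is connected by two-by-two moves. -/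
lemma reflTransGen_fiberStep (hAB : Disjoint A B) (hAC : Disjoint A C) (hBC : Disjoint B C)
    (hA : A.Nonempty) (hB : B.Nonempty) {θ θ' : α → α → Finset α → ℕ} (h : IsRep A B C θ)
    (h' : IsRep A B C θ') : Relation.ReflTransGen (FiberStep A B C) θ θ' := by
  have : Nonempty α := ⟨hA.choose⟩
  have : Std.Symm (FiberStep A B C) := ⟨fun _ _ => FiberStep.symm⟩
  obtain ⟨f, hf⟩ := exists_enumerates A
  obtain ⟨g, hg⟩ := exists_enumerates B
  obtain ⟨s, t, hst, rfl⟩ := h.exists_table hAB hAC hBC hA hB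
  obtain ⟨s', t', hst', rfl⟩ := h'.exists_table hAB hAC hBC hA hB
  exact (hst.linked_const hAB hAC hBC hB hf hg).2.trans
    (Std.Symm.symm _ _ (hst'.linked_const hAB hAC hBC hB hf hg).2)

end Table

theorem stmt5 {α : Type*} [DecidableEq α] (A B C : Finset α)
    (hAB : Disjoint A B) (hAC : Disjoint A C) (hBC : Disjoint B C)
    (hAne : A.Nonempty) (hBne : B.Nonempty)
    (θ θ' : α → α → Finset α → ℕ) (hθ : IsRep A B C θ) (hθ' : IsRep A B C θ') :
    ∃ (K : ℕ) (c : ℕ → α → α → Finset α → ℕ),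
      c 0 = θ ∧ c K = θ' ∧ (∀ k ≤ K, IsRep A B C (c k)) ∧
      ∀ k < K, Adjacent A B C (c k) (c (k + 1)) := by
  induction reflTransGen_fiberStep hAB hAC hBC hAne hBne hθ hθ' with
  | refl => exact ⟨0, fun _ => θ, rfl, rfl, fun _ _ => hθ, fun k hk => absurd hk k.not_lt_zero⟩
  | @tail η η' _ hstep ih =>
    obtain ⟨K, c, h0, hK, hrep, hadj⟩ := ih hstep.1
    refine ⟨K + 1, Function.update c (K + 1) η', ?_, Function.update_self _ _ _, fun k hk => ?_,
      fun k hk => ?_⟩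
    · rw [Function.update_of_ne (by omega), h0]
    · rcases Nat.lt_or_eq_of_le hk with hk | rfl
      · rw [Function.update_of_ne (by omega)]
        exact hrep k (by omega)
      · rw [Function.update_self]
        exact hstep.2.1
    · rw [Function.update_of_ne (by omega : k ≠ K + 1)]
      rcases Nat.lt_or_eq_of_le (Nat.le_of_lt_succ hk) with hk | rfl
      · rw [Function.update_of_ne (by omega)]
        exact hadj k hk
      · rw [Function.update_self, hK]
        exact hstep.2.2
end

section
/- Let N be a finite set and A, B, C pairwise disjoint subsets of N with A and B nonempty. Fix enumerations A = {a_1, …, a_m} and B = {b_1, …, b_n}. For any permutations σ of {1,…,m} and τ of {1,…,n}, the (σ,τ)-permuted standard representation of u_{⟨A,B|C⟩} is connected to the standard representation by a finite sequence of adjacent representations, i.e., it is obtained from the standard representation by applying two-by-two basic relations. -/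
open Finset

/-- The `(σ,τ)`-permuted standard representation: coefficient `1` on each elementary
imset `u_{⟨a_{σ(i)}, b_{τ(j)} | {a_{σ(1)},…,a_{σ(i−1)}} ∪ {b_{τ(1)},…,b_{τ(j−1)}} ∪ C⟩}`
and `0` elsewhere. -/
def permStd {α : Type*} [DecidableEq α] {m n : ℕ} (a : Fin m → α) (b : Fin n → α)
    (C : Finset α) (σ : Equiv.Perm (Fin m)) (τ : Equiv.Perm (Fin n)) :
    α → α → Finset α → ℕ := fun x y Z =>
  ∑ i : Fin m, ∑ j : Fin n,
    if x = a (σ i) ∧ y = b (τ j) ∧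
        Z = ((Finset.Iio i).image fun k => a (σ k)) ∪
            ((Finset.Iio j).image fun k => b (τ k)) ∪ C
    then 1 else 0

namespace Imset

variable {α : Type*} [DecidableEq α]

/-- The coefficient vector of a single elementary imset `u_{⟨x,y|Γ⟩}`. -/
def single (x y : α) (Γ : Finset α) : α → α → Finset α → ℕ := fun x' y' Z =>
  if x' = x ∧ y' = y ∧ Z = Γ then 1 else 0

/-- The standard representation of `u_{⟨{x},l|Γ⟩}` along the list `l`. -/
def rowRep (x : α) : List α → Finset α → α → α → Finset α → ℕ
  | [], _ => 0
  | y :: l, Γ => single x y Γ + rowRep x l (insert y Γ)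

/-- The standard representation of `u_{⟨k,l|Γ⟩}` along the lists `k` and `l`. -/
def listRep : List α → List α → Finset α → α → α → Finset α → ℕ
  | [], _, _ => 0
  | x :: k, l, Γ => rowRep x l Γ + listRep k l (insert x Γ)

/-- The imset given by an integer combination of elementary imsets. -/
def eval (A B C : Finset α) (f : α → α → Finset α → ℤ) (S : Finset α) : ℤ :=
  ∑ a ∈ A, ∑ b ∈ B, ∑ Γ ∈ (A ∪ B ∪ C).powerset, f a b Γ * uim {a} {b} Γ S

theorem eval_add (A B C : Finset α) (f g : α → α → Finset α → ℤ) (S : Finset α) :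
    eval A B C (f + g) S = eval A B C f S + eval A B C g S := by
  simp [eval, add_mul, sum_add_distrib]

theorem eval_sub (A B C : Finset α) (f g : α → α → Finset α → ℤ) (S : Finset α) :
    eval A B C (f - g) S = eval A B C f S - eval A B C g S := by
  simp [eval, sub_mul, sum_sub_distrib]

theorem eval_single {A B C : Finset α} {x y : α} {Γ : Finset α} (hx : x ∈ A) (hy : y ∈ B)
    (hΓ : Γ ⊆ A ∪ B ∪ C) (S : Finset α) :
    eval A B C (fun x' y' Z => if x' = x ∧ y' = y ∧ Z = Γ then 1 else 0) S =
      uim {x} {y} Γ S := by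
  unfold eval
  rw [sum_eq_single_of_mem x hx, sum_eq_single_of_mem y hy,
    sum_eq_single_of_mem Γ (mem_powerset.2 hΓ)]
  · simp
  · intro Z _ h; simp [h]
  · intro y' _ h; simp [h]
  · intro x' _ h; simp [h]

theorem uim_insert_right (x y : α) (B Γ S : Finset α) :
    uim {x} (insert y B) Γ S = uim {x} {y} Γ S + uim {x} B (insert y Γ) S := by
  have h₁ : {x} ∪ insert y B ∪ Γ = {x} ∪ B ∪ insert y Γ := by ext; simp
  have h₂ : insert y B ∪ Γ = B ∪ insert y Γ := by ext; simp
  have h₃ : {x} ∪ {y} ∪ Γ = {x} ∪ insert y Γ := by ext; simp; tauto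
  have h₄ : {y} ∪ Γ = insert y Γ := rfl
  simp only [uim, h₁, h₂, h₃, h₄]
  ring

theorem uim_insert_left (x : α) (A B Γ S : Finset α) :
    uim (insert x A) B Γ S = uim {x} B Γ S + uim A B (insert x Γ) S := by
  have h₁ : insert x A ∪ B ∪ Γ = A ∪ B ∪ insert x Γ := by ext; simp
  have h₂ : insert x A ∪ Γ = A ∪ insert x Γ := by ext; simp
  have h₃ : {x} ∪ B ∪ Γ = B ∪ insert x Γ := by ext; simp
  have h₄ : {x} ∪ Γ = insert x Γ := rfl
  simp only [uim, h₁, h₂, h₃, h₄]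
  ring

theorem uim_empty_left (B Γ S : Finset α) : uim ∅ B Γ S = 0 := by
  simp only [uim, empty_union]; ring

theorem uim_empty_right (A Γ S : Finset α) : uim A ∅ Γ S = 0 := by
  simp only [uim, empty_union, union_empty]; ring

theorem eval_rowRep {A B C : Finset α} {x : α} (hx : x ∈ A) (S : Finset α) :
    ∀ (l : List α) (Γ : Finset α), (∀ y ∈ l, y ∈ B) → Γ ⊆ A ∪ B ∪ C →
      eval A B C (fun a b Z => (rowRep x l Γ a b Z : ℤ)) S = uim {x} l.toFinset Γ S
  | [], Γ, _, _ => by simp [rowRep, eval, uim_empty_right]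
  | y :: l, Γ, hl, hΓ => by
    simp only [List.mem_cons, forall_eq_or_imp] at hl
    have hy : insert y Γ ⊆ A ∪ B ∪ C := insert_subset (by simp [hl.1]) hΓ
    rw [List.toFinset_cons, uim_insert_right, ← eval_rowRep hx S l _ hl.2 hy,
      ← eval_single hx hl.1 hΓ, ← eval_add]
    congr 1
    funext a b Z
    simp [rowRep, single]

theorem eval_listRep {A B C : Finset α} {l : List α} (hl : ∀ y ∈ l, y ∈ B) (S : Finset α) :
    ∀ (k : List α) (Γ : Finset α), (∀ x ∈ k, x ∈ A) → Γ ⊆ A ∪ B ∪ C →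
      eval A B C (fun a b Z => (listRep k l Γ a b Z : ℤ)) S = uim k.toFinset l.toFinset Γ S
  | [], Γ, _, _ => by simp [listRep, eval, uim_empty_left]
  | x :: k, Γ, hk, hΓ => by
    simp only [List.mem_cons, forall_eq_or_imp] at hk
    have hx : insert x Γ ⊆ A ∪ B ∪ C := insert_subset (by simp [hk.1]) hΓ
    rw [List.toFinset_cons, uim_insert_left, ← eval_listRep hl S k _ hk.2 hx,
      ← eval_rowRep hk.1 S l Γ hl hΓ, ← eval_add]
    congr 1

theorem rowRep_support {x a b : α} {Z : Finset α} :
    ∀ {l : List α} {Γ : Finset α}, l.Nodup → (∀ y ∈ l, y ∉ Γ) → x ∉ Γ → x ∉ l →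
      rowRep x l Γ a b Z ≠ 0 →
      a = x ∧ b ∈ l ∧ Γ ⊆ Z ∧ Z ⊆ Γ ∪ l.toFinset ∧ a ∉ Z ∧ b ∉ Z
  | [], Γ, _, _, _, _, h => by simp [rowRep] at h
  | y :: l, Γ, hn, hl, hx, hxl, h => by
    simp only [List.mem_cons, forall_eq_or_imp, List.nodup_cons, not_or] at hl hn hxl
    by_cases h0 : a = x ∧ b = y ∧ Z = Γ
    · obtain ⟨rfl, rfl, rfl⟩ := h0
      refine ⟨rfl, by simp, subset_rfl, subset_union_left, hx, hl.1⟩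
    · obtain ⟨h₁, h₂, h₃, h₄, h₅⟩ := rowRep_support (Γ := insert y Γ) hn.2
        (by grind) (by grind) hxl.2 (by simpa [rowRep, single, h0] using h)
      refine ⟨h₁, by simp [h₂], (subset_insert _ _).trans h₃, fun z hz => ?_, h₅⟩
      have := h₄ hz
      simp at this ⊢
      tauto

theorem listRep_support {a b : α} {Z : Finset α} {l : List α} (hn : l.Nodup) :
    ∀ {k : List α} {Γ : Finset α}, k.Nodup → (∀ x ∈ k, x ∉ Γ) → (∀ y ∈ l, y ∉ Γ) →
      (∀ x ∈ k, x ∉ l) → listRep k l Γ a b Z ≠ 0 →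
      a ∈ k ∧ b ∈ l ∧ Γ ⊆ Z ∧ Z ⊆ Γ ∪ k.toFinset ∪ l.toFinset ∧ a ∉ Z ∧ b ∉ Z
  | [], Γ, _, _, _, _, h => by simp [listRep] at h
  | x :: k, Γ, hk, hkΓ, hlΓ, hkl, h => by
    simp only [List.mem_cons, forall_eq_or_imp, List.nodup_cons] at hk hkΓ hkl
    by_cases h0 : rowRep x l Γ a b Z = 0
    · obtain ⟨h₁, h₂, h₃, h₄, h₅⟩ := listRep_support (Γ := insert x Γ) hn hk.2
        (by grind) (by grind) hkl.2 (by simpa [listRep, h0] using h)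
      refine ⟨by simp [h₁], h₂, (subset_insert _ _).trans h₃, fun z hz => ?_, h₅⟩
      have := h₄ hz
      simp at this ⊢
      tauto
    · obtain ⟨h₁, h₂, h₃, h₄, h₅⟩ := rowRep_support hn hlΓ hkΓ.1 hkl.1 h0
      refine ⟨by simp [h₁], h₂, h₃, fun z hz => ?_, h₅⟩
      have := h₄ hz
      simp at this ⊢
      tauto

theorem isRep_listRep {C : Finset α} {k l : List α} (hk : k.Nodup) (hl : l.Nodup)
    (hkl : ∀ x ∈ k, x ∉ l) (hkC : ∀ x ∈ k, x ∉ C) (hlC : ∀ y ∈ l, y ∉ C) :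
    IsRep k.toFinset l.toFinset C (listRep k l C) := by
  refine ⟨fun a b Γ h => ?_, fun S => ?_⟩
  · obtain ⟨h₁, h₂, h₃, h₄, h₅⟩ := listRep_support hl hk hkC hlC hkl h
    refine ⟨by simpa using h₁, by simpa using h₂, h₃, fun z hz => ?_, h₅⟩
    have := h₄ hz
    simp at this ⊢
    tauto
  · exact (eval_listRep (by simp) S k C (by simp) subset_union_right).symm

theorem isRep_of_sub_eq {A B C : Finset α} {θ θ' : α → α → Finset α → ℕ} (h : IsRep A B C θ)
    {p q r s : α × α × Finset α}
    (hE : ∀ t ∈ [p, q, r, s], t.1 ∈ A ∧ t.2.1 ∈ B ∧ C ⊆ t.2.2 ∧ t.2.2 ⊆ A ∪ B ∪ C ∧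
      t.1 ∉ t.2.2 ∧ t.2.1 ∉ t.2.2)
    (hu : ∀ S, uim {p.1} {p.2.1} p.2.2 S + uim {q.1} {q.2.1} q.2.2 S =
      uim {r.1} {r.2.1} r.2.2 S + uim {s.1} {s.2.1} s.2.2 S)
    (hd : ∀ x y Z, (θ x y Z : ℤ) - θ' x y Z =
      (if x = p.1 ∧ y = p.2.1 ∧ Z = p.2.2 then 1 else 0)
      + (if x = q.1 ∧ y = q.2.1 ∧ Z = q.2.2 then 1 else 0)
      - (if x = r.1 ∧ y = r.2.1 ∧ Z = r.2.2 then 1 else 0)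
      - (if x = s.1 ∧ y = s.2.1 ∧ Z = s.2.2 then 1 else 0)) :
    IsRep A B C θ' := by
  simp only [List.mem_cons, List.not_mem_nil, or_false, forall_eq_or_imp, forall_eq] at hE
  obtain ⟨hp, hq, hr, hs⟩ := hE
  refine ⟨fun a b Γ hne => ?_, fun S => ?_⟩
  · by_cases h0 : θ a b Γ = 0
    · have := hd a b Γ
      by_cases h₁ : a = r.1 ∧ b = r.2.1 ∧ Γ = r.2.2
      · obtain ⟨rfl, rfl, rfl⟩ := h₁; exact hr
      by_cases h₂ : a = s.1 ∧ b = s.2.1 ∧ Γ = s.2.2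
      · obtain ⟨rfl, rfl, rfl⟩ := h₂; exact hs
      rw [if_neg h₁, if_neg h₂] at this
      split_ifs at this <;> omega
    · exact h.1 a b Γ h0
  · rw [h.2 S]
    change eval A B C (fun a b Z => (θ a b Z : ℤ)) S = eval A B C (fun a b Z => (θ' a b Z : ℤ)) S
    rw [← sub_eq_zero, ← eval_sub]
    have := hu S
    rw [← eval_single hp.1 hp.2.1 hp.2.2.2.1, ← eval_single hq.1 hq.2.1 hq.2.2.2.1,
      ← eval_single hr.1 hr.2.1 hr.2.2.2.1, ← eval_single hs.1 hs.2.1 hs.2.2.2.1,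
      ← eval_add, ← eval_add, ← sub_eq_zero, ← eval_sub] at this
    rw [← this]
    congr 1
    funext x y Z
    simp only [Pi.sub_apply, Pi.add_apply, hd]
    ring

theorem uim_exchange_right (x y z : α) (Γ S : Finset α) :
    uim {x} {y} Γ S + uim {x} {z} (insert y Γ) S =
      uim {x} {z} Γ S + uim {x} {y} (insert z Γ) S := by
  rw [← uim_insert_right, ← uim_insert_right, pair_comm]

theorem uim_exchange_left (x y z : α) (Γ S : Finset α) :
    uim {x} {z} Γ S + uim {y} {z} (insert x Γ) S =
      uim {y} {z} Γ S + uim {x} {z} (insert y Γ) S := by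
  rw [← uim_insert_left, ← uim_insert_left, pair_comm]

theorem isRep_of_adjacent {A B C : Finset α} (hAB : Disjoint A B)
    {θ θ' : α → α → Finset α → ℕ} (h : IsRep A B C θ) (hadj : Adjacent A B C θ θ') :
    IsRep A B C θ' := by
  have hne : ∀ {x y}, x ∈ A → y ∈ B → x ≠ y := fun hx hy e =>
    disjoint_left.1 hAB hx (e ▸ hy)
  rcases hadj with ⟨x, y, z, Γ, hx, hy, hz, hyz, hC, hΓ, hxΓ, hyΓ, hzΓ, hd⟩ |
    ⟨x, y, z, Γ, hx, hy, hz, hxy, hC, hΓ, hxΓ, hyΓ, hzΓ, hd⟩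
  · refine isRep_of_sub_eq h (p := (x, y, Γ)) (q := (x, z, insert y Γ)) (r := (x, z, Γ))
      (s := (x, y, insert z Γ)) ?_ (uim_exchange_right x y z Γ) hd
    have := hne hx hy
    have := hne hx hz
    simp only [List.mem_cons, List.not_mem_nil, or_false, forall_eq_or_imp, forall_eq]
    grind
  · refine isRep_of_sub_eq h (p := (x, z, Γ)) (q := (y, z, insert x Γ)) (r := (y, z, Γ))
      (s := (x, z, insert y Γ)) ?_ (uim_exchange_left x y z Γ) hd
    have := hne hx hz
    have := hne hy hz
    simp only [List.mem_cons, List.not_mem_nil, or_false, forall_eq_or_imp, forall_eq]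
    grind

/-- Being connected by a finite sequence of two-by-two moves. -/
def Connected (A B C : Finset α) : (θ θ' : α → α → Finset α → ℕ) → Prop :=
  Relation.ReflTransGen (Adjacent A B C)

theorem Connected.add_left {A B C : Finset α} {θ θ' : α → α → Finset α → ℕ}
    (h : Connected A B C θ θ') (ρ : α → α → Finset α → ℕ) :
    Connected A B C (ρ + θ) (ρ + θ') := by
  refine Relation.ReflTransGen.lift (ρ + ·) (fun φ ψ hφ => ?_) _ _ h
  simpa [Adjacent] using hφ

theorem Connected.add {A B C : Finset α} {θ θ' ρ ρ' : α → α → Finset α → ℕ}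
    (h : Connected A B C θ θ') (h' : Connected A B C ρ ρ') :
    Connected A B C (θ + ρ) (θ' + ρ') := by
  refine (h'.add_left θ).trans ?_
  rw [add_comm θ, add_comm θ']
  exact h.add_left ρ'

theorem connected_exchange_right {A B C Γ : Finset α} {x y z : α} (hx : x ∈ A) (hy : y ∈ B)
    (hz : z ∈ B) (hyz : y ≠ z) (hC : C ⊆ Γ) (hΓ : Γ ⊆ A ∪ B ∪ C) (hxΓ : x ∉ Γ) (hyΓ : y ∉ Γ)
    (hzΓ : z ∉ Γ) :
    Connected A B C (single x y Γ + single x z (insert y Γ))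
      (single x z Γ + single x y (insert z Γ)) := by
  refine .single (.inl ⟨x, y, z, Γ, hx, hy, hz, hyz, hC, hΓ, hxΓ, hyΓ, hzΓ, fun a b Z => ?_⟩)
  simp only [single, Pi.add_apply]
  push_cast
  ring

theorem connected_exchange_left {A B C Γ : Finset α} {x y z : α} (hx : x ∈ A) (hy : y ∈ A)
    (hz : z ∈ B) (hxy : x ≠ y) (hC : C ⊆ Γ) (hΓ : Γ ⊆ A ∪ B ∪ C) (hxΓ : x ∉ Γ) (hyΓ : y ∉ Γ)
    (hzΓ : z ∉ Γ) :
    Connected A B C (single x z Γ + single y z (insert x Γ))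
      (single y z Γ + single x z (insert y Γ)) := by
  refine .single (.inr ⟨x, y, z, Γ, hx, hy, hz, hxy, hC, hΓ, hxΓ, hyΓ, hzΓ, fun a b Z => ?_⟩)
  simp only [single, Pi.add_apply]
  push_cast
  ring

theorem connected_rowRep_of_perm {A B C : Finset α} {x : α} (hx : x ∈ A) (hxB : x ∉ B)
    {l l' : List α} (h : l.Perm l') :
    ∀ {Γ : Finset α}, l.Nodup → (∀ y ∈ l, y ∈ B) → (∀ y ∈ l, y ∉ Γ) → x ∉ Γ → C ⊆ Γ →
      Γ ⊆ A ∪ B ∪ C → Connected A B C (rowRep x l Γ) (rowRep x l' Γ) := by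
  induction h with
  | nil => exact fun _ _ _ _ _ _ => .refl
  | cons y h ih =>
    intro Γ hn hB hl hxΓ hC hΓ
    simp only [List.mem_cons, forall_eq_or_imp, List.nodup_cons] at hn hB hl
    refine (ih (Γ := insert y Γ) hn.2 hB.2 ?_ ?_ ?_ ?_).add_left _ <;> grind
  | swap y z l =>
    intro Γ hn hB hl hxΓ hC hΓ
    simp only [List.mem_cons, forall_eq_or_imp, List.nodup_cons, not_or] at hn hB hl
    simp only [rowRep, ← add_assoc]
    rw [Finset.insert_comm]
    exact (connected_exchange_right hx hB.1 hB.2.1 hn.1.1 hC hΓ hxΓ hl.1 hl.2.1).add .refl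
  | trans h _ ih ih' =>
    intro Γ hn hB hl hxΓ hC hΓ
    exact (ih hn hB hl hxΓ hC hΓ).trans (ih' (h.nodup_iff.1 hn)
      (fun y hy => hB y (h.mem_iff.2 hy)) (fun y hy => hl y (h.mem_iff.2 hy)) hxΓ hC hΓ)

theorem connected_listRep_of_perm_right {A B C : Finset α} (hAB : Disjoint A B)
    {l l' : List α} (h : l.Perm l') (hn : l.Nodup) (hB : ∀ y ∈ l, y ∈ B) :
    ∀ {k : List α} {Γ : Finset α}, k.Nodup → (∀ x ∈ k, x ∈ A) → (∀ x ∈ k, x ∉ Γ) →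
      (∀ y ∈ l, y ∉ Γ) → C ⊆ Γ → Γ ⊆ A ∪ B ∪ C →
      Connected A B C (listRep k l Γ) (listRep k l' Γ)
  | [], _, _, _, _, _, _, _ => .refl
  | x :: k, Γ, hk, hA, hkΓ, hlΓ, hC, hΓ => by
    simp only [List.mem_cons, forall_eq_or_imp, List.nodup_cons] at hk hA hkΓ
    have hx := disjoint_left.1 hAB hA.1
    refine (connected_rowRep_of_perm hA.1 hx h hn hB hlΓ hkΓ.1 hC hΓ).add
      (connected_listRep_of_perm_right hAB h hn hB hk.2 hA.2 ?_ ?_ ?_ ?_) <;> grind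

theorem connected_rowRep_exchange {A B C : Finset α} (hAB : Disjoint A B) {x y : α}
    (hx : x ∈ A) (hy : y ∈ A) (hxy : x ≠ y) :
    ∀ {l : List α} {Γ : Finset α}, l.Nodup → (∀ z ∈ l, z ∈ B) → (∀ z ∈ l, z ∉ Γ) → x ∉ Γ →
      y ∉ Γ → C ⊆ Γ → Γ ⊆ A ∪ B ∪ C →
      Connected A B C (rowRep x l Γ + rowRep y l (insert x Γ))
        (rowRep y l Γ + rowRep x l (insert y Γ))
  | [], _, _, _, _, _, _, _, _ => .refl
  | z :: l, Γ, hn, hB, hl, hxΓ, hyΓ, hC, hΓ => by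
    simp only [List.mem_cons, forall_eq_or_imp, List.nodup_cons] at hn hB hl
    simp only [rowRep]
    rw [add_add_add_comm, add_add_add_comm (single y z Γ), Finset.insert_comm z x, Finset.insert_comm z y]
    have hzx : x ≠ z := fun e => disjoint_left.1 hAB hx (e ▸ hB.1)
    have hzy : y ≠ z := fun e => disjoint_left.1 hAB hy (e ▸ hB.1)
    refine (connected_exchange_left hx hy hB.1 hxy hC hΓ hxΓ hyΓ hl.1).add
      (connected_rowRep_exchange hAB hx hy hxy hn.2 hB.2 ?_ ?_ ?_ ?_ ?_) <;> grind

theorem connected_listRep_of_perm_left {A B C : Finset α} (hAB : Disjoint A B)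
    {l : List α} (hn : l.Nodup) (hB : ∀ y ∈ l, y ∈ B) {k k' : List α} (h : k.Perm k') :
    ∀ {Γ : Finset α}, k.Nodup → (∀ x ∈ k, x ∈ A) → (∀ x ∈ k, x ∉ Γ) →
      (∀ y ∈ l, y ∉ Γ) → C ⊆ Γ → Γ ⊆ A ∪ B ∪ C →
      Connected A B C (listRep k l Γ) (listRep k' l Γ) := by
  induction h with
  | nil => exact fun _ _ _ _ _ _ => .refl
  | cons x h ih =>
    intro Γ hk hA hkΓ hlΓ hC hΓ
    simp only [List.mem_cons, forall_eq_or_imp, List.nodup_cons] at hk hA hkΓ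
    have hx := disjoint_left.1 hAB hA.1
    refine (ih (Γ := insert x Γ) hk.2 hA.2 ?_ ?_ ?_ ?_).add_left _ <;> grind
  | swap x y k =>
    intro Γ hk hA hkΓ hlΓ hC hΓ
    simp only [List.mem_cons, forall_eq_or_imp, List.nodup_cons, not_or] at hk hA hkΓ
    simp only [listRep, ← add_assoc]
    rw [Finset.insert_comm]
    exact (connected_rowRep_exchange hAB hA.1 hA.2.1 hk.1.1 hn hB hlΓ hkΓ.1 hkΓ.2.1 hC hΓ).add
      .refl
  | trans h _ ih ih' =>
    intro Γ hk hA hkΓ hlΓ hC hΓ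
    exact (ih hk hA hkΓ hlΓ hC hΓ).trans (ih' (h.nodup_iff.1 hk)
      (fun y hy => hA y (h.mem_iff.2 hy)) (fun y hy => hkΓ y (h.mem_iff.2 hy)) hlΓ hC hΓ)

theorem image_Iio_succ {n : ℕ} (f : Fin (n + 1) → α) (i : Fin n) :
    (Iio i.succ).image f = insert (f 0) ((Iio i).image fun j => f j.succ) := by
  ext z
  simp [Fin.exists_fin_succ, eq_comm]

theorem image_Iio_zero {n : ℕ} (f : Fin (n + 1) → α) : (Iio 0).image f = ∅ := by
  ext; simp

theorem rowRep_ofFn (x : α) {n : ℕ} (g : Fin n → α) (Γ : Finset α) (a b : α) (Z : Finset α) :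
    rowRep x (List.ofFn g) Γ a b Z =
      ∑ j, if a = x ∧ b = g j ∧ Z = (Iio j).image g ∪ Γ then 1 else 0 := by
  induction n generalizing Γ with
  | zero => simp [rowRep]
  | succ n ih =>
    rw [List.ofFn_succ, Fin.sum_univ_succ]
    simp only [rowRep, Pi.add_apply, ih, image_Iio_succ, single, insert_union, union_insert]
    simp [image_Iio_zero]

theorem listRep_ofFn {m n : ℕ} (f : Fin m → α) (g : Fin n → α) (Γ : Finset α) (a b : α)
    (Z : Finset α) :
    listRep (List.ofFn f) (List.ofFn g) Γ a b Z =
      ∑ i, ∑ j, if a = f i ∧ b = g j ∧ Z = (Iio i).image f ∪ (Iio j).image g ∪ Γ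
        then 1 else 0 := by
  induction m generalizing Γ with
  | zero => simp [listRep]
  | succ m ih =>
    rw [List.ofFn_succ, Fin.sum_univ_succ]
    simp only [listRep, Pi.add_apply, ih, image_Iio_succ, rowRep_ofFn, insert_union, union_insert]
    simp [image_Iio_zero]

theorem permStd_eq_listRep {m n : ℕ} (a : Fin m → α) (b : Fin n → α) (C : Finset α)
    (σ : Equiv.Perm (Fin m)) (τ : Equiv.Perm (Fin n)) :
    permStd a b C σ τ = listRep (List.ofFn (a ∘ σ)) (List.ofFn (b ∘ τ)) C := by
  funext x y Z
  rw [listRep_ofFn]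
  rfl

theorem Connected.exists_chain {A B C : Finset α} (hAB : Disjoint A B)
    {θ θ' : α → α → Finset α → ℕ} (hθ : IsRep A B C θ) (h : Connected A B C θ θ') :
    ∃ (K : ℕ) (c : ℕ → α → α → Finset α → ℕ), c 0 = θ ∧ c K = θ' ∧
      (∀ k ≤ K, IsRep A B C (c k)) ∧ ∀ k < K, Adjacent A B C (c k) (c (k + 1)) := by
  induction h using Relation.ReflTransGen.head_induction_on with
  | refl => exact ⟨0, fun _ => θ', rfl, rfl, fun _ _ => hθ, by simp⟩
  | head hadj _ ih =>
    obtain ⟨K, c, h0, hK, hrep, hstep⟩ := ih (isRep_of_adjacent hAB hθ hadj)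
    refine ⟨K + 1, fun k => Nat.casesOn k _ c, by rfl, hK, ?_, ?_⟩
    · rintro (_ | k) hk
      · exact hθ
      · exact hrep k (by omega)
    · rintro (_ | k) hk
      · simpa [h0] using hadj
      · exact hstep k (by omega)

end Imset

theorem stmt6 {α : Type*} [DecidableEq α] (A B C : Finset α) {m n : ℕ}
    (a : Fin m → α) (b : Fin n → α)
    (hAB : Disjoint A B) (hAC : Disjoint A C) (hBC : Disjoint B C)
    (hAne : A.Nonempty) (hBne : B.Nonempty)
    (ha : Function.Injective a) (hb : Function.Injective b)
    (haA : A = Finset.image a Finset.univ) (hbB : B = Finset.image b Finset.univ)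
    (σ : Equiv.Perm (Fin m)) (τ : Equiv.Perm (Fin n)) :
    ∃ (K : ℕ) (c : ℕ → α → α → Finset α → ℕ),
      c 0 = permStd a b C (Equiv.refl (Fin m)) (Equiv.refl (Fin n)) ∧
      c K = permStd a b C σ τ ∧
      (∀ k ≤ K, IsRep A B C (c k)) ∧
      ∀ k < K, Adjacent A B C (c k) (c (k + 1)) := by
  have hk : (List.ofFn a).Nodup := List.nodup_ofFn.2 ha
  have hl : (List.ofFn b).Nodup := List.nodup_ofFn.2 hb
  have hkA : (List.ofFn a).toFinset = A := by ext; simp [haA]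
  have hlB : (List.ofFn b).toFinset = B := by ext; simp [hbB]
  have hmA : ∀ x ∈ List.ofFn a, x ∈ A := fun x hx => hkA ▸ List.mem_toFinset.2 hx
  have hmB : ∀ y ∈ List.ofFn b, y ∈ B := fun y hy => hlB ▸ List.mem_toFinset.2 hy
  have hkC : ∀ x ∈ List.ofFn a, x ∉ C := fun x hx => disjoint_left.1 hAC (hmA x hx)
  have hlC : ∀ y ∈ List.ofFn b, y ∉ C := fun y hy => disjoint_left.1 hBC (hmB y hy)
  have hrep := Imset.isRep_listRep hk hl
    (fun x hx hx' => disjoint_left.1 hAB (hmA x hx) (hmB x hx')) hkC hlC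
  rw [hkA, hlB] at hrep
  have hσ : (List.ofFn a).Perm (List.ofFn (a ∘ σ)) := (Equiv.Perm.ofFn_comp_perm σ a).symm
  have hτ : (List.ofFn b).Perm (List.ofFn (b ∘ τ)) := (Equiv.Perm.ofFn_comp_perm τ b).symm
  rw [Imset.permStd_eq_listRep, Imset.permStd_eq_listRep]
  refine Imset.Connected.exists_chain hAB hrep
    ((Imset.connected_listRep_of_perm_right hAB hτ hl hmB hk hmA hkC hlC subset_rfl
      subset_union_right).trans
    (Imset.connected_listRep_of_perm_left hAB (hτ.nodup_iff.1 hl)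
      (fun y hy => hmB y (hτ.mem_iff.2 hy)) hσ hk hmA hkC
      (fun y hy => hlC y (hτ.mem_iff.2 hy)) subset_rfl subset_union_right))
end

section
/- Let N be a finite set and A, B, C pairwise disjoint subsets of N with A and B nonempty, with enumerations A = {a_1, …, a_m} and B = {b_1, …, b_n}. The map sending a pair (σ, τ) of permutations of {1,…,m} and {1,…,n} to the (σ,τ)-permuted standard representation of u_{⟨A,B|C⟩} is injective; in particular there are exactly m!·n! distinct permuted standard representations. -/
open Finset

theorem permStd_pos_iff {α : Type*} [DecidableEq α] {m n : ℕ} (a : Fin m → α) (b : Fin n → α)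
    (C : Finset α) (σ : Equiv.Perm (Fin m)) (τ : Equiv.Perm (Fin n)) (x y : α) (Z : Finset α) :
    0 < permStd a b C σ τ x y Z ↔ ∃ i j, x = a (σ i) ∧ y = b (τ j) ∧
        Z = ((Finset.Iio i).image fun k => a (σ k)) ∪
            ((Finset.Iio j).image fun k => b (τ k)) ∪ C := by
  simp only [permStd, Finset.sum_pos_iff, Finset.mem_univ, true_and]
  refine exists_congr fun i => exists_congr fun j => ?_
  split_ifs with h <;> simp only [h, Nat.lt_irrefl, Nat.one_pos, and_self]

theorem image_prefix_subset {α : Type*} [DecidableEq α] {m : ℕ} (a : Fin m → α)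
    (σ : Equiv.Perm (Fin m)) (i : Fin m) :
    ((Finset.Iio i).image fun k => a (σ k)) ⊆ Finset.univ.image a := by
  intro x
  simp only [Finset.mem_image, Finset.mem_univ, true_and]
  rintro ⟨k, -, rfl⟩
  exact ⟨σ k, rfl⟩

/-- Intersecting a conditioning set with the range of one enumeration recovers the length of the
corresponding prefix. -/
theorem card_prefix_inter {α : Type*} [DecidableEq α] {m : ℕ} {a : Fin m → α}
    (ha : Function.Injective a) (σ : Equiv.Perm (Fin m)) (i : Fin m) {D : Finset α}
    (hD : Disjoint (Finset.univ.image a) D) :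
    ((((Finset.Iio i).image fun k => a (σ k)) ∪ D) ∩ Finset.univ.image a).card = i := by
  rw [Finset.union_inter_distrib_right, Finset.inter_eq_left.mpr (image_prefix_subset a σ i),
    Finset.disjoint_iff_inter_eq_empty.mp hD.symm, Finset.union_empty,
    Finset.card_image_of_injective (f := fun k => a (σ k)) _ (ha.comp σ.injective), Fin.card_Iio]

theorem eq_of_prefix_union_eq {α : Type*} [DecidableEq α] {m : ℕ} {a : Fin m → α}
    (ha : Function.Injective a) {σ σ' : Equiv.Perm (Fin m)} {i i' : Fin m} {D D' : Finset α}
    (hD : Disjoint (Finset.univ.image a) D) (hD' : Disjoint (Finset.univ.image a) D')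
    (h : ((Finset.Iio i).image fun k => a (σ k)) ∪ D =
      ((Finset.Iio i').image fun k => a (σ' k)) ∪ D') : i = i' := by
  rw [Fin.ext_iff, ← card_prefix_inter ha σ i hD, h, card_prefix_inter ha σ' i' hD']

theorem permStd_injective {α : Type*} [DecidableEq α] {m n : ℕ} [NeZero m] [NeZero n]
    {a : Fin m → α} {b : Fin n → α} {C : Finset α}
    (ha : Function.Injective a) (hb : Function.Injective b)
    (hab : Disjoint (Finset.univ.image a) (Finset.univ.image b))
    (haC : Disjoint (Finset.univ.image a) C) (hbC : Disjoint (Finset.univ.image b) C) :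
    Function.Injective (fun p : Equiv.Perm (Fin m) × Equiv.Perm (Fin n) =>
      permStd a b C p.1 p.2) := by
  rintro ⟨σ, τ⟩ ⟨σ', τ'⟩ h
  have key : ∀ i j, σ i = σ' i ∧ τ j = τ' j := by
    intro i j
    have hpos := (permStd_pos_iff a b C σ τ _ _ _).mpr ⟨i, j, rfl, rfl, rfl⟩
    rw [show permStd a b C σ τ = permStd a b C σ' τ' from h, permStd_pos_iff] at hpos
    obtain ⟨i', j', hx, hy, hZ⟩ := hpos
    have dA : ∀ (ρ : Equiv.Perm (Fin n)) l, Disjoint (Finset.univ.image a)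
        (((Finset.Iio l).image fun t => b (ρ t)) ∪ C) := fun ρ l =>
      Finset.disjoint_union_right.mpr ⟨hab.mono_right (image_prefix_subset b ρ l), haC⟩
    have dB : ∀ (ρ : Equiv.Perm (Fin m)) l, Disjoint (Finset.univ.image b)
        (((Finset.Iio l).image fun t => a (ρ t)) ∪ C) := fun ρ l =>
      Finset.disjoint_union_right.mpr ⟨hab.symm.mono_right (image_prefix_subset a ρ l), hbC⟩
    rw [Finset.union_assoc, Finset.union_assoc] at hZ
    have hi : i = i' := eq_of_prefix_union_eq ha (dA τ j) (dA τ' j') hZ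
    rw [Finset.union_left_comm, Finset.union_left_comm (s := Finset.image _ (Finset.Iio i'))] at hZ
    have hj : j = j' := eq_of_prefix_union_eq hb (dB σ i) (dB σ' i') hZ
    subst hi hj
    exact ⟨ha hx, hb hy⟩
  exact Prod.ext (Equiv.ext fun i => (key i 0).1) (Equiv.ext fun j => (key 0 j).2)

theorem stmt7 {α : Type*} [DecidableEq α] (N A B C : Finset α) {m n : ℕ}
    (a : Fin m → α) (b : Fin n → α)
    (hA : A ⊆ N) (hB : B ⊆ N) (hC : C ⊆ N)
    (hAB : Disjoint A B) (hAC : Disjoint A C) (hBC : Disjoint B C)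
    (hAne : A.Nonempty) (hBne : B.Nonempty)
    (ha : Function.Injective a) (hb : Function.Injective b)
    (haA : A = Finset.image a Finset.univ) (hbB : B = Finset.image b Finset.univ) :
    Function.Injective (fun p : Equiv.Perm (Fin m) × Equiv.Perm (Fin n) =>
      permStd a b C p.1 p.2) ∧
    {θ : α → α → Finset α → ℕ | ∃ σ τ, θ = permStd a b C σ τ}.ncard
      = Nat.factorial m * Nat.factorial n := by
  subst haA hbB
  have : NeZero m := ⟨by rintro rfl; simp at hAne⟩
  have : NeZero n := ⟨by rintro rfl; simp at hBne⟩
  have hinj := permStd_injective ha hb hAB hAC hBC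
  refine ⟨hinj, ?_⟩
  have hrange : {θ : α → α → Finset α → ℕ | ∃ σ τ, θ = permStd a b C σ τ} =
      Set.range (fun p : Equiv.Perm (Fin m) × Equiv.Perm (Fin n) =>
        permStd a b C p.1 p.2) := by
    ext θ
    simp [eq_comm]
  rw [hrange, ← Set.image_univ, Set.ncard_image_of_injective _ hinj, Set.ncard_univ]
  simp [Nat.card_eq_fintype_card, Fintype.card_perm]
end

section
/- Let N be a finite set and A, B, C pairwise disjoint subsets of N with A = {a} a singleton and B nonempty with |B| = n. Then the fiber F_{⟨{a},B|C⟩} has exactly n! elements, i.e., there are exactly |B|! different representations of u_{⟨a,B|C⟩} by elementary imsets. -/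
open Finset

/-- The unit edge from `s` to `insert b s`, as an edge weighting of the Boolean lattice. -/
def unitEdge {α : Type*} [DecidableEq α] (b : α) (s : Finset α) : α → Finset α → ℕ :=
  fun x Γ => if x = b ∧ Γ = s then 1 else 0

/-- `φ` is a unit flow from `s` to `t` in the Boolean lattice of subsets of `t`, where `φ b Γ` is
the weight of the edge from `Γ` to `insert b Γ`. -/
def IsUnitFlow {α : Type*} [DecidableEq α] (s t : Finset α) (φ : α → Finset α → ℕ) : Prop :=
  (∀ b Γ, φ b Γ ≠ 0 → b ∈ t ∧ b ∉ Γ ∧ Γ ⊆ t) ∧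
  ∀ S : Finset α, (if S = s then 1 else 0) + ∑ b ∈ t, (if b ∈ S then φ b (S.erase b) else 0) =
    (if S = t then 1 else 0) + ∑ b ∈ t, φ b S

section UnitFlow

variable {α : Type*} [DecidableEq α] {s t : Finset α} {φ : α → Finset α → ℕ}

theorem IsUnitFlow.subset_of_ne_zero (h : IsUnitFlow s t φ) (Γ : Finset α) :
    ∀ b, φ b Γ ≠ 0 → s ⊆ Γ := by
  induction Γ using Finset.strongInduction with
  | H Γ ih =>
    intro b hb
    by_cases hΓ : Γ = s
    · exact hΓ.ge
    have hbt := (h.1 b Γ hb).1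
    have hle : φ b Γ ≤ ∑ x ∈ t, φ x Γ :=
      single_le_sum (f := fun x => φ x Γ) (fun _ _ => Nat.zero_le _) hbt
    have heq := h.2 Γ
    rw [if_neg hΓ] at heq
    have hpos : ∑ x ∈ t, (if x ∈ Γ then φ x (Γ.erase x) else 0) ≠ 0 := by omega
    obtain ⟨x, -, hx⟩ := exists_ne_zero_of_sum_ne_zero hpos
    have hxΓ : x ∈ Γ := by
      by_contra hxΓ
      exact hx (if_neg hxΓ)
    rw [if_pos hxΓ] at hx
    exact (ih _ (erase_ssubset hxΓ) x hx).trans (erase_subset _ _)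

theorem isUnitFlow_add_unitEdge_iff {b : α} (hst : s ⊆ t) (hbt : b ∈ t) (hbs : b ∉ s) :
    IsUnitFlow s t (φ + unitEdge b s) ↔ IsUnitFlow (insert b s) t φ := by
  have hout (S : Finset α) : ∑ x ∈ t, unitEdge b s x S = if S = s then 1 else 0 := by
    simp [unitEdge, ite_and, hbt]
  have hin (S : Finset α) : ∑ x ∈ t, (if x ∈ S then unitEdge b s x (S.erase x) else 0) =
      if S = insert b s then 1 else 0 := by
    rw [sum_eq_single_of_mem b hbt (fun x _ hx => by simp [unitEdge, hx])]
    have : (b ∈ S ∧ S.erase b = s) ↔ S = insert b s := by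
      constructor
      · rintro ⟨hb, rfl⟩
        exact (insert_erase hb).symm
      · rintro rfl
        exact ⟨mem_insert_self _ _, erase_insert hbs⟩
    simp only [unitEdge, true_and, ← this, ite_and]
  have hsplit (S : Finset α) :
      ∑ x ∈ t, (if x ∈ S then (φ + unitEdge b s) x (S.erase x) else 0) =
        ∑ x ∈ t, (if x ∈ S then φ x (S.erase x) else 0) + if S = insert b s then 1 else 0 := by
    rw [← hin, ← sum_add_distrib]
    refine sum_congr rfl fun x _ => ?_
    split_ifs <;> simp
  have hsplit' (S : Finset α) : ∑ x ∈ t, (φ + unitEdge b s) x S =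
      ∑ x ∈ t, φ x S + if S = s then 1 else 0 := by
    rw [← hout, ← sum_add_distrib]
    rfl
  refine and_congr ⟨fun h x Γ hx => h x Γ ?_, fun h x Γ hx => ?_⟩ (forall_congr' fun S => ?_)
  · simp only [Pi.add_apply]
    omega
  · by_cases hφ : φ x Γ = 0
    · have : x = b ∧ Γ = s := by
        by_contra hne
        simp [hφ, unitEdge, hne] at hx
      obtain ⟨rfl, rfl⟩ := this
      exact ⟨hbt, hbs, hst⟩
    · exact h x Γ hφ
  · rw [hsplit, hsplit']
    omega

theorem isUnitFlow_self_iff : IsUnitFlow t t φ ↔ φ = 0 := by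
  constructor
  · intro h
    funext b Γ
    by_contra hb
    exact (h.1 b Γ hb).2.1 (h.subset_of_ne_zero Γ b hb (h.1 b Γ hb).1)
  · rintro rfl
    simp [IsUnitFlow]

theorem IsUnitFlow.exists_eq_add_unitEdge (h : IsUnitFlow s t φ) (hst : s ≠ t) :
    ∃ b ∈ t \ s, ∃ ψ, φ = ψ + unitEdge b s := by
  have hin : ∑ b ∈ t, (if b ∈ s then φ b (s.erase b) else 0) = 0 := by
    refine sum_eq_zero fun b _ => ?_
    split_ifs with hb
    · by_contra hne
      exact notMem_erase b s (h.subset_of_ne_zero _ b hne hb)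
    · rfl
  have heq := h.2 s
  rw [hin, if_pos rfl, if_neg hst] at heq
  obtain ⟨b, hbt, hb⟩ := exists_ne_zero_of_sum_ne_zero (s := t) (f := fun b => φ b s) (by omega)
  refine ⟨b, mem_sdiff.2 ⟨hbt, (h.1 b s hb).2.1⟩, φ - unitEdge b s, ?_⟩
  funext x Γ
  simp only [Pi.add_apply, Pi.sub_apply, unitEdge]
  split_ifs with hx
  · obtain ⟨rfl, rfl⟩ := hx
    omega
  · omega

open Classical in
theorem exists_finset_isUnitFlow (k : ℕ) (s t : Finset α) (hst : s ⊆ t) (hk : (t \ s).card = k) :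
    ∃ F : Finset (α → Finset α → ℕ), F.card = k.factorial ∧ ∀ φ, φ ∈ F ↔ IsUnitFlow s t φ := by
  induction k generalizing s with
  | zero =>
    obtain rfl : s = t := hst.antisymm (sdiff_eq_empty_iff_subset.1 (card_eq_zero.1 hk))
    exact ⟨{0}, by simp, fun φ => by rw [isUnitFlow_self_iff, mem_singleton]⟩
  | succ k ih =>
    have hne : s ≠ t := by
      rintro rfl
      simp at hk
    have hstep (b : α) (hb : b ∈ t \ s) : ∃ F : Finset (α → Finset α → ℕ),
        F.card = k.factorial ∧ ∀ φ, φ ∈ F ↔ IsUnitFlow (insert b s) t φ := by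
      refine ih _ (insert_subset (mem_sdiff.1 hb).1 hst) ?_
      rw [sdiff_insert, card_erase_of_mem hb, hk, Nat.add_sub_cancel]
    choose! F hcard hF using hstep
    refine ⟨(t \ s).biUnion fun b => (F b).image (· + unitEdge b s), ?_, fun φ => ?_⟩
    · rw [card_biUnion, sum_congr rfl fun b hb => (card_image_of_injective _
        (add_left_injective (unitEdge b s))).trans (hcard b hb), sum_const, hk, smul_eq_mul,
        Nat.factorial_succ]
      intro b hb c hc hbc
      rw [Function.onFun, Finset.disjoint_left]
      intro φ hφ hφ'
      obtain ⟨ψ, hψ, rfl⟩ := mem_image.1 hφ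
      obtain ⟨χ, -, hχ⟩ := mem_image.1 hφ'
      have hval := congr_fun (congr_fun hχ c) s
      have hne : ψ c s ≠ 0 := by
        simp [unitEdge, hbc.symm] at hval
        omega
      exact (mem_sdiff.1 hb).2
        (((hF b hb ψ).1 hψ).subset_of_ne_zero s c hne (mem_insert_self _ _))
    · simp only [mem_biUnion, mem_image]
      constructor
      · rintro ⟨b, hb, ψ, hψ, rfl⟩
        have hb' := mem_sdiff.1 hb
        exact (isUnitFlow_add_unitEdge_iff hst hb'.1 hb'.2).2 ((hF b hb ψ).1 hψ)
      · intro h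
        obtain ⟨b, hb, ψ, rfl⟩ := h.exists_eq_add_unitEdge hne
        have hb' := mem_sdiff.1 hb
        exact ⟨b, hb, ψ, (hF b hb ψ).2 ((isUnitFlow_add_unitEdge_iff hst hb'.1 hb'.2).1 h), rfl⟩

end UnitFlow

section Imset

variable {α : Type*} [DecidableEq α] {a : α} {B C : Finset α}

theorem uim_singleton_left {X Γ : Finset α} (haX : a ∉ X) (haΓ : a ∉ Γ) (S : Finset α) :
    uim {a} X Γ S = (if a ∈ S then -1 else 1) *
      ((if S.erase a = Γ then 1 else 0) - (if S.erase a = X ∪ Γ then 1 else 0)) := by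
  have key {T : Finset α} (haT : a ∉ T) : (S = {a} ∪ T ↔ a ∈ S ∧ S.erase a = T) ∧
      (S = T ↔ a ∉ S ∧ S.erase a = T) := by
    refine ⟨⟨?_, ?_⟩, ⟨?_, ?_⟩⟩
    · rintro rfl
      rw [← insert_eq]
      exact ⟨mem_insert_self _ _, erase_insert haT⟩
    · rintro ⟨h, rfl⟩
      rw [← insert_eq, insert_erase h]
    · rintro rfl
      exact ⟨haT, erase_eq_of_notMem haT⟩
    · rintro ⟨h, rfl⟩
      exact (erase_eq_of_notMem h).symm
  have haU : a ∉ X ∪ Γ := by simp [haX, haΓ]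
  simp only [uim, union_assoc, (key haU).1, (key haU).2, (key haΓ).1, (key haΓ).2]
  by_cases h : a ∈ S <;> simp [h]

theorem sum_mul_uim_singleton (haB : a ∉ B) {φ : α → Finset α → ℕ}
    (hφ : ∀ b Γ, φ b Γ ≠ 0 → b ∈ B ∧ b ∉ Γ ∧ Γ ⊆ B ∪ C ∧ a ∉ Γ) (S : Finset α) :
    ∑ b ∈ B, ∑ Γ ∈ ({a} ∪ B ∪ C).powerset, (φ b Γ : ℤ) * uim {a} {b} Γ S =
      (if a ∈ S then -1 else 1) * (∑ b ∈ B ∪ C, (φ b (S.erase a) : ℤ) -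
        ∑ b ∈ B ∪ C, if b ∈ S.erase a then (φ b ((S.erase a).erase b) : ℤ) else 0) := by
  have hzero {b : α} {Γ : Finset α} (h : b ∉ B ∨ b ∈ Γ ∨ ¬ Γ ⊆ B ∪ C ∨ a ∈ Γ) : φ b Γ = 0 := by
    by_contra hne
    have := hφ b Γ hne
    tauto
  have hpow {Γ : Finset α} (h : Γ ∉ ({a} ∪ B ∪ C).powerset) : ¬ Γ ⊆ B ∪ C := by
    rw [mem_powerset, union_assoc] at h
    exact fun h' => h (h'.trans subset_union_right)
  rw [← sum_sub_distrib, mul_sum]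
  rw [← sum_subset (subset_union_left : B ⊆ B ∪ C) (by
    intro b _ hb
    simp [hzero (Or.inl hb)])]
  refine sum_congr rfl fun b hb => ?_
  have hab : a ∉ ({b} : Finset α) := by
    rintro h
    exact haB (mem_singleton.1 h ▸ hb)
  have hterm (Γ : Finset α) : (φ b Γ : ℤ) * uim {a} {b} Γ S = (if a ∈ S then -1 else 1) *
      ((if S.erase a = Γ then (φ b Γ : ℤ) else 0) -
        (if b ∈ S.erase a ∧ (S.erase a).erase b = Γ then (φ b Γ : ℤ) else 0)) := by
    by_cases h0 : φ b Γ = 0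
    · simp [h0]
    obtain ⟨-, hbΓ, -, haΓ⟩ := hφ b Γ h0
    have : S.erase a = {b} ∪ Γ ↔ b ∈ S.erase a ∧ (S.erase a).erase b = Γ := by
      generalize S.erase a = T
      constructor
      · rintro rfl
        rw [← insert_eq]
        exact ⟨mem_insert_self _ _, erase_insert hbΓ⟩
      · rintro ⟨h, rfl⟩
        rw [← insert_eq, insert_erase h]
    rw [uim_singleton_left hab haΓ]
    simp only [this]
    rw [mul_left_comm, mul_sub, mul_ite, mul_ite, mul_one, mul_zero]
  simp only [hterm]
  rw [← mul_sum, sum_sub_distrib]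
  congr 2
  · rw [sum_ite_eq]
    split_ifs with h
    · rfl
    · simp [hzero (b := b) (Or.inr (Or.inr (Or.inl (hpow h))))]
  · simp only [ite_and]
    by_cases hbS : b ∈ S.erase a
    · simp only [if_pos hbS]
      rw [sum_ite_eq]
      split_ifs with h
      · rfl
      · simp [hzero (b := b) (Or.inr (Or.inr (Or.inl (hpow h))))]
    · simp only [if_neg hbS, sum_const_zero]

/-- Extend a weighting of pairs `(b, Γ)` by zero to triples `(a', b, Γ)` with `a' ≠ a`. -/
def liftWeight (a : α) (φ : α → Finset α → ℕ) : α → α → Finset α → ℕ :=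
  fun a' b Γ => if a' = a then φ b Γ else 0

theorem liftWeight_injective (a : α) : Function.Injective (liftWeight a) := by
  intro φ ψ h
  funext b Γ
  simpa [liftWeight] using congr_fun (congr_fun (congr_fun h a) b) Γ

theorem forall_uim_eq_iff_isUnitFlow {φ : α → Finset α → ℕ} (haB : a ∉ B) (haC : a ∉ C)
    (hφ : ∀ b Γ, φ b Γ ≠ 0 → b ∈ B ∧ b ∉ Γ ∧ Γ ⊆ B ∪ C ∧ a ∉ Γ) :
    (∀ S, uim {a} B C S =
      ∑ b ∈ B, ∑ Γ ∈ ({a} ∪ B ∪ C).powerset, (φ b Γ : ℤ) * uim {a} {b} Γ S) ↔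
    IsUnitFlow C (B ∪ C) φ := by
  have hε (S : Finset α) : (if a ∈ S then -1 else 1 : ℤ) ≠ 0 := by split_ifs <;> simp
  simp only [sum_mul_uim_singleton haB hφ, uim_singleton_left haB haC, mul_right_inj' (hε _)]
  constructor
  · intro h
    refine ⟨fun b Γ hb => ?_, fun S => ?_⟩
    · obtain ⟨h1, h2, h3, -⟩ := hφ b Γ hb
      exact ⟨mem_union_left _ h1, h2, h3⟩
    · by_cases haS : a ∈ S
      · have hz {b : α} {Γ : Finset α} (h : a ∈ Γ) : φ b Γ = 0 := by
          by_contra hne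
          exact (hφ b Γ hne).2.2.2 h
        have h1 : S ≠ C := fun h => haC (h ▸ haS)
        have h2 : S ≠ B ∪ C := fun h => by
          rw [h] at haS
          simp [haB, haC] at haS
        rw [if_neg h1, if_neg h2, sum_eq_zero, sum_eq_zero]
        · exact fun b _ => hz haS
        · intro b hb
          have hab : a ≠ b := by
            rintro rfl
            simp [haB, haC] at hb
          rw [hz (mem_erase.2 ⟨hab, haS⟩), ite_self]
      · have := h S
        rw [erase_eq_of_notMem haS] at this
        zify
        linarith
  · intro h S
    have := h.2 (S.erase a)
    zify at this
    linarith

theorem setOf_isRep_eq_image (haB : a ∉ B) (haC : a ∉ C) :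
    {θ | IsRep {a} B C θ} = liftWeight a '' {φ | IsUnitFlow C (B ∪ C) φ} := by
  ext θ
  constructor
  · rintro ⟨hsupp, heq⟩
    refine ⟨θ a, ?_, ?_⟩
    · refine (forall_uim_eq_iff_isUnitFlow haB haC fun b Γ h => ?_).1 fun S => ?_
      · obtain ⟨-, hb, -, hΓ, haΓ, hbΓ⟩ := hsupp a b Γ h
        refine ⟨hb, hbΓ, ?_, haΓ⟩
        rwa [union_assoc, ← insert_eq, subset_insert_iff_of_notMem haΓ] at hΓ
      · rw [heq S, sum_singleton]
    · funext a' b Γ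
      by_cases ha : a' = a
      · simp [liftWeight, ha]
      · have : θ a' b Γ = 0 := by
          by_contra hne
          exact ha (mem_singleton.1 (hsupp a' b Γ hne).1)
        simp [liftWeight, ha, this]
  · rintro ⟨φ, hφ, rfl⟩
    have hsupp (b : α) (Γ : Finset α) (h : φ b Γ ≠ 0) :
        b ∈ B ∧ b ∉ Γ ∧ Γ ⊆ B ∪ C ∧ a ∉ Γ := by
      obtain ⟨hb, hbΓ, hΓ⟩ := hφ.1 b Γ h
      have hC := hφ.subset_of_ne_zero Γ b h
      refine ⟨(mem_union.1 hb).resolve_right fun hb' => hbΓ (hC hb'), hbΓ, hΓ, fun ha => ?_⟩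
      exact (mem_union.1 (hΓ ha)).elim haB haC
    refine ⟨fun a' b Γ h => ?_, fun S => ?_⟩
    · obtain ⟨rfl, hne⟩ : a' = a ∧ φ b Γ ≠ 0 := by simpa [liftWeight] using h
      obtain ⟨hb, hbΓ, hΓ, haΓ⟩ := hsupp b Γ hne
      refine ⟨mem_singleton_self _, hb, hφ.subset_of_ne_zero Γ b hne, ?_, haΓ, hbΓ⟩
      rw [union_assoc]
      exact hΓ.trans subset_union_right
    · rw [sum_singleton, (forall_uim_eq_iff_isUnitFlow haB haC hsupp).2 hφ S]
      simp [liftWeight]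

end Imset

theorem stmt8 {α : Type*} [DecidableEq α] (N : Finset α) (a : α) (B C : Finset α) (n : ℕ)
    (haN : a ∈ N) (hB : B ⊆ N) (hC : C ⊆ N)
    (haB : a ∉ B) (haC : a ∉ C) (hBC : Disjoint B C)
    (hBne : B.Nonempty) (hn : B.card = n) :
    {θ : α → α → Finset α → ℕ | IsRep {a} B C θ}.ncard = Nat.factorial n := by
  obtain ⟨F, hcard, hF⟩ := exists_finset_isUnitFlow n C (B ∪ C) subset_union_right
    (by rw [union_sdiff_cancel_right hBC, hn])
  rw [setOf_isRep_eq_image haB haC, Set.ncard_image_of_injective _ (liftWeight_injective a),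
    ← hcard, ← Set.ncard_coe_finset]
  congr 1
  ext φ
  exact (hF φ).symm
end

section
/- Define r_2 : {1, 2, 3, …} → ℕ by r_2(1) = 1 and r_2(m) = m! + Σ_{k=1}^{m−1} k!·r_2(m−k) for m ≥ 2. Let N be a finite set and A, B, C pairwise disjoint subsets of N with |A| = 2 and |B| = m ≥ 1. Then the fiber F_{⟨A,B|C⟩} has exactly 2·m!·r_2(m) elements. -/
open Finset

/-- `SharesSwitches p s t c P Q`: reading `c`, `P`, `Q` simultaneously, with `p` the colour read
just before, `s` and `t` the multisets of entries already read off the two words, these multisets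
agree at the end and whenever the colour changes. -/
def SharesSwitches {α : Type*} : Bool → Multiset α → Multiset α → List Bool → List α → List α → Prop
  | _, s, t, [], [], [] => s = t
  | p, s, t, y :: c, b :: P, b' :: Q =>
      (y ≠ p → s = t) ∧ SharesSwitches y (b ::ₘ s) (b' ::ₘ t) c P Q
  | _, _, _, _, _, _ => False

namespace SharesSwitches

variable {α : Type*} {p q y : Bool} {s t : Multiset α} {c : List Bool} {P Q : List α}

theorem length_eq (h : SharesSwitches p s t c P Q) :
    c.length = P.length ∧ Q.length = P.length := by
  induction c generalizing p s t P Q with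
  | nil => cases P <;> cases Q <;> simp_all [SharesSwitches]
  | cons y c ih =>
    rcases P with _ | ⟨b, P⟩ <;> rcases Q with _ | ⟨b', Q⟩ <;> simp only [SharesSwitches] at h
    simpa using ih h.2

theorem congr_color (p q : Bool) :
    SharesSwitches p s s c P Q ↔ SharesSwitches q s s c P Q := by
  rcases c with _ | ⟨y, c⟩ <;> rcases P with _ | ⟨b, P⟩ <;> rcases Q with _ | ⟨b', Q⟩ <;>
    simp [SharesSwitches]

theorem eq_of_head?_ne (h : SharesSwitches p s t c P Q) (hc : c.head? ≠ some p) : s = t := by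
  rcases c with _ | ⟨y, c⟩ <;> rcases P with _ | ⟨b, P⟩ <;> rcases Q with _ | ⟨b', Q⟩ <;>
    simp_all [SharesSwitches]

theorem replicate_append_iff {k : ℕ} (hc : c.head? ≠ some y) :
    SharesSwitches y s t (List.replicate k y ++ c) P Q ↔
      k ≤ P.length ∧ k ≤ Q.length ∧ s + (P.take k : Multiset α) = t + (Q.take k : Multiset α) ∧
        SharesSwitches y (s + (P.take k : Multiset α)) (t + (Q.take k : Multiset α)) c
          (P.drop k) (Q.drop k) := by
  induction k generalizing s t P Q with
  | zero =>
    simpa using fun h => eq_of_head?_ne h hc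
  | succ k ih =>
    rcases P with _ | ⟨b, P⟩ <;> rcases Q with _ | ⟨b', Q⟩ <;>
      simp [List.replicate_succ, SharesSwitches]
    rw [ih]
    simp [← Multiset.cons_coe]

end SharesSwitches

theorem exists_eq_replicate_append (y : Bool) (c : List Bool) :
    ∃ k c', c = List.replicate k y ++ c' ∧ c'.head? ≠ some y := by
  induction c with
  | nil => exact ⟨0, [], by simp⟩
  | cons z c ih =>
    by_cases h : z = y
    · obtain ⟨k, c', rfl, hc⟩ := ih
      exact ⟨k + 1, c', by simp [List.replicate_succ, h], hc⟩
    · exact ⟨0, z :: c, by simpa using h⟩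

theorem replicate_append_inj {y : Bool} {k l : ℕ} {c d : List Bool}
    (hc : c.head? ≠ some y) (hd : d.head? ≠ some y)
    (h : List.replicate k y ++ c = List.replicate l y ++ d) : k = l ∧ c = d := by
  induction k generalizing l with
  | zero => cases l <;> simp_all [List.replicate_succ]
  | succ k ih =>
    cases l with
    | zero => simp_all [List.replicate_succ]; simp [← h] at hd
    | succ l => simpa using ih (by simpa [List.replicate_succ] using h)

theorem exists_finset_sharesSwitches {α : Type*} {r : ℕ → ℕ} (h0 : r 0 = 1)
    (hr : ∀ m, 1 ≤ m → r m = ∑ k ∈ Icc 1 m, k.factorial * r (m - k)) (P : List α)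
    (hP : P.Nodup) (p : Bool) (s : Multiset α) :
    ∃ F : Finset (List Bool × List α),
      (∀ c Q, (c, Q) ∈ F ↔ c.head? ≠ some p ∧ Q.Perm P ∧ SharesSwitches p s s c P Q) ∧
        F.card = r P.length := by
  classical
  induction hm : P.length using Nat.strong_induction_on generalizing P p s with
  | _ m ih =>
  rcases Nat.eq_zero_or_pos m with rfl | hm0
  · obtain rfl := List.length_eq_zero_iff.1 hm
    refine ⟨{([], [])}, fun c Q => ?_, by simp [h0]⟩
    constructor
    · rintro h
      simp at h
      simp [h, SharesSwitches]
    · rintro ⟨-, -, h⟩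
      have := h.length_eq
      simpa using this
  have key : ∀ k ∈ Icc 1 m, ∃ F : Finset (List Bool × List α),
      (∀ c Q, (c, Q) ∈ F ↔ c.head? ≠ some (!p) ∧ Q.Perm (P.drop k) ∧
        SharesSwitches (!p) (s + (P.take k : Multiset α)) (s + (P.take k : Multiset α)) c
          (P.drop k) Q) ∧ F.card = r (m - k) := by
    intro k hk
    rw [mem_Icc] at hk
    exact ih (m - k) (by omega) (P.drop k) (hP.sublist (List.drop_sublist ..)) _ _ (by simp [hm])
  choose! F hF hFc using key
  let g : List α × (List Bool × List α) → ℕ → List Bool × List α := fun x k =>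
    (List.replicate k (!p) ++ x.2.1, x.1 ++ x.2.2)
  let I : ℕ → Finset (List α × (List Bool × List α)) := fun k =>
    (P.take k).permutations.toFinset ×ˢ F k
  have hI : ∀ k ∈ Icc 1 m, ∀ Q₁ c Q₂, (Q₁, c, Q₂) ∈ I k ↔ Q₁.Perm (P.take k) ∧
      c.head? ≠ some (!p) ∧ Q₂.Perm (P.drop k) ∧
        SharesSwitches (!p) (s + (P.take k : Multiset α)) (s + (P.take k : Multiset α)) c
          (P.drop k) Q₂ := by
    intro k hk Q₁ c Q₂
    simp only [I, mem_product, List.mem_toFinset, List.mem_permutations, hF k hk]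
  refine ⟨(Icc 1 m).biUnion fun k => (I k).image (g · k), fun c Q => ?_, ?_⟩
  · simp only [mem_biUnion, mem_image, Prod.exists, g, Prod.mk.injEq]
    constructor
    · rintro ⟨k, hk, Q₁, c', Q₂, hx, rfl, rfl⟩
      rw [hI k hk] at hx
      obtain ⟨h₁, hc, h₂, hs⟩ := hx
      have hk' := mem_Icc.1 hk
      have hlen : Q₁.length = k := by rw [h₁.length_eq]; simp; omega
      refine ⟨?_, ?_, ?_⟩
      · obtain ⟨j, rfl⟩ : ∃ j, k = j + 1 := ⟨k - 1, by omega⟩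
        simp [List.replicate_succ]
      · simpa using h₁.append h₂
      · rw [SharesSwitches.congr_color p (!p), SharesSwitches.replicate_append_iff hc]
        refine ⟨by omega, by simp; omega, ?_, ?_⟩
        · have e : ((Q₁ ++ Q₂).take k : List α) = Q₁ := by rw [← hlen, List.take_left]
          rw [e, Multiset.coe_eq_coe.2 h₁]
        · have e : ((Q₁ ++ Q₂).take k : List α) = Q₁ := by rw [← hlen, List.take_left]
          have e' : ((Q₁ ++ Q₂).drop k : List α) = Q₂ := by rw [← hlen, List.drop_left]
          rw [e, e', Multiset.coe_eq_coe.2 h₁]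
          exact hs
    · rintro ⟨hc, hQ, hs⟩
      obtain ⟨k, c', rfl, hc'⟩ := exists_eq_replicate_append (!p) c
      have hk1 : 1 ≤ k := by
        by_contra hk
        obtain rfl : k = 0 := by omega
        have := hs.length_eq
        rcases c' with _ | ⟨z, c'⟩
        · simp at this; omega
        · simp at hc hc'; exact hc hc'
      rw [SharesSwitches.congr_color p (!p), SharesSwitches.replicate_append_iff hc'] at hs
      obtain ⟨hkP, hkQ, he, hs⟩ := hs
      have hk : k ∈ Icc 1 m := mem_Icc.2 ⟨hk1, by omega⟩
      have h₁ : (Q.take k).Perm (P.take k) := by simpa using he.symm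
      refine ⟨k, hk, Q.take k, c', Q.drop k, ?_, rfl, by simp⟩
      rw [hI k hk]
      refine ⟨h₁, hc', ?_, ?_⟩
      · refine (List.perm_append_left_iff (P.take k)).1 ?_
        refine (h₁.symm.append_right _).trans ?_
        simpa using hQ
      · rwa [← he] at hs
  · rw [card_biUnion, hr m hm0]
    · refine sum_congr rfl fun k hk => ?_
      have hk' := mem_Icc.1 hk
      rw [card_image_of_injOn]
      · simp only [I, card_product, hFc k hk]
        rw [List.toFinset_card_of_nodup
          (List.nodup_permutations _ (hP.sublist (List.take_sublist ..))), List.length_permutations]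
        congr 2
        simp; omega
      · rintro ⟨Q₁, c, Q₂⟩ hx ⟨Q₁', c', Q₂'⟩ hx' h
        rw [mem_coe, hI k hk] at hx hx'
        simp only [g, Prod.mk.injEq] at h
        have hl : Q₁.length = Q₁'.length := by rw [hx.1.length_eq, hx'.1.length_eq]
        obtain ⟨e₁, e₂⟩ := List.append_inj h.2 hl
        simp [e₁, e₂, List.append_cancel_left h.1]
    · intro k hk l hl hkl
      rw [Function.onFun, disjoint_left]
      rintro x hx hx'
      simp only [mem_image, Prod.exists] at hx hx'
      obtain ⟨Q₁, c, Q₂, hx, rfl⟩ := hx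
      obtain ⟨Q₁', c', Q₂', hx', h⟩ := hx'
      rw [hI k hk] at hx
      rw [hI l hl] at hx'
      simp only [g, Prod.mk.injEq] at h
      exact hkl (replicate_append_inj hx'.2.1 hx.2.1 h.1).1.symm

/-- The net outflow at the vertex `T` of a flow `f` on the Boolean lattice, where `f b T` is the
value on the edge from `T` to `insert b T`. -/
def netOutflow {α : Type*} [DecidableEq α] (B : Finset α) (f : α → Finset α → ℕ) (T : Finset α) :
    ℤ :=
  ∑ b ∈ B, ((f b T : ℤ) - if b ∈ T then (f b (T.erase b) : ℤ) else 0)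

/-- The edges of colour `x` on the path that starts at `S`, inserts the entries of the list one
after the other, and has its edges coloured by the list of Booleans. -/
def pathEdges {α : Type*} [DecidableEq α] (x : Bool) :
    Finset α → List Bool → List α → α → Finset α → ℕ
  | S, y :: c, b :: P => fun b' T =>
      (if y = x ∧ b' = b ∧ T = S then 1 else 0) + pathEdges x (insert b S) c P b' T
  | _, _, _ => fun _ _ => 0

section Paths

variable {α : Type*} [DecidableEq α] {B S S' T V : Finset α} {b : α} {P Q : List α}
  {c c' : List Bool} {x y : Bool}

theorem netOutflow_add (f g : α → Finset α → ℕ) :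
    netOutflow B (fun b T => f b T + g b T) T = netOutflow B f T + netOutflow B g T := by
  rw [netOutflow, netOutflow, netOutflow, ← sum_add_distrib]
  refine sum_congr rfl fun b _ => ?_
  split_ifs <;> push_cast <;> ring

theorem netOutflow_single (hb : b ∈ B) (hS : b ∉ S) (q : Prop) [Decidable q] :
    netOutflow B (fun b' T => if q ∧ b' = b ∧ T = S then 1 else 0) T =
      if q then (if T = S then 1 else 0) - (if T = insert b S then 1 else 0) else 0 := by
  rw [netOutflow, sum_eq_single b]
  · have : (b ∈ T ∧ T.erase b = S) ↔ T = insert b S := by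
      constructor
      · rintro ⟨h, rfl⟩
        rw [insert_erase h]
      · rintro rfl
        simp [hS]
    by_cases hq : q
    · by_cases h : b ∈ T <;> simp_all
    · simp [hq]
  · intro b' _ h
    simp [h]
  · exact fun h => absurd hb h

theorem netOutflow_eq_zero_of_not_subset {f : α → Finset α → ℕ} (hB : B ⊆ V)
    (hf : ∀ b T, f b T ≠ 0 → T ⊆ V) (hT : ¬ T ⊆ V) : netOutflow B f T = 0 := by
  refine sum_eq_zero fun b hb => ?_
  have h₁ : f b T = 0 := by_contra fun h => hT (hf b T h)
  have h₂ : f b (T.erase b) = 0 := by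
    by_contra h
    exact hT fun a ha => by
      by_cases hab : a = b
      · exact hB (hab ▸ hb)
      · exact hf _ _ h (mem_erase.2 ⟨hab, ha⟩)
  simp [h₁, h₂]

theorem notMem_and_insert_val_add (h : S.val + ((b :: P : List α) : Multiset α) = V.val) :
    b ∉ S ∧ (insert b S).val + (P : Multiset α) = V.val := by
  have hn : (S.val + ((b :: P : List α) : Multiset α)).Nodup := h ▸ V.nodup
  have hb : b ∉ S := fun hb =>
    Multiset.disjoint_left.1 (Multiset.nodup_add.1 hn).2.2 hb (by simp)
  refine ⟨hb, ?_⟩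
  rw [insert_val_of_notMem hb, ← h]
  simp [← Multiset.cons_coe]

theorem netOutflow_pathEdges_cons (hb : b ∈ B) (hS : b ∉ S) :
    netOutflow B (pathEdges x S (y :: c) (b :: P)) T =
      (if y = x then (if T = S then 1 else 0) - (if T = insert b S then 1 else 0) else 0) +
        netOutflow B (pathEdges x (insert b S) c P) T := by
  rw [← netOutflow_single hb hS, ← netOutflow_add]
  rfl

theorem netOutflow_zero : netOutflow B (fun _ _ => 0) T = 0 := by
  simp [netOutflow]

theorem netOutflow_pathEdges_eq_zero (hP : ∀ b ∈ P, b ∈ B)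
    (h : S.val + (P : Multiset α) = V.val) (hT : T.card < S.card) :
    netOutflow B (pathEdges x S c P) T = 0 := by
  induction P generalizing S c with
  | nil => cases c <;> exact netOutflow_zero
  | cons b P ih =>
    cases c with
    | nil => exact netOutflow_zero
    | cons y c =>
      obtain ⟨hb, h'⟩ := notMem_and_insert_val_add h
      have hc := card_insert_of_notMem hb
      rw [netOutflow_pathEdges_cons (hP b (by simp)) hb,
        ih (fun a ha => hP a (by simp [ha])) h' (by omega)]
      have h₁ : T ≠ S := by rintro rfl; omega
      have h₂ : T ≠ insert b S := by rintro rfl; omega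
      simp [h₁, h₂]

theorem sum_netOutflow_pathEdges (hP : ∀ b ∈ P, b ∈ B)
    (h : S.val + (P : Multiset α) = V.val) (hc : c.length = P.length) :
    netOutflow B (pathEdges true S c P) T + netOutflow B (pathEdges false S c P) T =
      (if T = S then 1 else 0) - (if T = V then 1 else 0) := by
  induction P generalizing S c with
  | nil =>
    obtain rfl : S = V := by simpa using h
    cases c <;> simp [pathEdges, netOutflow_zero]
  | cons b P ih =>
    cases c with
    | nil => simp at hc
    | cons y c =>
      obtain ⟨hb, h'⟩ := notMem_and_insert_val_add h
      have := ih (fun a ha => hP a (by simp [ha])) h' (by simpa using hc)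
      rw [netOutflow_pathEdges_cons (hP b (by simp)) hb,
        netOutflow_pathEdges_cons (hP b (by simp)) hb]
      cases y <;> simp <;> linarith

theorem pathEdges_ne_zero {T : Finset α} (h : S.val + (P : Multiset α) = V.val)
    (hT : pathEdges x S c P b T ≠ 0) : b ∈ P ∧ S ⊆ T ∧ T ⊆ V ∧ b ∉ T := by
  induction P generalizing S c with
  | nil => cases c <;> simp [pathEdges] at hT
  | cons a P ih =>
    cases c with
    | nil => simp [pathEdges] at hT
    | cons y c =>
      obtain ⟨ha, h'⟩ := notMem_and_insert_val_add h
      by_cases h0 : pathEdges x (insert a S) c P b T = 0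
      · simp only [pathEdges, h0, add_zero, ne_eq, ite_eq_right_iff, one_ne_zero, imp_false,
          not_not] at hT
        obtain ⟨-, rfl, rfl⟩ := hT
        refine ⟨by simp, subset_rfl, ?_, ha⟩
        rw [← val_le_iff, ← h]
        exact Multiset.le_add_right _ _
      · obtain ⟨h₁, h₂, h₃⟩ := ih h' h0
        exact ⟨by simp [h₁], (subset_insert _ _).trans h₂, h₃⟩

theorem pathEdges_injective (h : S.val + (P : Multiset α) = V.val)
    (hQ : S.val + (Q : Multiset α) = V.val) (hc : c.length = P.length)
    (hc' : c'.length = Q.length)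
    (he : ∀ x, pathEdges x S c P = pathEdges x S c' Q) : c = c' ∧ P = Q := by
  have hl : P.length = Q.length := by
    simpa using congrArg Multiset.card (add_left_cancel (h.trans hQ.symm))
  induction P generalizing S c c' Q with
  | nil =>
    have := List.length_eq_zero_iff.1 hl.symm
    subst this
    simp_all
  | cons a P ih =>
    rcases Q with _ | ⟨a', Q⟩
    · simp at hl
    rcases c with _ | ⟨y, c⟩
    · simp at hc
    rcases c' with _ | ⟨y', c'⟩
    · simp at hc'
    obtain ⟨ha, h'⟩ := notMem_and_insert_val_add h
    obtain ⟨ha', hQ'⟩ := notMem_and_insert_val_add hQ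
    have tail : ∀ {a : α} {P : List α}, a ∉ S → (insert a S).val + (P : Multiset α) = V.val →
        ∀ x c b,
          pathEdges x (insert a S) c P b S = 0 := by
      intro a P ha h' x c b
      by_contra hne
      exact ha ((pathEdges_ne_zero h' hne).2.1 (mem_insert_self _ _))
    have key := congrFun (congrFun (he y) a) S
    simp only [pathEdges, tail ha h', tail ha' hQ', and_true, if_true] at key
    have : y' = y ∧ a = a' := by
      by_contra hne
      simp [hne] at key
    obtain ⟨rfl, rfl⟩ := this
    have := ih h' hQ' (by simpa using hc) (by simpa using hc') (fun x => by
      funext b T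
      simpa [pathEdges] using congrFun (congrFun (he x) b) T) (by simpa using hl)
    simp [this]

theorem netOutflow_pathEdges_eq_iff {p : Bool} (hPB : ∀ b ∈ P, b ∈ B) (hQB : ∀ b ∈ Q, b ∈ B)
    (hP : S.val + (P : Multiset α) = V.val) (hQ : S'.val + (Q : Multiset α) = V.val)
    (hc : c.length = P.length) (hc' : c'.length = Q.length) (hl : P.length = Q.length) :
    (∀ T, netOutflow B (pathEdges true S c P) T - (if p = true ∧ T = S then 1 else 0) =
        netOutflow B (pathEdges true S' c' Q) T - (if p = true ∧ T = S' then 1 else 0)) ↔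
      c = c' ∧ SharesSwitches p S.val S'.val c P Q := by
  have hcard : S.card = S'.card := by
    have := congrArg Multiset.card (hP.trans hQ.symm)
    simpa [hl] using this
  induction P generalizing S S' c c' Q p with
  | nil =>
    obtain rfl := List.length_eq_zero_iff.1 hl.symm
    obtain rfl := List.length_eq_zero_iff.1 hc
    obtain rfl := List.length_eq_zero_iff.1 hc'
    obtain rfl : S = V := by simpa using hP
    obtain rfl : S' = S := by simpa using hQ
    simp [SharesSwitches]
  | cons a P ih =>
    rcases Q with _ | ⟨a', Q⟩
    · simp at hl
    rcases c with _ | ⟨y, c⟩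
    · simp at hc
    rcases c' with _ | ⟨y', c'⟩
    · simp at hc'
    obtain ⟨ha, hP'⟩ := notMem_and_insert_val_add hP
    obtain ⟨ha', hQ'⟩ := notMem_and_insert_val_add hQ
    have hPB' : ∀ b ∈ P, b ∈ B := fun b hb => hPB b (by simp [hb])
    have hQB' : ∀ b ∈ Q, b ∈ B := fun b hb => hQB b (by simp [hb])
    have hins : (insert a S).card = (insert a' S').card := by
      rw [card_insert_of_notMem ha, card_insert_of_notMem ha', hcard]
    have IH := ih (p := y) (c := c) (c' := c') hPB' hQB' hP' hQ' (by simpa using hc)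
      (by simpa using hc') (by simpa using hl) hins
    rw [insert_val_of_notMem ha, insert_val_of_notMem ha'] at IH
    have hN : ∀ T, netOutflow B (pathEdges true S (y :: c) (a :: P)) T = _ := fun T =>
      netOutflow_pathEdges_cons (hPB a (by simp)) ha
    have hN' : ∀ T, netOutflow B (pathEdges true S' (y' :: c') (a' :: Q)) T = _ := fun T =>
      netOutflow_pathEdges_cons (hQB a' (by simp)) ha'
    have hz : ∀ T : Finset α, T.card = S.card →
        netOutflow B (pathEdges true (insert a S) c P) T = 0 ∧
        netOutflow B (pathEdges true (insert a' S') c' Q) T = 0 ∧ T ≠ insert a S ∧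
          T ≠ insert a' S' := by
      intro T hT
      have h₁ := card_insert_of_notMem ha
      have h₂ := card_insert_of_notMem ha'
      exact ⟨netOutflow_pathEdges_eq_zero hPB' hP' (by omega),
        netOutflow_pathEdges_eq_zero hQB' hQ' (by omega),
        by rintro rfl; omega, by rintro rfl; omega⟩
    have hsplit : (∀ T, netOutflow B (pathEdges true S (y :: c) (a :: P)) T -
          (if p = true ∧ T = S then 1 else 0) =
        netOutflow B (pathEdges true S' (y' :: c') (a' :: Q)) T -
          (if p = true ∧ T = S' then 1 else 0)) ↔
        (y = y' ∧ (y ≠ p → S = S')) ∧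
        (∀ T, netOutflow B (pathEdges true (insert a S) c P) T -
            (if y = true ∧ T = insert a S then 1 else 0) =
          netOutflow B (pathEdges true (insert a' S') c' Q) T -
            (if y = true ∧ T = insert a' S' then 1 else 0)) := by
      constructor
      · intro H
        have hy : y = y' ∧ (y ≠ p → S = S') := by
          have e₁ := H S
          have e₂ := H S'
          obtain ⟨z₁, z₂, z₃, z₄⟩ := hz S rfl
          obtain ⟨w₁, w₂, w₃, w₄⟩ := hz S' hcard.symm
          rw [hN, hN', z₁, z₂] at e₁
          rw [hN, hN', w₁, w₂] at e₂
          clear * - e₁ e₂ z₃ z₄ w₃ w₄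
          by_cases hS : S = S'
          · subst hS
            cases y <;> cases y' <;> cases p <;> simp_all
          · have hS' := Ne.symm hS
            cases y <;> cases y' <;> cases p <;> simp_all
        refine ⟨hy, fun T => ?_⟩
        have e := H T
        rw [hN, hN'] at e
        obtain ⟨rfl, hS⟩ := hy
        by_cases hyp : y = p
        · subst hyp
          cases y <;> simp at e ⊢ <;> linarith
        · obtain rfl := hS hyp
          cases y <;> simp at e ⊢ <;> linarith
      · rintro ⟨⟨rfl, hS⟩, H⟩ T
        have e := H T
        rw [hN, hN']
        by_cases hyp : y = p
        · subst hyp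
          cases y <;> simp at e ⊢ <;> linarith
        · obtain rfl := hS hyp
          cases y <;> simp at e ⊢ <;> linarith
    refine hsplit.trans ((and_congr_right fun _ => IH).trans ?_)
    simp only [SharesSwitches, List.cons.injEq, val_inj]
    tauto

theorem exists_eq_pathEdges (hBV : B ⊆ V) (hSV : S ⊆ V) {F : Bool → α → Finset α → ℕ}
    (hF : ∀ x b T, F x b T ≠ 0 → b ∈ B ∧ S ⊆ T ∧ T ⊆ V ∧ b ∉ T)
    (hflow : ∀ T, netOutflow B (F true) T + netOutflow B (F false) T =
      (if T = S then 1 else 0) - (if T = V then 1 else 0)) :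
    ∃ (c : List Bool) (P : List α), c.length = P.length ∧ S.val + (P : Multiset α) = V.val ∧
      ∀ x, F x = pathEdges x S c P := by
  induction hn : (V \ S).card generalizing S F with
  | zero =>
    obtain rfl : S = V := hSV.antisymm (by
      rwa [card_eq_zero, sdiff_eq_empty_iff_subset] at hn)
    refine ⟨[], [], rfl, by simp, fun x => ?_⟩
    funext b T
    by_contra h
    obtain ⟨h₁, h₂, h₃, h₄⟩ := hF x b T h
    exact h₄ (h₂ (hBV h₁))
  | succ n ih =>
    have hne : S ≠ V := by rintro rfl; simp at hn
    have hsum : ∑ b ∈ B, ∑ x, F x b S = 1 := by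
      have h := hflow S
      have hin : ∀ x, netOutflow B (F x) S = ∑ b ∈ B, (F x b S : ℤ) := fun x => by
        refine sum_congr rfl fun b _ => ?_
        rw [sub_eq_self]
        split_ifs with hb
        · by_contra h0
          exact notMem_erase b S ((hF x b (S.erase b) (by exact_mod_cast h0)).2.1 hb)
        · rfl
      rw [hin, hin, ← sum_add_distrib] at h
      simp only [if_true, hne, if_false, sub_zero] at h
      simp only [Fintype.sum_bool]
      exact_mod_cast h
    obtain ⟨b, hb, hbsum⟩ : ∃ b ∈ B, ∑ x, F x b S ≠ 0 := by
      by_contra! h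
      rw [sum_eq_zero h] at hsum
      exact zero_ne_one hsum
    obtain ⟨x, -, hx⟩ : ∃ x ∈ (univ : Finset Bool), F x b S ≠ 0 := by
      by_contra! h
      exact hbsum (sum_eq_zero h)
    obtain ⟨F', hF'⟩ : ∃ F' : Bool → α → Finset α → ℕ, ∀ x' b' T,
        F x' b' T = (if x = x' ∧ b' = b ∧ T = S then 1 else 0) + F' x' b' T := by
      refine ⟨fun x' b' T => F x' b' T - if x = x' ∧ b' = b ∧ T = S then 1 else 0, ?_⟩
      intro x' b' T
      by_cases h : x = x' ∧ b' = b ∧ T = S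
      · obtain ⟨rfl, rfl, rfl⟩ := h
        dsimp only
        rw [if_pos ⟨rfl, rfl, rfl⟩]
        omega
      · dsimp only
        rw [if_neg h]
        omega
    obtain ⟨-, -, -, hbS⟩ := hF x b S hx
    have hbV := hBV hb
    have hle : ∀ x' b' T, F' x' b' T ≠ 0 → F x' b' T ≠ 0 := fun x' b' T h => by
      rw [hF']
      omega
    have hflow' : ∀ T, netOutflow B (F' true) T + netOutflow B (F' false) T =
        (if T = insert b S then 1 else 0) - (if T = V then 1 else 0) := by
      intro T
      have hadd : ∀ x', netOutflow B (F x') T = _ := fun x' => by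
        rw [show F x' = fun b' T => (if x = x' ∧ b' = b ∧ T = S then 1 else 0) + F' x' b' T from
          funext fun b' => funext fun T => hF' x' b' T, netOutflow_add, netOutflow_single hb hbS]
      have h := hflow T
      rw [hadd, hadd] at h
      cases x <;> simp at h ⊢ <;> linarith
    have hsupp : ∀ T x' b', ¬ insert b S ⊆ T → F' x' b' T = 0 := by
      intro T
      induction T using Finset.strongInduction with
      | H T ihT =>
      intro x' b' hT
      by_contra h0
      obtain ⟨hb', hST, hTV, -⟩ := hF _ _ _ (hle _ _ _ h0)
      have hTS : T ≠ insert b S := by rintro rfl; exact hT subset_rfl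
      have hTV' : T ≠ V := by rintro rfl; exact hT (insert_subset hbV hSV)
      have h := hflow' T
      have hin : ∀ x, netOutflow B (F' x) T = ∑ b ∈ B, (F' x b T : ℤ) := fun x => by
        refine sum_congr rfl fun a _ => ?_
        rw [sub_eq_self]
        split_ifs with ha
        · exact_mod_cast ihT _ (erase_ssubset ha) x a fun h => hT (h.trans (erase_subset _ _))
        · rfl
      rw [hin, hin, ← sum_add_distrib] at h
      simp only [hTS, hTV', if_false, sub_zero] at h
      have h' : ∑ b' ∈ B, ∑ x', F' x' b' T = 0 := by
        simp only [Fintype.sum_bool]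
        exact_mod_cast h
      exact h0 (sum_eq_zero_iff.1 (sum_eq_zero_iff.1 h' b' hb') x' (mem_univ _))
    obtain ⟨c, P, hc, hP, he⟩ := ih (S := insert b S) (F := F') (insert_subset hbV hSV)
      (fun x' b' T h => by
        obtain ⟨h₁, h₂, h₃⟩ := hF _ _ _ (hle _ _ _ h)
        exact ⟨h₁, by_contra fun hT => h (hsupp T x' b' hT), h₃⟩) hflow' (by
        rw [sdiff_insert, card_erase_of_mem (by simp [hbV, hbS])]
        omega)
    refine ⟨x :: c, b :: P, by simp [hc], ?_, fun x' => ?_⟩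
    · rw [← hP, insert_val_of_notMem hbS]
      simp [← Multiset.cons_coe]
    · funext b' T
      rw [hF', he]
      rfl

end Paths

/-- The map `θ` on triples `(a, b, Γ)` with `a ∈ {a₁, a₂}` whose restrictions to the four copies of
the Boolean lattice cut out by the conditions `a₁ ∈ Γ` and `a₂ ∈ Γ` are the `F x` and the `G x`. -/
def assemble {α : Type*} [DecidableEq α] (a₁ a₂ : α) (F G : Bool → α → Finset α → ℕ) :
    α → α → Finset α → ℕ := fun a b Γ =>
  if a = a₁ then if a₂ ∈ Γ then G false b (Γ.erase a₂) else F true b Γ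
  else if a = a₂ then if a₁ ∈ Γ then G true b (Γ.erase a₁) else F false b Γ
  else 0

/-- Every `F x` lives on the edges `(b, T)` with `b ∈ B` of the interval from `C` to `B ∪ C`. -/
def SupportedOn {α : Type*} [DecidableEq α] (B C : Finset α) (F : Bool → α → Finset α → ℕ) : Prop :=
  ∀ x b T, F x b T ≠ 0 → b ∈ B ∧ C ⊆ T ∧ T ⊆ B ∪ C ∧ b ∉ T

section Fiber

variable {α : Type*} [DecidableEq α] {A B C : Finset α} {a₁ a₂ : α}

theorem sum_mul_ite_eq_union {f : Finset α → ℕ} {U : Finset α} (X S : Finset α)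
    (hf : ∀ Γ, f Γ ≠ 0 → Γ ⊆ U ∧ Disjoint X Γ) :
    ∑ Γ ∈ U.powerset, (f Γ : ℤ) * (if S = X ∪ Γ then 1 else 0) =
      if X ⊆ S then (f (S \ X) : ℤ) else 0 := by
  rw [sum_eq_single (S \ X)]
  · by_cases h : X ⊆ S
    · simp [h, union_sdiff_of_subset h]
    · have : S ≠ X ∪ S \ X := fun e => h (by rw [e]; exact subset_union_left)
      simp [h]
  · intro Γ _ hΓ
    by_cases h0 : f Γ = 0
    · simp [h0]
    · have : S ≠ X ∪ Γ := by
        rintro rfl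
        exact hΓ (union_sdiff_cancel_left (hf Γ h0).2).symm
      simp [this]
  · intro h
    have : f (S \ X) = 0 := by_contra fun h0 => h (mem_powerset.2 (hf _ h0).1)
    simp [this]

theorem sum_mul_uim_s9 {θ : α → α → Finset α → ℕ} (hAB : Disjoint A B)
    (hθ : ∀ a b Γ, θ a b Γ ≠ 0 →
      a ∈ A ∧ b ∈ B ∧ C ⊆ Γ ∧ Γ ⊆ A ∪ B ∪ C ∧ a ∉ Γ ∧ b ∉ Γ) (S : Finset α) :
    ∑ a ∈ A, ∑ b ∈ B, ∑ Γ ∈ (A ∪ B ∪ C).powerset, (θ a b Γ : ℤ) * uim {a} {b} Γ S =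
      ∑ a ∈ A, (netOutflow B (θ a) S - if a ∈ S then netOutflow B (θ a) (S.erase a) else 0) := by
  refine sum_congr rfl fun a ha => ?_
  have hite : (if a ∈ S then netOutflow B (θ a) (S.erase a) else 0) = ∑ b ∈ B, if a ∈ S then
      ((θ a b (S.erase a) : ℤ) - if b ∈ S.erase a then (θ a b ((S.erase a).erase b) : ℤ) else 0)
      else 0 := by
    split_ifs <;> simp [netOutflow]
  rw [hite, netOutflow, ← sum_sub_distrib]
  refine sum_congr rfl fun b hb => ?_
  have hab : b ≠ a := fun h => disjoint_left.1 hAB ha (h ▸ hb)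
  have h₀ := sum_mul_ite_eq_union (f := θ a b) (U := A ∪ B ∪ C) ∅ S fun Γ h =>
    ⟨(hθ a b Γ h).2.2.2.1, by simp⟩
  have h₁ := sum_mul_ite_eq_union (f := θ a b) (U := A ∪ B ∪ C) {a} S fun Γ h =>
    ⟨(hθ a b Γ h).2.2.2.1, by simpa using (hθ a b Γ h).2.2.2.2.1⟩
  have h₂ := sum_mul_ite_eq_union (f := θ a b) (U := A ∪ B ∪ C) {b} S fun Γ h =>
    ⟨(hθ a b Γ h).2.2.2.1, by simpa using (hθ a b Γ h).2.2.2.2.2⟩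
  have h₃ := sum_mul_ite_eq_union (f := θ a b) (U := A ∪ B ∪ C) ({a} ∪ {b}) S fun Γ h =>
    ⟨(hθ a b Γ h).2.2.2.1, by simpa using (hθ a b Γ h).2.2.2.2⟩
  have e₃ : S \ ({a} ∪ {b}) = (S.erase a).erase b := by
    ext; simp only [mem_sdiff, mem_union, mem_singleton, mem_erase]; tauto
  simp only [empty_union, empty_subset, sdiff_empty, if_true, singleton_subset_iff,
    sdiff_singleton_eq_erase, e₃, union_subset_iff] at h₀ h₁ h₂ h₃
  simp only [uim, mul_add, mul_sub, sum_add_distrib, sum_sub_distrib, h₀, h₁, h₂, h₃, mem_erase,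
    ne_eq, hab, not_false_eq_true, true_and]
  by_cases ha' : a ∈ S <;> by_cases hb' : b ∈ S <;> simp [ha', hb'] <;> ring

theorem SupportedOn.eq_zero {F : Bool → α → Finset α → ℕ} (hF : SupportedOn B C F) {a b : α}
    {T : Finset α} (x : Bool) (ha : a ∉ B ∪ C) (haT : a ∈ T) : F x b T = 0 :=
  by_contra fun h => ha ((hF x b T h).2.2.1 haT)

theorem assemble_supported {F G : Bool → α → Finset α → ℕ} (ha : a₁ ≠ a₂) (ha₁ : a₁ ∉ B ∪ C)
    (ha₂ : a₂ ∉ B ∪ C) (hF : SupportedOn B C F) (hG : SupportedOn B C G) (a b : α)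
    (Γ : Finset α) (h : assemble a₁ a₂ F G a b Γ ≠ 0) :
    a ∈ ({a₁, a₂} : Finset α) ∧ b ∈ B ∧ C ⊆ Γ ∧ Γ ⊆ {a₁, a₂} ∪ B ∪ C ∧ a ∉ Γ ∧ b ∉ Γ := by
  have low : ∀ {x a}, a ∉ B ∪ C → F x b Γ ≠ 0 → b ∈ B ∧ C ⊆ Γ ∧ Γ ⊆ {a₁, a₂} ∪ B ∪ C ∧ a ∉ Γ ∧
      b ∉ Γ := fun ha h => by
    obtain ⟨h₁, h₂, h₃, h₄⟩ := hF _ _ _ h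
    exact ⟨h₁, h₂, h₃.trans (by rw [union_assoc]; exact subset_union_right),
      fun h => ha (h₃ h), h₄⟩
  have high : ∀ {x a a'}, a ∉ B ∪ C → a' ∈ ({a₁, a₂} : Finset α) → a' ∉ B ∪ C → a ≠ a' → a' ∈ Γ →
      G x b (Γ.erase a') ≠ 0 → b ∈ B ∧ C ⊆ Γ ∧ Γ ⊆ {a₁, a₂} ∪ B ∪ C ∧ a ∉ Γ ∧ b ∉ Γ :=
    fun {x a a'} ha hm ha' hne hΓ h => by
    obtain ⟨h₁, h₂, h₃, h₄⟩ := hG _ _ _ h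
    refine ⟨h₁, h₂.trans (erase_subset _ _), ?_, fun h => ha (h₃ (mem_erase.2 ⟨hne, h⟩)),
      fun h => h₄ (mem_erase.2 ⟨?_, h⟩)⟩
    · rw [← insert_erase hΓ, union_assoc]
      exact insert_subset (mem_union_left _ hm) (h₃.trans subset_union_right)
    · rintro rfl
      exact ha' (mem_union_left _ h₁)
  unfold assemble at h
  split_ifs at h with h₁ h₂ h₂ h₃
  · subst h₁
    exact ⟨by simp, high ha₁ (by simp) ha₂ ha h₂ h⟩
  · subst h₁
    exact ⟨by simp, low ha₁ h⟩
  · subst h₂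
    exact ⟨by simp, high ha₂ (by simp) ha₁ ha.symm h₃ h⟩
  · subst h₂
    exact ⟨by simp, low ha₂ h⟩
  · exact absurd rfl h

theorem netOutflow_congr {f g : α → Finset α → ℕ} {S T : Finset α}
    (h₁ : ∀ b ∈ B, f b S = g b T) (h₂ : ∀ b ∈ B, b ∈ S ↔ b ∈ T)
    (h₃ : ∀ b ∈ B, b ∈ T → f b (S.erase b) = g b (T.erase b)) :
    netOutflow B f S = netOutflow B g T := by
  refine sum_congr rfl fun b hb => ?_
  rw [h₁ b hb]
  by_cases h : b ∈ T
  · simp [h, (h₂ b hb).2 h, h₃ b hb h]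
  · simp [h, (h₂ b hb).not.2 h]

theorem isRep_assemble_iff {F G : Bool → α → Finset α → ℕ} (ha : a₁ ≠ a₂) (ha₁ : a₁ ∉ B ∪ C)
    (ha₂ : a₂ ∉ B ∪ C) (hF : SupportedOn B C F) (hG : SupportedOn B C G) :
    IsRep {a₁, a₂} B C (assemble a₁ a₂ F G) ↔
      (∀ T, netOutflow B (F true) T + netOutflow B (F false) T =
        (if T = C then 1 else 0) - (if T = B ∪ C then 1 else 0)) ∧
      ∀ x T, netOutflow B (G x) T = netOutflow B (F x) T := by
  have hsupp := assemble_supported ha ha₁ ha₂ hF hG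
  have hb₁ : ∀ b ∈ B, b ≠ a₁ := fun b hb h => ha₁ (mem_union_left _ (h ▸ hb))
  have hb₂ : ∀ b ∈ B, b ≠ a₂ := fun b hb h => ha₂ (mem_union_left _ (h ▸ hb))
  have hAB : Disjoint {a₁, a₂} B := by
    rw [disjoint_right]
    intro b hb
    simp [hb₁ b hb, hb₂ b hb]
  set θ := assemble a₁ a₂ F G with hθ
  have z : ∀ a S, a ∉ B → a ∈ S → netOutflow B (θ a) S = 0 := by
    intro a S ha hS
    have h0 : ∀ b T, a ∈ T → θ a b T = 0 := fun b T haT =>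
      by_contra fun h => (hsupp a b T h).2.2.2.2.1 haT
    refine sum_eq_zero fun b hb => ?_
    rw [h0 b S hS, h0 b (S.erase b) (mem_erase.2 ⟨by rintro rfl; exact ha hb, hS⟩)]
    simp
  have hn₁ : a₁ ∉ B := fun h => ha₁ (mem_union_left _ h)
  have hn₂ : a₂ ∉ B := fun h => ha₂ (mem_union_left _ h)
  have low₁ : ∀ T, a₂ ∉ T → netOutflow B (θ a₁) T = netOutflow B (F true) T := fun T hT =>
    netOutflow_congr (fun b _ => by simp [hθ, assemble, hT]) (fun _ _ => Iff.rfl)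
      fun b _ _ => by simp [hθ, assemble, hT]
  have low₂ : ∀ T, a₁ ∉ T → netOutflow B (θ a₂) T = netOutflow B (F false) T := fun T hT =>
    netOutflow_congr (fun b _ => by simp [hθ, assemble, hT, ha.symm]) (fun _ _ => Iff.rfl)
      fun b _ _ => by simp [hθ, assemble, hT, ha.symm]
  have high₁ : ∀ T, a₂ ∉ T → netOutflow B (θ a₁) (insert a₂ T) = netOutflow B (G false) T :=
    fun T hT => netOutflow_congr (fun b _ => by simp [hθ, assemble, hT])
      (fun b hb => by simp [hb₂ b hb]) fun b hb _ => by
        rw [erase_insert_of_ne (hb₂ b hb).symm]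
        simp [hθ, assemble, hT]
  have high₂ : ∀ T, a₁ ∉ T → netOutflow B (θ a₂) (insert a₁ T) = netOutflow B (G true) T :=
    fun T hT => netOutflow_congr (fun b _ => by simp [hθ, assemble, hT, ha.symm])
      (fun b hb => by simp [hb₁ b hb]) fun b hb _ => by
        rw [erase_insert_of_ne (hb₁ b hb).symm]
        simp [hθ, assemble, hT, ha.symm]
  have hBC₁ : a₁ ∉ B ∧ a₁ ∉ C := by simpa using ha₁
  have hBC₂ : a₂ ∉ B ∧ a₂ ∉ C := by simpa using ha₂
  have mem_ne : ∀ {a : α} {S T : Finset α}, a ∈ S → a ∉ T → S ≠ T := fun h h' e => h' (e ▸ h)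
  have ne_mem : ∀ {a : α} {S T : Finset α}, a ∉ S → a ∈ T → S ≠ T := fun h h' e => h (e ▸ h')
  have u₀ : ∀ T, a₁ ∉ T → a₂ ∉ T → uim {a₁, a₂} B C T =
      (if T = C then 1 else 0) - (if T = B ∪ C then 1 else 0) := fun T h₁ h₂ => by
    have e₁ : T ≠ {a₁, a₂} ∪ B ∪ C := ne_mem h₁ (by simp)
    have e₂ : T ≠ {a₁, a₂} ∪ C := ne_mem h₁ (by simp)
    simp only [uim, e₁, e₂, if_false]
    ring
  have u₁ : ∀ T, a₁ ∉ T → a₂ ∉ T → uim {a₁, a₂} B C (insert a₁ T) = 0 := fun T h₁ h₂ => by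
    have h : a₂ ∉ insert a₁ T := by simp [h₂, ha.symm]
    have e₁ : insert a₁ T ≠ {a₁, a₂} ∪ B ∪ C := ne_mem h (by simp)
    have e₂ : insert a₁ T ≠ {a₁, a₂} ∪ C := ne_mem h (by simp)
    have e₃ : insert a₁ T ≠ C := mem_ne (mem_insert_self _ _) hBC₁.2
    have e₄ : insert a₁ T ≠ B ∪ C := mem_ne (mem_insert_self _ _) ha₁
    simp only [uim, e₁, e₂, e₃, e₄, if_false]
    ring
  have u₂ : ∀ T, a₁ ∉ T → a₂ ∉ T → uim {a₁, a₂} B C (insert a₂ T) = 0 := fun T h₁ h₂ => by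
    have h : a₁ ∉ insert a₂ T := by simp [h₁, ha]
    have e₁ : insert a₂ T ≠ {a₁, a₂} ∪ B ∪ C := ne_mem h (by simp)
    have e₂ : insert a₂ T ≠ {a₁, a₂} ∪ C := ne_mem h (by simp)
    have e₃ : insert a₂ T ≠ C := mem_ne (mem_insert_self _ _) hBC₂.2
    have e₄ : insert a₂ T ≠ B ∪ C := mem_ne (mem_insert_self _ _) ha₂
    simp only [uim, e₁, e₂, e₃, e₄, if_false]
    ring
  have u₃ : ∀ T, a₁ ∉ T → a₂ ∉ T → uim {a₁, a₂} B C (insert a₁ (insert a₂ T)) =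
      (if T = B ∪ C then 1 else 0) - (if T = C then 1 else 0) := fun T h₁ h₂ => by
    have key : ∀ U : Finset α, a₁ ∉ U → a₂ ∉ U →
        (insert a₁ (insert a₂ T) = {a₁, a₂} ∪ U ↔ T = U) := fun U k₁ k₂ => by
      have e : ({a₁, a₂} : Finset α) ∪ U = insert a₁ (insert a₂ U) := by ext; simp
      rw [e]
      refine ⟨fun h => ?_, fun h => by rw [h]⟩
      have := congrArg (fun S => (S.erase a₁).erase a₂) h
      simpa [erase_insert, h₁, h₂, k₁, k₂, ha] using this
    have e₃ : insert a₁ (insert a₂ T) ≠ C := mem_ne (mem_insert_self _ _) hBC₁.2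
    have e₄ : insert a₁ (insert a₂ T) ≠ B ∪ C := mem_ne (mem_insert_self _ _) ha₁
    simp only [uim, union_assoc, key _ ha₁ ha₂, key _ hBC₁.2 hBC₂.2, e₃, e₄, if_false]
    ring
  have main : IsRep {a₁, a₂} B C θ ↔ ∀ S, uim {a₁, a₂} B C S =
      (netOutflow B (θ a₁) S - if a₁ ∈ S then netOutflow B (θ a₁) (S.erase a₁) else 0) +
        (netOutflow B (θ a₂) S - if a₂ ∈ S then netOutflow B (θ a₂) (S.erase a₂) else 0) := by
    refine ⟨fun h S => ?_, fun h => ⟨hsupp, fun S => ?_⟩⟩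
    · rw [h.2 S, sum_mul_uim_s9 hAB hsupp, sum_pair ha]
    · rw [h S, sum_mul_uim_s9 hAB hsupp, sum_pair ha]
  have s₀ : ∀ T, a₁ ∉ T → a₂ ∉ T →
      (netOutflow B (θ a₁) T - if a₁ ∈ T then netOutflow B (θ a₁) (T.erase a₁) else 0) +
        (netOutflow B (θ a₂) T - if a₂ ∈ T then netOutflow B (θ a₂) (T.erase a₂) else 0) =
      netOutflow B (F true) T + netOutflow B (F false) T := fun T h₁ h₂ => by
    simp [h₁, h₂, low₁, low₂]
  have s₁ : ∀ T, a₁ ∉ T → a₂ ∉ T →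
      (netOutflow B (θ a₁) (insert a₁ T) - if a₁ ∈ insert a₁ T then
          netOutflow B (θ a₁) ((insert a₁ T).erase a₁) else 0) +
        (netOutflow B (θ a₂) (insert a₁ T) - if a₂ ∈ insert a₁ T then
          netOutflow B (θ a₂) ((insert a₁ T).erase a₂) else 0) =
      netOutflow B (G true) T - netOutflow B (F true) T := fun T h₁ h₂ => by
    rw [z a₁ _ hn₁ (mem_insert_self _ _), high₂ T h₁, erase_insert h₁, low₁ T h₂]
    simp [h₂, ha.symm]
    ring
  have s₂ : ∀ T, a₁ ∉ T → a₂ ∉ T →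
      (netOutflow B (θ a₁) (insert a₂ T) - if a₁ ∈ insert a₂ T then
          netOutflow B (θ a₁) ((insert a₂ T).erase a₁) else 0) +
        (netOutflow B (θ a₂) (insert a₂ T) - if a₂ ∈ insert a₂ T then
          netOutflow B (θ a₂) ((insert a₂ T).erase a₂) else 0) =
      netOutflow B (G false) T - netOutflow B (F false) T := fun T h₁ h₂ => by
    rw [z a₂ _ hn₂ (mem_insert_self _ _), high₁ T h₂, erase_insert h₂, low₂ T h₁]
    simp [h₁, ha]
    ring
  have s₃ : ∀ T, a₁ ∉ T → a₂ ∉ T →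
      (netOutflow B (θ a₁) (insert a₁ (insert a₂ T)) - if a₁ ∈ insert a₁ (insert a₂ T) then
          netOutflow B (θ a₁) ((insert a₁ (insert a₂ T)).erase a₁) else 0) +
        (netOutflow B (θ a₂) (insert a₁ (insert a₂ T)) - if a₂ ∈ insert a₁ (insert a₂ T) then
          netOutflow B (θ a₂) ((insert a₁ (insert a₂ T)).erase a₂) else 0) =
      - netOutflow B (G false) T - netOutflow B (G true) T := fun T h₁ h₂ => by
    rw [z a₁ _ hn₁ (mem_insert_self _ _), z a₂ _ hn₂ (by simp),
      erase_insert (by simp [h₁, ha]), insert_comm a₁ a₂, erase_insert (by simp [h₂, ha.symm]),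
      high₁ T h₂, high₂ T h₁]
    simp
    ring
  rw [main]
  have hz : ∀ {H : Bool → α → Finset α → ℕ}, SupportedOn B C H → ∀ x T, ¬ T ⊆ B ∪ C →
      netOutflow B (H x) T = 0 := fun hH x T hT =>
    netOutflow_eq_zero_of_not_subset subset_union_left (fun b T h => (hH x b T h).2.2.1) hT
  constructor
  · intro H
    refine ⟨fun T => ?_, fun x T => ?_⟩
    · by_cases hT : T ⊆ B ∪ C
      · have h₁ : a₁ ∉ T := fun h => ha₁ (hT h)
        have h₂ : a₂ ∉ T := fun h => ha₂ (hT h)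
        rw [← s₀ T h₁ h₂, ← H T, u₀ T h₁ h₂]
      · have e₁ : T ≠ C := by rintro rfl; exact hT subset_union_right
        have e₂ : T ≠ B ∪ C := by rintro rfl; exact hT subset_rfl
        simp [hz hF _ T hT, e₁, e₂]
    · by_cases hT : T ⊆ B ∪ C
      · have h₁ : a₁ ∉ T := fun h => ha₁ (hT h)
        have h₂ : a₂ ∉ T := fun h => ha₂ (hT h)
        cases x
        · linarith [s₂ T h₁ h₂, H (insert a₂ T), u₂ T h₁ h₂]
        · linarith [s₁ T h₁ h₂, H (insert a₁ T), u₁ T h₁ h₂]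
      · rw [hz hF _ T hT, hz hG _ T hT]
  · rintro ⟨H, HG⟩ S
    obtain ⟨T, hT⟩ : ∃ T, T = (S.erase a₁).erase a₂ := ⟨_, rfl⟩
    have h₁ : a₁ ∉ T := by simp [hT]
    have h₂ : a₂ ∉ T := by simp [hT]
    by_cases m₁ : a₁ ∈ S <;> by_cases m₂ : a₂ ∈ S
    · obtain rfl : S = insert a₁ (insert a₂ T) := by
        rw [hT, insert_erase (mem_erase.2 ⟨ha.symm, m₂⟩), insert_erase m₁]
      rw [u₃ T h₁ h₂, s₃ T h₁ h₂, HG, HG]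
      linarith [H T]
    · obtain rfl : S = insert a₁ T := by
        rw [hT, erase_eq_of_notMem (by simp [m₂]), insert_erase m₁]
      rw [u₁ T h₁ h₂, s₁ T h₁ h₂, HG, sub_self]
    · obtain rfl : S = insert a₂ T := by
        rw [hT, erase_eq_of_notMem m₁, insert_erase m₂]
      rw [u₂ T h₁ h₂, s₂ T h₁ h₂, HG, sub_self]
    · obtain rfl : S = T := by
        rw [hT, erase_eq_of_notMem m₁, erase_eq_of_notMem m₂]
      rw [u₀ S h₁ h₂, s₀ S h₁ h₂, H]

theorem IsRep.exists_eq_assemble {θ : α → α → Finset α → ℕ} (ha : a₁ ≠ a₂)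
    (ha₁ : a₁ ∉ B ∪ C) (ha₂ : a₂ ∉ B ∪ C)
    (hθ : IsRep {a₁, a₂} B C θ) :
    ∃ F G, SupportedOn B C F ∧ SupportedOn B C G ∧ θ = assemble a₁ a₂ F G := by
  have hsub : ∀ {T : Finset α}, T ⊆ {a₁, a₂} ∪ B ∪ C → a₁ ∉ T → a₂ ∉ T → T ⊆ B ∪ C := by
    intro T hT h₁ h₂ a haT
    have := hT haT
    simp only [mem_union, mem_insert, mem_singleton] at this
    rcases this with ((rfl | rfl) | h) | h
    · exact absurd haT h₁
    · exact absurd haT h₂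
    · exact mem_union_left _ h
    · exact mem_union_right _ h
  let own : Bool → α := fun x => if x then a₁ else a₂
  have hown : ∀ x, own x ∉ B ∪ C ∧ own x ≠ own (!x) := by
    intro x
    cases x <;> simp_all [own, eq_comm]
  have hsub' : ∀ x {T : Finset α}, T ⊆ {a₁, a₂} ∪ B ∪ C → own x ∉ T → own (!x) ∉ T →
      T ⊆ B ∪ C := by
    intro x T h h₁ h₂
    cases x
    · exact hsub h h₂ h₁
    · exact hsub h h₁ h₂
  refine ⟨fun x b T => if own (!x) ∈ T then 0 else θ (own x) b T,
    fun x b T => if own x ∈ T then 0 else θ (own !x) b (insert (own x) T), ?_, ?_, ?_⟩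
  · intro x b T h
    simp only [ne_eq, ite_eq_left_iff, not_forall] at h
    obtain ⟨h₀, h⟩ := h
    obtain ⟨-, h₁, h₂, h₃, h₄, h₅⟩ := hθ.1 _ _ _ h
    exact ⟨h₁, h₂, hsub' x h₃ h₄ h₀, h₅⟩
  · intro x b T h
    simp only [ne_eq, ite_eq_left_iff, not_forall] at h
    obtain ⟨h₀, h⟩ := h
    obtain ⟨-, h₁, h₂, h₃, h₄, h₅⟩ := hθ.1 _ _ _ h
    refine ⟨h₁, fun a haC => ?_, hsub' x ((subset_insert _ _).trans h₃) h₀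
      (fun h => h₄ (mem_insert_of_mem h)), fun h => h₅ (mem_insert_of_mem h)⟩
    exact mem_of_mem_insert_of_ne (h₂ haC)
      fun e => (hown x).1 (mem_union_right _ (e ▸ haC))
  · funext a b Γ
    unfold assemble
    split_ifs with h₁ h₂ h₂ h₃
    · subst h₁
      simp [own, insert_erase h₂]
    · subst h₁
      simp [own, h₂]
    · subst h₂
      simp [own, insert_erase h₃]
    · subst h₂
      simp [own, h₃]
    · by_contra h
      have := (hθ.1 _ _ _ h).1
      simp [h₁, h₂] at this

theorem assemble_injective {F G F' G' : Bool → α → Finset α → ℕ} (ha : a₁ ≠ a₂)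
    (ha₁ : a₁ ∉ B ∪ C) (ha₂ : a₂ ∉ B ∪ C) (hF : SupportedOn B C F) (hG : SupportedOn B C G)
    (hF' : SupportedOn B C F') (hG' : SupportedOn B C G')
    (h : assemble a₁ a₂ F G = assemble a₁ a₂ F' G') : F = F' ∧ G = G' := by
  have h' : ∀ a b Γ, assemble a₁ a₂ F G a b Γ = assemble a₁ a₂ F' G' a b Γ := fun a b Γ => by rw [h]
  constructor
  · funext x b T
    cases x
    · by_cases hT : a₁ ∈ T
      · rw [hF.eq_zero _ ha₁ hT, hF'.eq_zero _ ha₁ hT]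
      · simpa [assemble, hT, ha.symm] using h' a₂ b T
    · by_cases hT : a₂ ∈ T
      · rw [hF.eq_zero _ ha₂ hT, hF'.eq_zero _ ha₂ hT]
      · simpa [assemble, hT] using h' a₁ b T
  · funext x b T
    cases x
    · by_cases hT : a₂ ∈ T
      · rw [hG.eq_zero _ ha₂ hT, hG'.eq_zero _ ha₂ hT]
      · simpa [assemble, hT] using h' a₁ b (insert a₂ T)
    · by_cases hT : a₁ ∈ T
      · rw [hG.eq_zero _ ha₁ hT, hG'.eq_zero _ ha₁ hT]
      · simpa [assemble, hT, ha.symm] using h' a₂ b (insert a₁ T)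

theorem supportedOn_pathEdges {P : List α} {c : List Bool}
    (h : C.val + (P : Multiset α) = (B ∪ C).val) (hP : ∀ b ∈ P, b ∈ B) :
    SupportedOn B C fun x => pathEdges x C c P := fun _ b _ hT =>
  have h' := pathEdges_ne_zero h hT
  ⟨hP b h'.1, h'.2⟩

theorem val_add_coe_eq_iff (hBC : Disjoint B C) (P : List α) :
    C.val + (P : Multiset α) = (B ∪ C).val ↔ P.Perm B.toList := by
  have : (B ∪ C).val = C.val + (B.toList : Multiset α) := by
    rw [coe_toList, union_comm, ← disjUnion_eq_union _ _ hBC.symm]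
    rfl
  rw [this, add_right_inj, Multiset.coe_eq_coe]

theorem isRep_iff_exists (ha : a₁ ≠ a₂) (ha₁ : a₁ ∉ B ∪ C) (ha₂ : a₂ ∉ B ∪ C)
    (hBC : Disjoint B C) (θ : α → α → Finset α → ℕ) :
    IsRep {a₁, a₂} B C θ ↔ ∃ P c Q, P.Perm B.toList ∧ Q.Perm P ∧
      SharesSwitches true C.val C.val c P Q ∧
        assemble a₁ a₂ (fun x => pathEdges x C c P) (fun x => pathEdges x C c Q) = θ := by
  constructor
  · intro h
    obtain ⟨F, G, hF, hG, rfl⟩ := h.exists_eq_assemble ha ha₁ ha₂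
    obtain ⟨hflow, hFG⟩ := (isRep_assemble_iff ha ha₁ ha₂ hF hG).1 h
    obtain ⟨c, P, hc, hP, hFP⟩ :=
      exists_eq_pathEdges subset_union_left subset_union_right hF hflow
    obtain ⟨c', Q, hc', hQ, hGQ⟩ :=
      exists_eq_pathEdges subset_union_left subset_union_right hG fun T => by
        rw [hFG, hFG, hflow]
    have hPB := (val_add_coe_eq_iff hBC P).1 hP
    have hQB := (val_add_coe_eq_iff hBC Q).1 hQ
    obtain ⟨rfl, hs⟩ := (netOutflow_pathEdges_eq_iff (B := B) (p := true)
      (fun b hb => mem_toList.1 (hPB.mem_iff.1 hb)) (fun b hb => mem_toList.1 (hQB.mem_iff.1 hb))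
      hP hQ hc hc' (hPB.trans hQB.symm).length_eq).1 fun T => by
        rw [← hFP, ← hGQ, hFG]
    exact ⟨P, c, Q, hPB, hQB.trans hPB.symm, hs, by rw [funext hFP, funext hGQ]⟩
  · rintro ⟨P, c, Q, hPB, hQP, hs, rfl⟩
    have hQB := hQP.trans hPB
    have hP := (val_add_coe_eq_iff hBC P).2 hPB
    have hQ := (val_add_coe_eq_iff hBC Q).2 hQB
    have mP : ∀ b ∈ P, b ∈ B := fun b hb => mem_toList.1 (hPB.mem_iff.1 hb)
    have mQ : ∀ b ∈ Q, b ∈ B := fun b hb => mem_toList.1 (hQB.mem_iff.1 hb)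
    obtain ⟨hc, hl⟩ := hs.length_eq
    have hc' := hc.trans hl.symm
    have key := (netOutflow_pathEdges_eq_iff (p := true) mP mQ hP hQ hc hc' hl.symm).2 ⟨rfl, hs⟩
    rw [isRep_assemble_iff ha ha₁ ha₂ (supportedOn_pathEdges hP mP) (supportedOn_pathEdges hQ mQ)]
    refine ⟨fun T => sum_netOutflow_pathEdges mP hP hc, fun x T => ?_⟩
    have k := sub_left_injective (key T)
    cases x
    · have e₁ := sum_netOutflow_pathEdges (T := T) mP hP hc
      have e₂ := sum_netOutflow_pathEdges (T := T) mQ hQ hc'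
      linarith
    · exact k.symm

end Fiber

theorem exists_finset_card_eq_two_mul {α : Type*} {r : ℕ → ℕ} (h0 : r 0 = 1)
    (hr : ∀ m, 1 ≤ m → r m = ∑ k ∈ Icc 1 m, k.factorial * r (m - k)) (P : List α)
    (hP : P.Nodup) (hne : P ≠ []) (s : Multiset α) :
    ∃ F : Finset (List Bool × List α),
      (∀ c Q, (c, Q) ∈ F ↔ Q.Perm P ∧ SharesSwitches true s s c P Q) ∧
        F.card = 2 * r P.length := by
  classical
  obtain ⟨F₁, hF₁, hc₁⟩ := exists_finset_sharesSwitches h0 hr P hP true s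
  obtain ⟨F₂, hF₂, hc₂⟩ := exists_finset_sharesSwitches h0 hr P hP false s
  refine ⟨F₁ ∪ F₂, fun c Q => ?_, ?_⟩
  · rw [mem_union, hF₁, hF₂, SharesSwitches.congr_color false true, ← or_and_right,
      and_iff_right_iff_imp]
    rintro -
    rcases c with _ | ⟨_ | _, c⟩ <;> simp
  · rw [card_union_of_disjoint, hc₁, hc₂, two_mul]
    rw [disjoint_left]
    rintro ⟨c, Q⟩ h₁ h₂
    rw [hF₁] at h₁
    rw [hF₂] at h₂
    have hl := h₁.2.2.length_eq.1
    rcases c with _ | ⟨_ | _, c⟩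
    · exact hne (List.length_eq_zero_iff.1 hl.symm)
    · simp at h₂
    · simp at h₁

theorem stmt9 {α : Type*} [DecidableEq α] (N A B C : Finset α) (m : ℕ)
    (hA : A ⊆ N) (hB : B ⊆ N) (hC : C ⊆ N)
    (hAB : Disjoint A B) (hAC : Disjoint A C) (hBC : Disjoint B C)
    (hcardA : A.card = 2) (hcardB : B.card = m) (hm : 1 ≤ m)
    (r₂ : ℕ → ℕ) (hr₂1 : r₂ 1 = 1)
    (hr₂ : ∀ k, 2 ≤ k →
      r₂ k = Nat.factorial k + ∑ j ∈ Finset.Icc 1 (k - 1), Nat.factorial j * r₂ (k - j)) :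
    {θ : α → α → Finset α → ℕ | IsRep A B C θ}.ncard
      = 2 * Nat.factorial m * r₂ m := by
  obtain ⟨a₁, a₂, ha, rfl⟩ := card_eq_two.1 hcardA
  have ha₁ : a₁ ∉ B ∪ C := by
    rw [mem_union, not_or]
    exact ⟨disjoint_left.1 hAB (by simp), disjoint_left.1 hAC (by simp)⟩
  have ha₂ : a₂ ∉ B ∪ C := by
    rw [mem_union, not_or]
    exact ⟨disjoint_left.1 hAB (by simp), disjoint_left.1 hAC (by simp)⟩
  let r : ℕ → ℕ := fun k => if k = 0 then 1 else r₂ k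
  have hr : ∀ m, 1 ≤ m → r m = ∑ k ∈ Icc 1 m, k.factorial * r (m - k) := by
    intro m hm
    obtain ⟨n, rfl⟩ : ∃ n, m = n + 1 := ⟨m - 1, by omega⟩
    rw [sum_Icc_succ_top (by omega)]
    rcases Nat.eq_zero_or_pos n with rfl | hn
    · simp [r, hr₂1]
    · have h : ∀ k ∈ Icc 1 n, k.factorial * r (n + 1 - k) = k.factorial * r₂ (n + 1 - k) := by
        intro k hk
        have : n + 1 - k ≠ 0 := by have := (mem_Icc.1 hk).2; omega
        simp [r, this]
      rw [sum_congr rfl h]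
      simp [r, hr₂ (n + 1) (by omega), add_comm]
  have key : ∀ P : List α, P.Perm B.toList → ∃ F : Finset (List Bool × List α),
      (∀ c Q, (c, Q) ∈ F ↔ Q.Perm P ∧ SharesSwitches true C.val C.val c P Q) ∧
        F.card = 2 * r₂ m := by
    intro P hP
    have hlen : P.length = m := by rw [hP.length_eq, length_toList, hcardB]
    obtain ⟨F, hF, hFc⟩ := exists_finset_card_eq_two_mul (r := r) (by simp [r]) hr P
      (hP.nodup_iff.2 B.nodup_toList) (by rintro rfl; simp at hlen; omega) C.val
    refine ⟨F, hF, ?_⟩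
    rw [hFc, hlen]
    simp [r, show m ≠ 0 by omega]
  choose! F hF hFc using key
  let D : Finset (Σ _ : List α, List Bool × List α) := B.toList.permutations.toFinset.sigma F
  have hD : ∀ P c Q, (⟨P, c, Q⟩ : Σ _ : List α, List Bool × List α) ∈ D ↔
      P.Perm B.toList ∧ Q.Perm P ∧ SharesSwitches true C.val C.val c P Q := by
    intro P c Q
    simp only [D, mem_sigma, List.mem_toFinset, List.mem_permutations]
    exact and_congr_right fun h => hF P h c Q
  let Φ : (Σ _ : List α, List Bool × List α) → α → α → Finset α → ℕ := fun x =>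
    assemble a₁ a₂ (fun y => pathEdges y C x.2.1 x.1) (fun y => pathEdges y C x.2.1 x.2.2)
  have himage : {θ : α → α → Finset α → ℕ | IsRep {a₁, a₂} B C θ} = Φ '' (D : Set _) := by
    ext θ
    rw [Set.mem_ofPred_eq, isRep_iff_exists ha ha₁ ha₂ hBC]
    constructor
    · rintro ⟨P, c, Q, h₁, h₂, h₃, rfl⟩
      exact ⟨⟨P, c, Q⟩, (hD P c Q).2 ⟨h₁, h₂, h₃⟩, rfl⟩
    · rintro ⟨⟨P, c, Q⟩, hx, rfl⟩
      obtain ⟨h₁, h₂, h₃⟩ := (hD P c Q).1 hx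
      exact ⟨P, c, Q, h₁, h₂, h₃, rfl⟩
  have hinj : Set.InjOn Φ (D : Set _) := by
    rintro ⟨P, c, Q⟩ hx ⟨P', c', Q'⟩ hx' h
    obtain ⟨hPB, hQP, hs⟩ := (hD P c Q).1 hx
    obtain ⟨hPB', hQP', hs'⟩ := (hD P' c' Q').1 hx'
    have sup : ∀ {P : List α} (c : List Bool), P.Perm B.toList →
        SupportedOn B C fun x => pathEdges x C c P := fun c hP =>
      supportedOn_pathEdges ((val_add_coe_eq_iff hBC _).2 hP)
        fun b hb => mem_toList.1 (hP.mem_iff.1 hb)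
    have val := fun P => (val_add_coe_eq_iff hBC P).2
    obtain ⟨e₁, e₂⟩ := assemble_injective ha ha₁ ha₂ (sup c hPB) (sup c (hQP.trans hPB))
      (sup c' hPB') (sup c' (hQP'.trans hPB')) h
    obtain ⟨rfl, rfl⟩ := pathEdges_injective (val P hPB) (val P' hPB') hs.length_eq.1
      hs'.length_eq.1 (congrFun e₁)
    obtain ⟨-, rfl⟩ := pathEdges_injective (val Q (hQP.trans hPB)) (val Q' (hQP'.trans hPB'))
      (hs.length_eq.1.trans hs.length_eq.2.symm) (hs'.length_eq.1.trans hs'.length_eq.2.symm)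
      (congrFun e₂)
    rfl
  rw [himage, hinj.ncard_image, Set.ncard_coe_finset, card_sigma,
    sum_congr rfl fun P hP => hFc P (by simpa using hP), sum_const,
    List.toFinset_card_of_nodup (List.nodup_permutations _ B.nodup_toList),
    List.length_permutations, length_toList, hcardB, smul_eq_mul]
  ring
end
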